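/- Suppose η > 0, k ≥ 3, 1 ≤ ℓ < k/2 and ℓ < d ≤ k−1. Then there exists n₀ such that every k-graph H on n ≥ n₀ vertices with (k−ℓ) ∣ n and δ_d(H) ≥ (max{t(k,d,ℓ), 1/3} + η)·C(n, k−d) contains a Hamilton ℓ-cycle; consequently h_d^ℓ(k) ≤ max{t(k,d,ℓ), 1/3}. -/

import Mathlib

/-- `H` is a `k`-uniform hypergraph (a `k`-graph) on the vertex set `Fin n`. -/
def IsKGraph (n k : ℕ) (H : Finset (Finset (Fin n))) : Prop :=
  ∀ e ∈ H, e.card = k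

/-- The degree `deg_H(S)` of a vertex set `S` in the `k`-graph `H`: the number of
`(k - |S|)`-sets `T` disjoint from `S` with `S ∪ T ∈ H`. -/
noncomputable def hDeg (n k : ℕ) (H : Finset (Finset (Fin n))) (S : Finset (Fin n)) : ℕ :=
  Nat.card {T : Finset (Fin n) // T.card = k - S.card ∧ Disjoint S T ∧ S ∪ T ∈ H}

/-- The minimum `d`-degree `δ_d(H)` of a `k`-graph `H` on `Fin n`. -/
noncomputable def minDeg (n k d : ℕ) (H : Finset (Finset (Fin n))) : ℕ :=
  sInf { m : ℕ | ∃ S : Finset (Fin n), S.card = d ∧ hDeg n k H S = m }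

/-- `H` contains a Hamilton `ℓ`-cycle: there is a cyclic ordering of all the vertices such
that the `n / (k - ℓ)` segments of `k` consecutive vertices starting at the positions
divisible by `k - ℓ` are all edges of `H` (hence every two consecutive edges share
exactly `ℓ` vertices). -/
def HasHamiltonCycle (n k l : ℕ) (H : Finset (Finset (Fin n))) : Prop :=
  ∃ f : ZMod n → Fin n, Function.Bijective f ∧
    ∀ j < n / (k - l),
      ((Finset.range k).image (fun i => f ((j * (k - l) + i : ℕ) : ZMod n))) ∈ H

/-- `f` enumerates (the vertices, in order, of) an `ℓ`-path with `t` edges in `H`: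
the `j`-th edge consists of the `k` consecutive vertices starting at position `j * (k - ℓ)`,
so every two consecutive edges share exactly `ℓ` vertices. -/
def IsLPath (n k l t : ℕ) (H : Finset (Finset (Fin n))) (f : ℕ → Fin n) : Prop :=
  Set.InjOn f (Set.Iio (t * (k - l) + l)) ∧
  ∀ j < t, ((Finset.range k).image (fun i => f (j * (k - l) + i))) ∈ H

/-- The vertex set of the `ℓ`-path with `t` edges enumerated by `f`. -/
def pathVerts (n k l t : ℕ) (f : ℕ → Fin n) : Finset (Fin n) :=
  (Finset.range (t * (k - l) + l)).image f

/-- The first `ℓ` vertices (as an ordered `ℓ`-set) of the path enumerated by `f`. -/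
def pathBeg (n l : ℕ) (f : ℕ → Fin n) : Fin l → Fin n := fun i => f (i : ℕ)

/-- The last `ℓ` vertices (as an ordered `ℓ`-set) of an `ℓ`-path with `t` edges
enumerated by `f`. -/
def pathEnd (n k l t : ℕ) (f : ℕ → Fin n) : Fin l → Fin n := fun i => f (t * (k - l) + (i : ℕ))

/-- `T` is a reachable set for the pair `{u, v}` (with parameter `i`): there are
vertex-disjoint `ℓ`-paths `P₁, …, Pᵢ` of length two covering exactly `T ∪ {u}` and
vertex-disjoint `ℓ`-paths `P₁', …, Pᵢ'` of length two covering exactly `T ∪ {v}`,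
where `P_j` and `P_j'` have the same (ordered) ends for all `j`. -/
def ReachSet (n k l i : ℕ) (H : Finset (Finset (Fin n))) (u v : Fin n)
    (T : Finset (Fin n)) : Prop :=
  ∃ P P' : Fin i → ℕ → Fin n,
    (∀ j, IsLPath n k l 2 H (P j)) ∧ (∀ j, IsLPath n k l 2 H (P' j)) ∧
    (∀ j j', j ≠ j' → Disjoint (pathVerts n k l 2 (P j)) (pathVerts n k l 2 (P j'))) ∧
    (∀ j j', j ≠ j' → Disjoint (pathVerts n k l 2 (P' j)) (pathVerts n k l 2 (P' j'))) ∧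
    (Finset.univ.biUnion (fun j => pathVerts n k l 2 (P j)) = insert u T) ∧
    (Finset.univ.biUnion (fun j => pathVerts n k l 2 (P' j)) = insert v T) ∧
    (∀ j, pathBeg n l (P j) = pathBeg n l (P' j) ∧
      pathEnd n k l 2 (P j) = pathEnd n k l 2 (P' j))

/-- `u` and `v` are `(β, i)`-reachable in the `k`-graph `H` on `n` vertices: there are at
least `β * n ^ ((2k - ℓ) i - 1)` sets `T` of size `(2k - ℓ) i - 1` that are reachable sets
for `{u, v}`. -/
def Reachable (n k l : ℕ) (H : Finset (Finset (Fin n))) (β : ℝ) (i : ℕ) (u v : Fin n) : Prop :=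
  β * (n : ℝ) ^ ((2 * k - l) * i - 1) ≤
    (Nat.card {T : Finset (Fin n) // T.card = (2 * k - l) * i - 1 ∧
      ReachSet n k l i H u v T} : ℝ)

/-- `H` contains a `Y_{k,2ℓ}`-tiling (vertex-disjoint copies of the `k`-graph consisting of
two edges intersecting in exactly `2ℓ` vertices) covering all but at most `u` vertices. -/
def HasYTilingCover (n l : ℕ) (H : Finset (Finset (Fin n))) (u : ℝ) : Prop :=
  ∃ (m : ℕ) (e₁ e₂ : Fin m → Finset (Fin n)),
    (∀ j, e₁ j ∈ H ∧ e₂ j ∈ H ∧ ((e₁ j) ∩ (e₂ j)).card = 2 * l) ∧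
    (∀ j j', j ≠ j' → Disjoint ((e₁ j) ∪ (e₂ j)) ((e₁ j') ∪ (e₂ j'))) ∧
    (n : ℝ) - ((Finset.univ.biUnion fun j => (e₁ j) ∪ (e₂ j)).card : ℝ) ≤ u

/-- The tiling threshold `t_d^ℓ(k, n, ε)`: the minimum `t` such that every `k`-graph `H`
on `n` vertices with `δ_d(H) ≥ t` contains a `Y_{k,2ℓ}`-tiling covering all but at most
`ε n` vertices. -/
noncomputable def tThreshold (k d l n : ℕ) (ε : ℝ) : ℕ :=
  sInf { t : ℕ | ∀ H : Finset (Finset (Fin n)), IsKGraph n k H →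
    t ≤ minDeg n k d H → HasYTilingCover n l H (ε * n) }

/-- `t(k,d,ℓ) := limsup_{ε → 0⁺} limsup_{n → ∞} t_d^ℓ(k,n,ε) / C(n, k-d)`. -/
noncomputable def tVal (k d l : ℕ) : ℝ :=
  Filter.limsup
    (fun ε : ℝ => Filter.limsup
      (fun n : ℕ => (tThreshold k d l n ε : ℝ) / (n.choose (k - d) : ℝ)) Filter.atTop)
    (nhdsWithin (0 : ℝ) (Set.Ioi (0 : ℝ)))

/-- The Dirac threshold `h_d^ℓ(k, n)`: the smallest `h` such that every `k`-graph `H` on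
`n` vertices with `δ_d(H) ≥ h` contains a Hamilton `ℓ`-cycle. -/
noncomputable def hThreshold (k d l n : ℕ) : ℕ :=
  sInf { h : ℕ | ∀ H : Finset (Finset (Fin n)), IsKGraph n k H →
    h ≤ minDeg n k d H → HasHamiltonCycle n k l H }

/-- `h_d^ℓ(k) := limsup_{n → ∞, (k-ℓ) ∣ n} h_d^ℓ(k,n) / C(n, k-d)`. -/
noncomputable def hVal (k d l : ℕ) : ℝ :=
  Filter.limsup (fun n : ℕ => (hThreshold k d l n : ℝ) / (n.choose (k - d) : ℝ))
    (Filter.atTop ⊓ Filter.principal { m : ℕ | (k - l) ∣ m })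

/-- The generalized binomial coefficient `C(x, r)` for a real `x`. -/
noncomputable def genChoose (x : ℝ) (r : ℕ) : ℝ :=
  (∏ i ∈ Finset.range r, (x - (i : ℝ))) / (r.factorial : ℝ)

/-- The number of sets in the `ε`-robust `r`-shadow `∂_ε^r(G)` of the `K`-graph `G` on
`Fin n`: the number of `(K - r)`-sets lying in more than `ε * n ^ r` edges of `G`. -/
noncomputable def shadowCard (n K r : ℕ) (G : Finset (Finset (Fin n))) (ε : ℝ) : ℕ :=
  Nat.card {F : Finset (Fin n) // F.card = K - r ∧ ε * (n : ℝ) ^ r < (hDeg n K G F : ℝ)}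

/-- `g` is an `S`-absorber, given as a `b`-tuple of distinct vertices avoiding `S`: the
tuple spans a family of `2k - 2ℓ + 1` vertex-disjoint `ℓ`-paths, and there is another
family of `2k - 2ℓ + 1` vertex-disjoint `ℓ`-paths, with the same ordered ends, spanning
the tuple together with `S`. -/
def IsAbsorberTuple (n k l b : ℕ) (H : Finset (Finset (Fin n))) (S : Finset (Fin n))
    (g : Fin b → Fin n) : Prop :=
  Function.Injective g ∧ (∀ i, g i ∉ S) ∧
  ∃ (t t' : Fin (2 * k - 2 * l + 1) → ℕ) (Q Q' : Fin (2 * k - 2 * l + 1) → ℕ → Fin n),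
    (∀ j, IsLPath n k l (t j) H (Q j)) ∧ (∀ j, IsLPath n k l (t' j) H (Q' j)) ∧
    (∀ j j', j ≠ j' → Disjoint (pathVerts n k l (t j) (Q j)) (pathVerts n k l (t j') (Q j'))) ∧
    (∀ j j', j ≠ j' →
      Disjoint (pathVerts n k l (t' j) (Q' j)) (pathVerts n k l (t' j') (Q' j'))) ∧
    (∀ j, pathBeg n l (Q j) = pathBeg n l (Q' j) ∧
      pathEnd n k l (t j) (Q j) = pathEnd n k l (t' j) (Q' j)) ∧
    Finset.univ.biUnion (fun j => pathVerts n k l (t' j) (Q' j)) = Finset.image g Finset.univ ∧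
    Finset.univ.biUnion (fun j => pathVerts n k l (t j) (Q j)) = Finset.image g Finset.univ ∪ S

namespace LCycle

set_option linter.unusedSectionVars false

/-- `LWalk l E A B c`: there is a walk from the `l`-set `A` to `B`, each step of which uses an edge
`e ∈ E` containing the current set and moves to an `l`-set of new vertices of `e`; the multiset `c`
records the vertices passed, not counting those of the start `A`. -/
inductive LWalk {V : Type*} [DecidableEq V] (l : ℕ) (E : Set (Finset V)) (A : Finset V) :
    Finset V → Multiset V → Prop
  | nil : LWalk l E A A 0
  | cons {B C e : Finset V} {c : Multiset V} : LWalk l E A B c → e ∈ E → B ⊆ e → C ⊆ e \ B →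
      C.card = l → LWalk l E A C (c + (e \ B).val)

section Walk

variable {V : Type*} [DecidableEq V] {l : ℕ} {E E' : Set (Finset V)} {A B C e : Finset V}
  {c c' : Multiset V}

lemma LWalk.single (he : e ∈ E) (hA : A ⊆ e) (hB : B ⊆ e \ A) (hl : B.card = l) :
    LWalk l E A B (e \ A).val := by
  simpa using LWalk.cons LWalk.nil he hA hB hl

lemma LWalk.trans (h : LWalk l E A B c) (h' : LWalk l E B C c') : LWalk l E A C (c + c') := by
  induction h' with
  | nil => simpa using h
  | cons _ he hB hC hl ih => rw [← add_assoc]; exact LWalk.cons ih he hB hC hl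

lemma LWalk.mono (hE : E ⊆ E') (h : LWalk l E A B c) : LWalk l E' A B c := by
  induction h with
  | nil => exact LWalk.nil
  | cons _ he hB hC hl ih => exact LWalk.cons ih (hE he) hB hC hl

lemma LWalk.end_le (h : LWalk l E A B c) : (B = A ∧ c = 0) ∨ (B.card = l ∧ B.val ≤ c) := by
  cases h with
  | nil => exact Or.inl ⟨rfl, rfl⟩
  | cons _ he hB hC hl => exact Or.inr ⟨hl, (Finset.val_le_iff.mpr hC).trans (Multiset.le_add_left _ _)⟩

lemma LWalk.end_le_of_ne (h : LWalk l E A B c) (hc : c ≠ 0) : B.val ≤ c := by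
  rcases h.end_le with h | h
  · exact absurd h.2 hc
  · exact h.2

lemma LWalk.card_end (h : LWalk l E A B c) (hA : A.card = l) : B.card = l := by
  cases h with
  | nil => exact hA
  | cons _ he hB hC hl => exact hl

lemma LWalk.dvd_card {k : ℕ} (hE : ∀ e ∈ E, e.card = k) (hA : A.card = l)
    (h : LWalk l E A B c) : (k - l) ∣ Multiset.card c := by
  induction h with
  | nil => simp
  | cons h' he hB hC hl ih =>
    rw [Multiset.card_add]
    refine dvd_add ih ?_
    rw [Finset.card_val, Finset.card_sdiff_of_subset hB, hE _ he, h'.card_end hA]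

lemma LWalk.exists_reverse {A : Finset V} (hA : A.card = l)
    (h : LWalk l E A B c) : ∃ c', LWalk l E B A c' ∧ Multiset.card c' = Multiset.card c := by
  induction h with
  | nil => exact ⟨0, LWalk.nil, rfl⟩
  | @cons B C e c h' he hB hC hl ih =>
    obtain ⟨c', h1, h2⟩ := ih
    have hBl := h'.card_end hA
    have hCe : C ⊆ e := hC.trans Finset.sdiff_subset
    have hBC : B ⊆ e \ C := by
      intro x hx
      refine Finset.mem_sdiff.mpr ⟨hB hx, fun hxC => ?_⟩
      exact (Finset.mem_sdiff.mp (hC hxC)).2 hx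
    refine ⟨_, (LWalk.single he hCe hBC hBl).trans h1, ?_⟩
    rw [Multiset.card_add, Multiset.card_add, h2, Finset.card_val, Finset.card_val,
      Finset.card_sdiff_of_subset hB, Finset.card_sdiff_of_subset hCe, hBl, hl, add_comm]

lemma map_sdiff_val {W : Type*} [DecidableEq W] {g : V → W} {e B : Finset V}
    (hg : Set.InjOn g e) (hB : B ⊆ e) :
    (e \ B).val.map g = (e.image g \ B.image g).val := by
  have h1 : (e \ B).image g = e.image g \ B.image g := by
    ext w
    simp only [Finset.mem_image, Finset.mem_sdiff]
    constructor
    · rintro ⟨a, ⟨ha, hb⟩, rfl⟩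
      refine ⟨⟨a, ha, rfl⟩, ?_⟩
      rintro ⟨b, hbB, hbe⟩
      exact hb (hg (hB hbB) ha hbe ▸ hbB)
    · rintro ⟨⟨a, ha, rfl⟩, hb⟩
      exact ⟨a, ⟨ha, fun h => hb ⟨a, h, rfl⟩⟩, rfl⟩
  rw [← h1, Finset.image_val_of_injOn]
  exact hg.mono (by simp)

lemma LWalk.map {W : Type*} [DecidableEq W] {g : V → W} {H : Set (Finset W)}
    (hg : ∀ e ∈ E, Set.InjOn g e ∧ e.image g ∈ H) (h : LWalk l E A B c) :
    LWalk l H (A.image g) (B.image g) (c.map g) := by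
  induction h with
  | nil => exact LWalk.nil
  | cons h' he hB hC hl ih =>
    rw [Multiset.map_add, map_sdiff_val (hg _ he).1 hB]
    refine LWalk.cons ih (hg _ he).2 (Finset.image_subset_image hB) ?_ ?_
    · intro x hx
      have := Finset.image_subset_image (f := g) hC hx
      obtain ⟨a, ha, rfl⟩ := Finset.mem_image.mp this
      rw [← Finset.mem_val, ← map_sdiff_val (hg _ he).1 hB, Multiset.mem_map]
      exact ⟨a, ha, rfl⟩
    · rw [Finset.card_image_of_injOn, hl]
      exact (hg _ he).1.mono (by simpa using hC.trans Finset.sdiff_subset)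

lemma exists_le_map_eq {α β : Type*} {f : α → β} {s : Multiset α} :
    ∀ {t : Multiset β}, t ≤ s.map f → ∃ s' ≤ s, s'.map f = t := by
  induction s using Multiset.induction_on with
  | empty => intro t ht; exact ⟨0, le_rfl, (Multiset.le_zero.mp ht).symm⟩
  | cons a s ih =>
    intro t ht
    classical
    rw [Multiset.map_cons] at ht
    by_cases hat : f a ∈ t
    · obtain ⟨t', rfl⟩ := Multiset.exists_cons_of_mem hat
      obtain ⟨s', hs', rfl⟩ := ih ((Multiset.cons_le_cons_iff _).mp ht)
      exact ⟨a ::ₘ s', Multiset.cons_le_cons _ hs', by simp⟩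
    · obtain ⟨s', hs', rfl⟩ := ih ((Multiset.le_cons_of_notMem hat).mp ht)
      exact ⟨s', hs'.trans (Multiset.le_cons_self _ _), rfl⟩

lemma exists_finset_le_map_eq {α β : Type*} {f : α → β} {s : Finset α} {t : Multiset β}
    (h : t ≤ s.val.map f) : ∃ s' ⊆ s, s'.val.map f = t := by
  obtain ⟨s', h1, h2⟩ := exists_le_map_eq h
  exact ⟨⟨s', Multiset.nodup_of_le h1 s.nodup⟩, Finset.val_le_iff.mp h1, h2⟩

lemma image_eq_of_map_val {α β : Type*} [DecidableEq β] {f : α → β} {s : Finset α} {t : Finset β}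
    (h : s.val.map f = t.val) : s.image f = t := by
  ext x
  rw [Finset.mem_image, ← Finset.mem_val, ← h]
  simp

lemma injOn_of_map_val {α β : Type*} {f : α → β} {s : Finset α} {t : Finset β}
    (h : s.val.map f = t.val) : Set.InjOn f s := by
  classical
  rw [← Finset.card_image_iff, image_eq_of_map_val h, ← Finset.card_val, ← h, Multiset.card_map,
    Finset.card_val]

lemma card_eq_of_map_val {α β : Type*} {f : α → β} {s : Finset α} {t : Finset β}
    (h : s.val.map f = t.val) : s.card = t.card := by
  rw [← Finset.card_val, ← Finset.card_val, ← h, Multiset.card_map]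

/-- The sets of vertices of a blow-up that project bijectively onto an edge. -/
def liftEdges {K : Type*} [DecidableEq K] (p : K → V) (E : Set (Finset V)) : Set (Finset K) :=
  {f | Set.InjOn p f ∧ f.image p ∈ E}

lemma LWalk.lift {K : Type*} [DecidableEq K] {p : K → V} (hl0 : 0 < l)
    (h : LWalk l E A B c) :
    ∀ {At X Bt : Finset K}, c ≠ 0 → At.val.map p = A.val → X.val.map p = c → Disjoint At X →
      Bt ⊆ X → Bt.val.map p = B.val → LWalk l (liftEdges p E) At Bt X.val := by
  induction h with
  | nil => intro _ _ _ h; exact absurd rfl h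
  | @cons B C e c h' he hB hC hl ih =>
    intro At X Ct _ hAt hX hd hCt hCtC
    -- choose the vertices of the last step
    have hle : (e \ B).val - C.val ≤ (X \ Ct).val.map p := by
      have h1 : X.val = (X \ Ct).val + Ct.val := by
        rw [Finset.sdiff_val, tsub_add_cancel_of_le (Finset.val_le_iff.mpr hCt)]
      rw [h1, Multiset.map_add, hCtC] at hX
      have h2 : (X \ Ct).val.map p = c + (e \ B).val - C.val := by
        rw [← hX, Multiset.add_sub_cancel_right]
      rw [h2]
      exact tsub_le_tsub_right (Multiset.le_add_left _ _) _
    obtain ⟨Q, hQ, hQm⟩ := exists_finset_le_map_eq hle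
    have hdQ : Disjoint Q Ct := Finset.disjoint_of_subset_left hQ Finset.sdiff_disjoint
    set P := Q ∪ Ct with hP
    have hPX : P ⊆ X := Finset.union_subset (hQ.trans Finset.sdiff_subset) hCt
    have hPval : P.val = Q.val + Ct.val := by
      rw [hP, ← Finset.disjUnion_eq_union _ _ hdQ]; rfl
    have hPm : P.val.map p = (e \ B).val := by
      rw [hPval, Multiset.map_add, hQm, hCtC, tsub_add_cancel_of_le (Finset.val_le_iff.mpr hC)]
    have hrest : (X \ P).val.map p = c := by
      have h1 : X.val = (X \ P).val + P.val := by
        rw [Finset.sdiff_val, tsub_add_cancel_of_le (Finset.val_le_iff.mpr hPX)]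
      rw [h1, Multiset.map_add, hPm] at hX
      exact (Multiset.add_left_inj).mp hX
    have hXsplit : X.val = (X \ P).val + P.val := by
      rw [Finset.sdiff_val, tsub_add_cancel_of_le (Finset.val_le_iff.mpr hPX)]
    -- the start of the last step
    have key : ∃ Bt : Finset K, Bt.val.map p = B.val ∧ Disjoint Bt P ∧
        LWalk l (liftEdges p E) At Bt (X \ P).val := by
      by_cases hc : c = 0
      · rcases h'.end_le with ⟨rfl, _⟩ | hBc
        · refine ⟨At, hAt, Finset.disjoint_of_subset_right hPX hd, ?_⟩
          have : (X \ P).val = 0 := by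
            rw [hc] at hrest
            simpa using hrest
          rw [this]
          exact LWalk.nil
        · rw [hc] at hBc
          have hB0 : B = ∅ := by simpa using hBc.2
          rw [hB0] at hBc
          simp at hBc
          omega
      · have hBc := h'.end_le_of_ne hc
        rw [← hrest] at hBc
        obtain ⟨Bt, hBt, hBtm⟩ := exists_finset_le_map_eq hBc
        refine ⟨Bt, hBtm, ?_, ih hc hAt hrest (Finset.disjoint_of_subset_right
          Finset.sdiff_subset hd) hBt hBtm⟩
        exact Finset.disjoint_of_subset_left hBt Finset.sdiff_disjoint
    obtain ⟨Bt, hBtm, hBd, hw⟩ := key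
    have hBPval : (Bt ∪ P).val = Bt.val + P.val := by
      rw [← Finset.disjUnion_eq_union _ _ hBd]; rfl
    have hem : (Bt ∪ P).val.map p = e.val := by
      rw [hBPval, Multiset.map_add, hBtm, hPm, Finset.sdiff_val, add_comm,
        tsub_add_cancel_of_le (Finset.val_le_iff.mpr hB)]
    have hsd : (Bt ∪ P) \ Bt = P := by
      rw [Finset.union_sdiff_left, Finset.sdiff_eq_self_of_disjoint hBd.symm]
    rw [hXsplit]
    nth_rewrite 2 [← hsd]
    refine LWalk.cons hw ⟨injOn_of_map_val hem, ?_⟩ Finset.subset_union_left ?_ ?_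
    · rw [image_eq_of_map_val hem]; exact he
    · rw [hsd]; exact Finset.subset_union_right
    · rw [card_eq_of_map_val hCtC, hl]

end Walk

section Path

variable {V : Type*} [DecidableEq V] {l : ℕ} {E : Set (Finset V)} {A B C e : Finset V}
  {c c' : Multiset V}

lemma union_val {s t : Finset V} (h : Disjoint s t) : (s ∪ t).val = s.val + t.val := by
  rw [← Finset.disjUnion_eq_union _ _ h]; rfl

/-- `K` is the vertex set of a path in `E` whose first and last `l` vertices form `A` and `B`. -/
def PathOn (l : ℕ) (E : Set (Finset V)) (A B K : Finset V) : Prop :=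
  A ⊆ K ∧ A.card = l ∧ LWalk l E A B (K \ A).val

lemma PathOn.end_subset {K : Finset V} (h : PathOn l E A B K) : B ⊆ K := by
  rcases h.2.2.end_le with h' | h'
  · rw [h'.1]; exact h.1
  · exact (Finset.val_le_iff.mp h'.2).trans Finset.sdiff_subset

lemma PathOn.card_end {K : Finset V} (h : PathOn l E A B K) : B.card = l :=
  h.2.2.card_end h.2.1

lemma PathOn.join {A' B' K K' R : Finset V} (h : PathOn l E A B K)
    (hR : LWalk l E B A' (R ∪ A').val) (h' : PathOn l E A' B' K') (hKR : Disjoint K R)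
    (hKK : Disjoint K K') (hRK : Disjoint R K') : PathOn l E A B' (K ∪ R ∪ K') := by
  refine ⟨?_, h.2.1, ?_⟩
  · intro x hx
    simp [h.1 hx]
  · have := (h.2.2.trans hR).trans h'.2.2
    have e1 : (K \ A).val + (R ∪ A').val = (K \ A ∪ (R ∪ A')).val := by
      refine (union_val (Disjoint.mono_left Finset.sdiff_subset ?_)).symm
      exact Finset.disjoint_union_right.mpr ⟨hKR, hKK.mono_right h'.1⟩
    have e2 : (K \ A).val + (R ∪ A').val + (K' \ A').val = (K \ A ∪ (R ∪ A') ∪ K' \ A').val := by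
      rw [e1, ← union_val]
      refine Finset.disjoint_union_left.mpr ⟨?_, Finset.disjoint_union_left.mpr ⟨?_, ?_⟩⟩
      · exact Finset.disjoint_of_subset_left Finset.sdiff_subset
          (Finset.disjoint_of_subset_right Finset.sdiff_subset hKK)
      · exact Finset.disjoint_of_subset_right Finset.sdiff_subset hRK
      · exact Finset.disjoint_sdiff
    rw [e2] at this
    convert this using 2
    ext x
    have hA' : x ∈ A' → x ∈ K' := fun hx => h'.1 hx
    have hA : x ∈ A → x ∈ K := fun hx => h.1 hx
    have d1 := fun hx : x ∈ K => Finset.disjoint_left.mp hKR hx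
    have d2 := fun hx : x ∈ K => Finset.disjoint_left.mp hKK hx
    simp only [Finset.mem_sdiff, Finset.mem_union]
    tauto

lemma PathOn.close {K R : Finset V} (h : PathOn l E A B K)
    (hR : LWalk l E B A (R ∪ A).val) (hKR : Disjoint K R) : LWalk l E A A (K ∪ R).val := by
  have := h.2.2.trans hR
  rw [← union_val] at this
  · convert this using 2
    ext x
    have hA : x ∈ A → x ∈ K := fun hx => h.1 hx
    simp only [Finset.mem_sdiff, Finset.mem_union]
    tauto
  · exact Finset.disjoint_union_right.mpr ⟨Finset.disjoint_of_subset_left Finset.sdiff_subset hKR,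
      Finset.sdiff_disjoint⟩

lemma LWalk.exists_list {k : ℕ} (hE : ∀ e ∈ E, e.card = k) (hlk : 2 * l ≤ k) (hA : A.card = l)
    {α : List V} (hα : (α : Multiset V) = A.val) (h : LWalk l E A B c) :
    ∀ γ : List V, (γ : Multiset V) = B.val → (c = 0 → γ = α) →
      ∃ (w : List V) (p : ℕ), (w : Multiset V) = A.val + c ∧ w.length = p * (k - l) + l ∧
        α <+: w ∧ γ <:+ w ∧ ∀ j < p, ((w.drop (j * (k - l))).take k).toFinset ∈ E := by
  induction h with
  | nil =>
    intro γ hγ h0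
    refine ⟨α, 0, by simpa using hα, ?_, List.prefix_rfl, ?_, by simp⟩
    · rw [← Multiset.coe_card, hα]; simpa using hA
    · rw [h0 rfl]
  | @cons B C e c h' he hB hC hl ih =>
    intro γ hγ _
    have hBl := h'.card_end hA
    obtain ⟨β, hβ, hβ0⟩ : ∃ β : List V, (β : Multiset V) = B.val ∧ (c = 0 → β = α) := by
      rcases h'.end_le with ⟨rfl, _⟩ | hBc
      · exact ⟨α, hα, fun _ => rfl⟩
      · by_cases hc : c = 0
        · refine ⟨α, ?_, fun _ => rfl⟩
          rw [hc] at hBc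
          have hB0 : B = ∅ := by simpa using hBc.2
          have : l = 0 := by rw [← hBl, hB0]; rfl
          have hA0 : A = ∅ := by rw [← Finset.card_eq_zero, hA, this]
          rw [hα, hA0, hB0]
        · exact ⟨B.toList, by simp, fun h => absurd h hc⟩
    obtain ⟨w, p, hw, hwl, hp, ⟨w0, hs⟩, hedge⟩ := ih β hβ hβ0
    obtain ⟨μ, hμ⟩ : ∃ μ : List V, (μ : Multiset V) = ((e \ B) \ C).val := ⟨_, Finset.coe_toList _⟩
    have hβl : β.length = l := by rw [← Multiset.coe_card, hβ]; exact hBl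
    have hγl : γ.length = l := by rw [← Multiset.coe_card, hγ]; exact hl
    have hμl : μ.length = k - l - l := by
      rw [← Multiset.coe_card, hμ, Finset.card_val, Finset.card_sdiff_of_subset hC,
        Finset.card_sdiff_of_subset hB, hE _ he, hBl, hl]
    have hμγ : ((μ ++ γ : List V) : Multiset V) = (e \ B).val := by
      rw [← Multiset.coe_add, hμ, hγ, Finset.sdiff_val (e \ B),
        tsub_add_cancel_of_le (Finset.val_le_iff.mpr hC)]
    have hμγl : (μ ++ γ).length = k - l := by
      rw [List.length_append, hμl, hγl]; omega
    refine ⟨w ++ (μ ++ γ), p + 1, ?_, ?_, ?_, ?_, ?_⟩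
    · rw [← Multiset.coe_add, hw, hμγ, add_assoc]
    · rw [List.length_append, hμγl, hwl]; ring
    · exact hp.trans (List.prefix_append _ _)
    · exact (List.suffix_append _ _).trans (List.suffix_append _ _)
    · intro j hj
      rcases Nat.lt_succ_iff_lt_or_eq.mp hj with hj | rfl
      · have h1 : j * (k - l) + k ≤ w.length := by
          rw [hwl]
          have : (j + 1) * (k - l) ≤ p * (k - l) := Nat.mul_le_mul_right _ hj
          rw [add_mul, one_mul] at this
          omega
        rw [List.drop_append_of_le_length (by omega), List.take_append_of_le_length]
        · exact hedge j hj
        · rw [List.length_drop]; omega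
      · have h0 : w0.length = j * (k - l) := by
          have := congrArg List.length hs
          rw [List.length_append, hβl, hwl] at this
          omega
        rw [← hs, List.append_assoc, List.drop_left' h0, List.take_of_length_le]
        · convert he
          ext x
          have h2 : x ∈ β ↔ x ∈ B := by rw [← Multiset.mem_coe, hβ]; rfl
          have h3 : x ∈ μ ++ γ ↔ x ∈ e \ B := by rw [← Multiset.mem_coe, hμγ]; rfl
          rw [List.mem_toFinset, List.mem_append, h2, h3, Finset.mem_sdiff]
          have := @hB x
          tauto
        · rw [List.length_append, hβl, hμγl]; omega

lemma hasHamiltonCycle_of_closed_walk {n k l : ℕ} (hl : 0 < l) (hlk : 2 * l ≤ k)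
    {H : Finset (Finset (Fin n))} (hH : IsKGraph n k H) {A : Finset (Fin n)} (hA : A.card = l)
    (h : LWalk l (H : Set (Finset (Fin n))) A A Finset.univ.val) : HasHamiltonCycle n k l H := by
  have hln : l ≤ n := by
    have := Finset.card_le_univ A
    rw [hA, Fintype.card_fin] at this
    exact this
  have : NeZero n := ⟨by omega⟩
  obtain ⟨w, p, hw, hwl, ⟨w2, hp⟩, ⟨w0, hs⟩, hedge⟩ :=
    h.exists_list (k := k) (fun e he => hH e he) hlk hA (Finset.coe_toList A) A.toList
      (Finset.coe_toList A) (fun _ => rfl)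
  have hαl : A.toList.length = l := by simpa using hA
  have hw0 : (w0 : Multiset (Fin n)) = Finset.univ.val := by
    rw [← hs, ← Multiset.coe_add, Finset.coe_toList, add_comm] at hw
    exact (Multiset.add_right_inj).mp hw
  have hw0l : w0.length = n := by
    rw [← Multiset.coe_card, hw0]; simp
  have hnp : n = p * (k - l) := by
    have := congrArg List.length hs
    rw [List.length_append, hαl, hwl, hw0l] at this
    omega
  have hnd : w0.Nodup := by
    rw [← Multiset.coe_nodup, hw0]; exact Finset.univ.nodup
  have hlt : ∀ z : ZMod n, z.val < w0.length := fun z => by rw [hw0l]; exact ZMod.val_lt z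
  refine ⟨fun z => w0[z.val]'(hlt z), ?_, ?_⟩
  · rw [Fintype.bijective_iff_injective_and_card]
    refine ⟨fun a b hab => ?_, by simp [ZMod.card]⟩
    exact ZMod.val_injective n ((hnd.getElem_inj_iff).mp hab)
  · intro j hj
    have hjp : j < p := by
      rw [hnp, Nat.mul_div_cancel _ (by omega)] at hj
      exact hj
    refine Eq.subst (motive := fun s => s ∈ H) ?_ (hedge j hjp)
    symm
    have hjk : j * (k - l) + k ≤ n + l := by
      have : (j + 1) * (k - l) ≤ p * (k - l) := Nat.mul_le_mul_right _ hjp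
      rw [add_mul, one_mul, ← hnp] at this
      omega
    have hwl' : w.length = n + l := by rw [hwl, ← hnp]
    have key : ∀ i, (hi : i < n + l) →
        w0[((i : ℕ) : ZMod n).val]'(hlt _) = w[i]'(by omega) := by
      intro i hi
      rcases lt_or_ge i n with hin | hin
      · simp only [ZMod.val_natCast, Nat.mod_eq_of_lt hin]
        subst hs
        rw [List.getElem_append_left]
      · have hmod : i % n = i - n := by
          rw [Nat.mod_eq_sub_mod hin]
          rcases lt_or_ge (i - n) n with h | h
          · exact Nat.mod_eq_of_lt h
          · omega
        simp only [ZMod.val_natCast, hmod]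
        have h1 : w[i]'(by omega) = A.toList[i - n]'(by omega) := by
          subst hs
          rw [List.getElem_append_right (by omega)]
          simp only [hw0l]
        have h2 : w[i - n]'(by omega) = A.toList[i - n]'(by omega) := by
          subst hp
          rw [List.getElem_append_left]
        have h3 : w[i - n]'(by omega) = w0[i - n]'(by omega) := by
          subst hs
          rw [List.getElem_append_left]
        rw [h1, ← h2, h3]
    ext x
    rw [Finset.mem_image, List.mem_toFinset, List.mem_iff_getElem]
    constructor
    · rintro ⟨i, hi, rfl⟩
      rw [Finset.mem_range] at hi
      refine ⟨i, ?_, ?_⟩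
      · rw [List.length_take, List.length_drop]; omega
      · rw [List.getElem_take, List.getElem_drop]
        exact (key _ (by omega)).symm
    · rintro ⟨i, hi, rfl⟩
      rw [List.length_take, List.length_drop] at hi
      refine ⟨i, Finset.mem_range.mpr (by omega), ?_⟩
      rw [List.getElem_take, List.getElem_drop]
      exact key _ (by omega)

end Path

/-- The number of elements of a type with a given property, as a real number. -/
noncomputable def cnt {X : Type} (P : X → Prop) : ℝ := (Nat.card {x // P x} : ℝ)

section Count

variable {X Y V : Type} [Fintype X] [Fintype Y] [Fintype V]

lemma cnt_eq_sum (P : X → Prop) [DecidablePred P] :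
    cnt P = ∑ x, if P x then (1 : ℝ) else 0 := by
  rw [cnt, Nat.card_eq_fintype_card, Fintype.card_subtype, Finset.card_filter]
  push_cast
  rfl

lemma cnt_nonneg (P : X → Prop) : 0 ≤ cnt P := Nat.cast_nonneg _

lemma cnt_mono {P Q : X → Prop} (h : ∀ x, P x → Q x) : cnt P ≤ cnt Q := by
  classical
  rw [cnt_eq_sum, cnt_eq_sum]
  refine Finset.sum_le_sum fun x _ => ?_
  by_cases hP : P x
  · rw [if_pos hP, if_pos (h x hP)]
  · rw [if_neg hP]; split_ifs <;> norm_num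

lemma cnt_true : cnt (fun _ : X => True) = Fintype.card X := by
  classical
  rw [cnt_eq_sum]; simp

lemma cnt_le_card (P : X → Prop) : cnt P ≤ Fintype.card X := by
  rw [← cnt_true]; exact cnt_mono fun _ _ => trivial

lemma cnt_or_le (P Q : X → Prop) : cnt (fun x => P x ∨ Q x) ≤ cnt P + cnt Q := by
  classical
  rw [cnt_eq_sum, cnt_eq_sum, cnt_eq_sum, ← Finset.sum_add_distrib]
  refine Finset.sum_le_sum fun x _ => ?_
  by_cases hP : P x <;> by_cases hQ : Q x <;> simp [hP, hQ]

lemma cnt_exists_le {ι : Type} [Fintype ι] (P : ι → X → Prop) :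
    cnt (fun x => ∃ i, P i x) ≤ ∑ i, cnt (P i) := by
  classical
  simp_rw [cnt_eq_sum]
  rw [Finset.sum_comm]
  refine Finset.sum_le_sum fun x _ => ?_
  split_ifs with h
  · obtain ⟨i, hi⟩ := h
    calc (1 : ℝ) = if P i x then 1 else 0 := by rw [if_pos hi]
      _ ≤ _ := Finset.single_le_sum (f := fun i => if P i x then (1 : ℝ) else 0)
        (fun j _ => by split_ifs <;> norm_num) (Finset.mem_univ i)
  · exact Finset.sum_nonneg fun j _ => by split_ifs <;> norm_num

lemma cnt_and_ge (P Q : X → Prop) :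
    cnt P - cnt (fun x => ¬ Q x) ≤ cnt (fun x => P x ∧ Q x) := by
  have : cnt P ≤ cnt (fun x => (P x ∧ Q x) ∨ ¬ Q x) := cnt_mono fun x hx => by tauto
  linarith [cnt_or_le (fun x => P x ∧ Q x) (fun x => ¬ Q x)]

omit [Fintype X] [Fintype Y] in
lemma cnt_equiv (e : X ≃ Y) (P : Y → Prop) : cnt (fun x => P (e x)) = cnt P := by
  rw [cnt, cnt, Nat.card_congr (e.subtypeEquiv fun a => Iff.rfl)]

lemma cnt_congr {P Q : X → Prop} (h : ∀ x, P x ↔ Q x) : cnt P = cnt Q := by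
  rw [show P = Q from funext fun x => propext (h x)]

lemma cnt_prod (P : X → Y → Prop) : cnt (fun z : X × Y => P z.1 z.2) = ∑ x, cnt (P x) := by
  classical
  simp_rw [cnt_eq_sum]
  rw [Fintype.sum_prod_type]

lemma cnt_prod' (P : X → Y → Prop) :
    cnt (fun z : X × Y => P z.1 z.2) = ∑ y, cnt (fun x => P x y) := by
  classical
  simp_rw [cnt_eq_sum]
  rw [Fintype.sum_prod_type_right]

lemma cnt_pi {ι : Type} [Fintype ι] {Z : ι → Type} [∀ i, Fintype (Z i)]
    (P : ∀ i, Z i → Prop) : cnt (fun f : ∀ i, Z i => ∀ i, P i (f i)) = ∏ i, cnt (P i) := by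
  classical
  unfold cnt
  rw [Nat.card_congr (Equiv.subtypePiEquivPi (p := fun i => P i)), Nat.card_pi]
  push_cast
  rfl

lemma exists_of_cnt_pos {P : X → Prop} (h : 0 < cnt P) : ∃ x, P x := by
  by_contra hn
  push Not at hn
  have : IsEmpty {x // P x} := ⟨fun x => hn x x.2⟩
  rw [cnt, Nat.card_eq_zero.mpr (Or.inl this)] at h
  simp at h

lemma cnt_and_prod_ge {P : X → Prop} {Q : X → Y → Prop} {a b : ℝ} (hb : 0 ≤ b)
    (hP : a ≤ cnt P) (hQ : ∀ x, P x → b ≤ cnt (Q x)) :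
    a * b ≤ cnt (fun z : X × Y => P z.1 ∧ Q z.1 z.2) := by
  classical
  rw [cnt_prod (fun x y => P x ∧ Q x y)]
  calc a * b ≤ cnt P * b := mul_le_mul_of_nonneg_right hP hb
    _ = ∑ x, if P x then b else 0 := by
      rw [cnt_eq_sum, Finset.sum_mul]
      simp
    _ ≤ _ := Finset.sum_le_sum fun x _ => by
      split_ifs with h
      · exact (hQ x h).trans (cnt_mono fun y hy => ⟨h, hy⟩)
      · exact cnt_nonneg _

lemma cnt_blowup_one (Q : X → V → Prop) {τ : ℝ} (hτ : 0 ≤ τ) (r : ℕ)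
    (h : τ * (Fintype.card X * Fintype.card V) ≤ cnt (fun z : X × V => Q z.1 z.2)) :
    τ ^ r * (Fintype.card X * (Fintype.card V : ℝ) ^ r) ≤
      cnt (fun z : X × (Fin r → V) => ∀ s, Q z.1 (z.2 s)) := by
  classical
  rw [cnt_prod (fun x (v : Fin r → V) => ∀ s, Q x (v s))]
  have h1 : ∀ x, cnt (fun v : Fin r → V => ∀ s, Q x (v s)) = cnt (Q x) ^ r := by
    intro x
    rw [cnt_pi (fun (_ : Fin r) v => Q x v)]
    simp
  simp_rw [h1]
  rw [cnt_prod] at h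
  rcases Nat.eq_zero_or_pos (Fintype.card X) with h0 | h0
  · rw [h0]; simp
    exact Finset.sum_nonneg fun x _ => pow_nonneg (cnt_nonneg _) _
  cases r with
  | zero => simp
  | succ r =>
    have hX : (0 : ℝ) < Fintype.card X := by exact_mod_cast h0
    have := pow_sum_div_card_le_sum_pow (s := Finset.univ) (f := fun x => cnt (Q x)) (n := r)
      (fun x _ => cnt_nonneg _)
    refine le_trans ?_ this
    rw [Finset.card_univ, le_div_iff₀ (by positivity)]
    calc τ ^ (r + 1) * (Fintype.card X * (Fintype.card V : ℝ) ^ (r + 1)) * (Fintype.card X) ^ r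
        = (τ * (Fintype.card X * Fintype.card V)) ^ (r + 1) := by ring
      _ ≤ _ := by gcongr

lemma cnt_blowup_fin (r : ℕ) (p : ℕ) : ∀ (X : Type) [Fintype X] (Q : X → (Fin p → V) → Prop)
    {τ : ℝ}, 0 ≤ τ →
    τ * (Fintype.card X * (Fintype.card V : ℝ) ^ p) ≤
      cnt (fun z : X × (Fin p → V) => Q z.1 z.2) →
    τ ^ r ^ p * (Fintype.card X * (Fintype.card V : ℝ) ^ (p * r)) ≤
      cnt (fun z : X × (Fin p → Fin r → V) => ∀ σ : Fin p → Fin r, Q z.1 fun i => z.2 i (σ i)) := by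
  induction p with
  | zero =>
    intro X _ Q τ hτ h
    simp only [pow_zero, pow_one, Nat.zero_mul] at h ⊢
    refine h.trans (le_of_eq ?_)
    let e : X × (Fin 0 → V) ≃ X × (Fin 0 → Fin r → V) :=
      Equiv.prodCongr (Equiv.refl X) (Equiv.ofUnique _ _)
    rw [← cnt_equiv e]
    refine cnt_congr fun z => ?_
    have : ∀ f : Fin 0 → V, f = z.2 := fun f => Subsingleton.elim _ _
    constructor
    · intro hz σ; rw [this (fun i => (e z).2 i (σ i))]; exact hz
    · intro hz
      have := hz Fin.elim0
      rwa [‹∀ f : Fin 0 → V, f = z.2› (fun i => (e z).2 i (Fin.elim0 i))] at this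
  | succ p ih =>
    intro X _ Q τ hτ h
    let e1 : (X × V) × (Fin p → V) ≃ X × (Fin (p + 1) → V) :=
      (Equiv.prodAssoc X V _).trans (Equiv.prodCongr (Equiv.refl X) (Fin.consEquiv fun _ => V))
    have h1 := ih (X × V) (fun z f => Q z.1 (Fin.cons z.2 f)) hτ (by
      rw [← cnt_equiv e1] at h
      refine le_trans (le_of_eq ?_) (h.trans (cnt_mono fun z hz => hz))
      rw [Fintype.card_prod]; push_cast; ring)
    let e2 : (X × (Fin p → Fin r → V)) × V ≃ (X × V) × (Fin p → Fin r → V) :=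
      ⟨fun z => ((z.1.1, z.2), z.1.2), fun z => ((z.1.1, z.2), z.1.2), fun _ => rfl, fun _ => rfl⟩
    rw [← cnt_equiv e2] at h1
    have h2 := cnt_blowup_one (X := X × (Fin p → Fin r → V)) (V := V)
      (fun z v => ∀ σ : Fin p → Fin r, Q z.1 (Fin.cons v fun i => z.2 i (σ i)))
      (τ := τ ^ r ^ p) (by positivity) r (by
        refine le_trans (le_of_eq ?_) (h1.trans (cnt_mono fun z hz => hz))
        rw [Fintype.card_prod, Fintype.card_prod, Fintype.card_fun, Fintype.card_fun,
          Fintype.card_fin, Fintype.card_fin]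
        push_cast
        ring)
    let e3 : (X × (Fin p → Fin r → V)) × (Fin r → V) ≃ X × (Fin (p + 1) → Fin r → V) :=
      ((Equiv.prodAssoc X _ _).trans (Equiv.prodCongr (Equiv.refl X)
        ((Equiv.prodComm _ _).trans (Fin.consEquiv fun _ => Fin r → V))))
    rw [← cnt_equiv e3]
    refine le_trans (le_of_eq ?_) (h2.trans (cnt_mono fun z hz σ => ?_))
    · rw [Fintype.card_prod, Fintype.card_fun, Fintype.card_fun,
          Fintype.card_fin, Fintype.card_fin]
      push_cast
      ring
    · have := hz (σ 0) (fun i => σ i.succ)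
      have hfe : (fun i => (e3 z).2 i (σ i)) =
          Fin.cons (z.2 (σ 0)) fun i => z.1.2 i (σ i.succ) := by
        funext i
        refine Fin.cases ?_ (fun j => ?_) i <;> rfl
      rw [hfe]
      exact this

lemma cnt_blowup {ν : Type} [Fintype ν] (r : ℕ) (Q : (ν → V) → Prop) {τ : ℝ} (hτ : 0 ≤ τ)
    (h : τ * (Fintype.card V : ℝ) ^ (Fintype.card ν) ≤ cnt Q) :
    τ ^ r ^ (Fintype.card ν) * (Fintype.card V : ℝ) ^ (Fintype.card ν * r) ≤
      cnt (fun g : ν × Fin r → V => ∀ σ : ν → Fin r, Q fun i => g (i, σ i)) := by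
  classical
  let e := Fintype.equivFin ν
  let e0 : (Fin (Fintype.card ν) → V) ≃ (ν → V) := Equiv.arrowCongr e.symm (Equiv.refl V)
  have h1 := cnt_blowup_fin (V := V) r (Fintype.card ν) Unit (fun _ f => Q (e0 f)) hτ (by
    rw [← cnt_equiv e0, ← cnt_equiv (Equiv.punitProd.{0, 0} (Fin (Fintype.card ν) → V))] at h
    simpa using h)
  let e1 : Unit × (Fin (Fintype.card ν) → Fin r → V) ≃ (ν × Fin r → V) :=
    (Equiv.punitProd.{0, 0} _).trans ((Equiv.arrowCongr e.symm (Equiv.refl _)).trans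
      (Equiv.curry _ _ _).symm)
  rw [← cnt_equiv e1]
  refine le_trans (le_of_eq (by simp)) (h1.trans (cnt_mono fun z hz σ => ?_))
  have := hz (fun i => σ (e.symm i))
  convert this using 2
  simp [e1, e0, Equiv.curry, Equiv.punitProd]

lemma cnt_eq_coord_mul_le {β : Type} [Fintype β] {i j : β} (hij : i ≠ j) :
    cnt (fun g : β → V => g i = g j) * Fintype.card V ≤ (Fintype.card V : ℝ) ^ Fintype.card β := by
  classical
  have : Function.Injective
      (fun z : {g : β → V // g i = g j} × V => Function.update z.1.1 i z.2) := by
    rintro ⟨⟨g, hg⟩, v⟩ ⟨⟨g', hg'⟩, v'⟩ h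
    simp only at h
    have h1 : ∀ b, b ≠ i → g b = g' b := by
      intro b hb
      have := congrFun h b
      rwa [Function.update_of_ne hb, Function.update_of_ne hb] at this
    have h2 : v = v' := by simpa using congrFun h i
    have h3 : g = g' := by
      ext b
      by_cases hb : b = i
      · rw [hb, hg, hg', h1 j hij.symm]
      · exact h1 b hb
    subst h2 h3; rfl
  have := Nat.card_le_card_of_injective _ this
  rw [Nat.card_prod, Nat.card_fun, Nat.card_eq_fintype_card (α := V),
    Nat.card_eq_fintype_card (α := β)] at this
  unfold cnt
  exact_mod_cast this

lemma cnt_mem_coord_mul_le {β : Type} [Fintype β] (i : β) (F : Finset V) :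
    cnt (fun g : β → V => g i ∈ F) * Fintype.card V ≤
      F.card * (Fintype.card V : ℝ) ^ Fintype.card β := by
  classical
  have : Function.Injective (fun z : {g : β → V // g i ∈ F} × V =>
      ((⟨z.1.1 i, z.1.2⟩ : F), Function.update z.1.1 i z.2)) := by
    rintro ⟨⟨g, hg⟩, v⟩ ⟨⟨g', hg'⟩, v'⟩ h
    simp only [Prod.mk.injEq, Subtype.mk.injEq] at h
    obtain ⟨h0, h⟩ := h
    have h2 : v = v' := by simpa using congrFun h i
    have h3 : g = g' := by
      ext b
      by_cases hb : b = i
      · rw [hb, h0]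
      · have := congrFun h b
        rwa [Function.update_of_ne hb, Function.update_of_ne hb] at this
    subst h2 h3; rfl
  have := Nat.card_le_card_of_injective _ this
  rw [Nat.card_prod, Nat.card_prod, Nat.card_fun, Nat.card_eq_fintype_card (α := V),
    Nat.card_eq_fintype_card (α := β), Nat.card_eq_fintype_card (α := F), Fintype.card_coe] at this
  unfold cnt
  exact_mod_cast this

/-- Most maps are injective and avoid a small set. -/
lemma cnt_inj_avoid {β : Type} [Fintype β] (Q : (β → V) → Prop) (F : Finset V) {τ : ℝ}
    (h : τ * (Fintype.card V : ℝ) ^ Fintype.card β ≤ cnt Q)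
    (hF : (Fintype.card β : ℝ) ^ 2 + Fintype.card β * F.card ≤ τ / 2 * Fintype.card V)
    (hV : 0 < Fintype.card V) :
    τ / 2 * (Fintype.card V : ℝ) ^ Fintype.card β ≤
      cnt (fun g => Q g ∧ Function.Injective g ∧ ∀ i, g i ∉ F) := by
  classical
  set n : ℝ := (Fintype.card V : ℝ) with hndef
  set b : ℝ := (Fintype.card β : ℝ) with hbdef
  have hn : 0 < n := by simpa [n] using hV
  have h1 := cnt_and_ge Q (fun g => Function.Injective g ∧ ∀ i, g i ∉ F)
  have h2 : cnt (fun g : β → V => ¬ (Function.Injective g ∧ ∀ i, g i ∉ F)) ≤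
      cnt (fun g : β → V => (∃ p : β × β, p.1 ≠ p.2 ∧ g p.1 = g p.2) ∨ ∃ i, g i ∈ F) := by
    refine cnt_mono fun g hg => ?_
    rw [not_and_or] at hg
    rcases hg with hg | hg
    · left
      unfold Function.Injective at hg
      push Not at hg
      obtain ⟨a, c, h1, h2⟩ := hg
      exact ⟨(a, c), h2, h1⟩
    · right; push Not at hg; exact hg
  have h3 : cnt (fun g : β → V => ∃ p : β × β, p.1 ≠ p.2 ∧ g p.1 = g p.2) * n ≤
      b ^ 2 * n ^ Fintype.card β := by
    calc _ ≤ (∑ p : β × β, cnt (fun g : β → V => p.1 ≠ p.2 ∧ g p.1 = g p.2)) * n :=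
          mul_le_mul_of_nonneg_right (cnt_exists_le _) hn.le
      _ = ∑ p : β × β, cnt (fun g : β → V => p.1 ≠ p.2 ∧ g p.1 = g p.2) * n := Finset.sum_mul ..
      _ ≤ ∑ p : β × β, n ^ Fintype.card β := by
        refine Finset.sum_le_sum fun p _ => ?_
        by_cases hp : p.1 = p.2
        · have : cnt (fun g : β → V => p.1 ≠ p.2 ∧ g p.1 = g p.2) = 0 := by
            rw [cnt_eq_sum]; simp [hp]
          rw [this, zero_mul]; positivity
        · refine le_trans (mul_le_mul_of_nonneg_right (cnt_mono fun g hg => hg.2) hn.le) ?_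
          exact cnt_eq_coord_mul_le hp
      _ = b ^ 2 * n ^ Fintype.card β := by
        simp only [Finset.sum_const, Finset.card_univ, Fintype.card_prod, nsmul_eq_mul, Nat.cast_mul]
        ring
  have h4 : cnt (fun g : β → V => ∃ i, g i ∈ F) * n ≤ b * F.card * n ^ Fintype.card β := by
    calc _ ≤ (∑ i, cnt (fun g : β → V => g i ∈ F)) * n :=
          mul_le_mul_of_nonneg_right (cnt_exists_le _) hn.le
      _ = ∑ i, cnt (fun g : β → V => g i ∈ F) * n := Finset.sum_mul ..
      _ ≤ ∑ i : β, F.card * n ^ Fintype.card β :=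
        Finset.sum_le_sum fun i _ => cnt_mem_coord_mul_le i F
      _ = _ := by simp [b]; ring
  have h5 := h2.trans (cnt_or_le _ _)
  have h6 : cnt (fun g : β → V => ¬ (Function.Injective g ∧ ∀ i, g i ∉ F)) * n ≤
      (τ / 2 * n ^ Fintype.card β) * n := by
    calc _ ≤ (b ^ 2 + b * F.card) * n ^ Fintype.card β := by nlinarith
      _ ≤ (τ / 2 * n) * n ^ Fintype.card β := mul_le_mul_of_nonneg_right hF (by positivity)
      _ = _ := by ring
  have h7 := le_of_mul_le_mul_right h6 hn
  linarith

end Count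

section Generic

variable {ι : Type} [DecidableEq ι]

/-- The set system `E` on `ι` behaves on `X` like a `k`-graph in which every `d`-set is covered. -/
structure IsGadget (k l d : ℕ) (E : Set (Finset ι)) (X : Finset ι) : Prop where
  hl : 1 ≤ l
  hlk : 2 * l < k
  hld : l < d
  card_edge : ∀ e ∈ E, e.card = k
  exists_edge : ∀ D ⊆ X, D.card = d → ∃ e ∈ E, D ⊆ e
  card_inter : ∀ e ∈ E, d ≤ (e ∩ X).card
  card_X : d ≤ X.card

/-- Two sets joined by a walk with an even number of steps. -/
def EvenConn (k l : ℕ) (E : Set (Finset ι)) (A B : Finset ι) : Prop :=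
  ∃ c m, LWalk l E A B c ∧ Multiset.card c = m * (2 * (k - l))

lemma EvenConn.trans {k l : ℕ} {E : Set (Finset ι)} {A B C : Finset ι}
    (h : EvenConn k l E A B) (h' : EvenConn k l E B C) : EvenConn k l E A C := by
  obtain ⟨c, m, h1, h2⟩ := h
  obtain ⟨c', m', h1', h2'⟩ := h'
  exact ⟨c + c', m + m', h1.trans h1', by rw [Multiset.card_add, h2, h2']; ring⟩

lemma card_sdiff_edge {k l : ℕ} {e A : Finset ι} (he : e.card = k) (hA : A.card = l) (hAe : A ⊆ e) :
    (e \ A).card = k - l := by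
  rw [Finset.card_sdiff_of_subset hAe, he, hA]

/-- A relation on `l`-sets that holds for pairs differing in one element holds for all pairs. -/
lemma johnson_connected {l : ℕ} {Y : Finset ι} {R : Finset ι → Finset ι → Prop}
    (hR : ∀ A B, A ⊆ Y → B ⊆ Y → A.card = l → B.card = l → (A ∪ B).card ≤ l + 1 → R A B)
    (htr : ∀ A B C, R A B → R B C → R A C) :
    ∀ (m : ℕ) (A B : Finset ι), A ⊆ Y → B ⊆ Y → A.card = l → B.card = l → (B \ A).card = m →
      R A B := by
  intro m
  induction m with
  | zero =>
    intro A B hA hB hAl hBl h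
    have hBA : B ⊆ A := by
      rwa [Finset.card_eq_zero, Finset.sdiff_eq_empty_iff_subset] at h
    have : B = A := Finset.eq_of_subset_of_card_le hBA (by omega)
    subst this
    exact hR B B hA hA hAl hAl (by simp [hAl])
  | succ m ih =>
    intro A B hA hB hAl hBl h
    obtain ⟨b, hb⟩ : (B \ A).Nonempty := by rw [← Finset.card_pos]; omega
    obtain ⟨a, ha⟩ : (A \ B).Nonempty := by
      rw [← Finset.card_pos]
      have := Finset.card_sdiff_add_card_inter A B
      have := Finset.card_sdiff_add_card_inter B A
      rw [Finset.inter_comm] at this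
      omega
    rw [Finset.mem_sdiff] at ha hb
    have hbe : b ∉ A.erase a := fun h => hb.2 (Finset.mem_of_mem_erase h)
    have hcard : (insert b (A.erase a)).card = l := by
      rw [Finset.card_insert_of_notMem hbe, Finset.card_erase_of_mem ha.1, hAl]
      have := Finset.card_pos.mpr ⟨a, ha.1⟩
      omega
    have hsub : insert b (A.erase a) ⊆ Y :=
      Finset.insert_subset (hB hb.1) ((Finset.erase_subset _ _).trans hA)
    refine htr A (insert b (A.erase a)) B (hR A _ hA hsub hAl hcard ?_)
      (ih _ B hsub hB hcard hBl ?_)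
    · have : A ∪ insert b (A.erase a) ⊆ insert b A := by
        intro x; simp only [Finset.mem_union, Finset.mem_insert, Finset.mem_erase]; tauto
      refine (Finset.card_le_card this).trans ((Finset.card_insert_le _ _).trans (by omega))
    · have : B \ insert b (A.erase a) = (B \ A).erase b := by
        ext x
        simp only [Finset.mem_sdiff, Finset.mem_insert, Finset.mem_erase]
        constructor
        · rintro ⟨h1, h2⟩
          push Not at h2
          refine ⟨h2.1, h1, fun hxA => h2.2 ?_ hxA⟩
          rintro rfl; exact ha.2 h1
        · rintro ⟨h1, h2, h3⟩
          exact ⟨h2, by tauto⟩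
      rw [this, Finset.card_erase_of_mem (by simp [hb]), h]
      rfl

variable {k l d : ℕ} {E : Set (Finset ι)} {X : Finset ι}

lemma LWalk.two_step {e A B C : Finset ι} (he : e ∈ E) (hA : A ⊆ e)
    (hB : B ⊆ e) (hC : C ⊆ e) (hBl : B.card = l) (hCl : C.card = l)
    (hAB : Disjoint A B) (hCB : Disjoint C B) :
    LWalk l E A C ((e \ A).val + (e \ B).val) := by
  refine (LWalk.single he hA ?_ hBl).trans (LWalk.single he hB ?_ hCl)
  · exact Finset.subset_sdiff.mpr ⟨hB, hAB.symm⟩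
  · exact Finset.subset_sdiff.mpr ⟨hC, hCB⟩

lemma IsGadget.adj (hG : IsGadget k l d E X) {e A C : Finset ι} (he : e ∈ E) (hA : A ⊆ e)
    (hC : C ⊆ e) (hAl : A.card = l) (hCl : C.card = l) (h : (A ∪ C).card ≤ l + 1) :
    EvenConn k l E A C := by
  have hk := hG.card_edge e he
  have h1 := hG.hlk
  obtain ⟨B, hB, hBl⟩ := Finset.exists_subset_card_eq (s := e \ (A ∪ C)) (n := l) (by
    rw [Finset.card_sdiff_of_subset (Finset.union_subset hA hC)]; omega)
  obtain ⟨hBe, hBd⟩ := Finset.subset_sdiff.mp hB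
  rw [Finset.disjoint_union_right] at hBd
  refine ⟨_, 1, LWalk.two_step he hA hBe hC hBl hCl hBd.1.symm hBd.2.symm, ?_⟩
  rw [Multiset.card_add, Finset.card_val, Finset.card_val, card_sdiff_edge hk hAl hA,
    card_sdiff_edge hk hBl hBe]
  ring

lemma IsGadget.evenConn_edge (hG : IsGadget k l d E X) {e A C : Finset ι} (he : e ∈ E) (hA : A ⊆ e)
    (hC : C ⊆ e) (hAl : A.card = l) (hCl : C.card = l) : EvenConn k l E A C :=
  johnson_connected (Y := e) (R := EvenConn k l E)
    (fun _ _ h1 h2 h3 h4 h5 => hG.adj he h1 h2 h3 h4 h5)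
    (fun _ _ _ => EvenConn.trans) _ A C hA hC hAl hCl rfl

lemma IsGadget.evenConn_X (hG : IsGadget k l d E X) {A C : Finset ι} (hA : A ⊆ X)
    (hC : C ⊆ X) (hAl : A.card = l) (hCl : C.card = l) : EvenConn k l E A C := by
  refine johnson_connected (Y := X) (R := EvenConn k l E) ?_
    (fun _ _ _ => EvenConn.trans) _ A C hA hC hAl hCl rfl
  intro A B hA hB hAl hBl hAB
  have := hG.hld
  obtain ⟨D, hD1, hD2, hD3⟩ := Finset.exists_subsuperset_card_eq (Finset.union_subset hA hB)
    (n := d) (by omega) hG.card_X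
  obtain ⟨e, he, hDe⟩ := hG.exists_edge D hD2 hD3
  exact hG.adj he (Finset.subset_union_left.trans (hD1.trans hDe))
    (Finset.subset_union_right.trans (hD1.trans hDe)) hAl hBl hAB

lemma IsGadget.exists_subset_inter (hG : IsGadget k l d E X) {e : Finset ι} (he : e ∈ E) :
    ∃ A ⊆ e ∩ X, A.card = l :=
  Finset.exists_subset_card_eq ((hG.hld.le).trans (hG.card_inter e he))

lemma IsGadget.evenConn_edge_X (hG : IsGadget k l d E X) {e A C : Finset ι} (he : e ∈ E)
    (hA : A ⊆ e) (hC : C ⊆ X) (hAl : A.card = l) (hCl : C.card = l) :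
    EvenConn k l E A C ∧ EvenConn k l E C A := by
  obtain ⟨B, hB, hBl⟩ := hG.exists_subset_inter he
  have hBe := hB.trans Finset.inter_subset_left
  have hBX := hB.trans Finset.inter_subset_right
  exact ⟨(hG.evenConn_edge he hA hBe hAl hBl).trans (hG.evenConn_X hBX hC hBl hCl),
    (hG.evenConn_X hC hBX hCl hBl).trans (hG.evenConn_edge he hBe hA hBl hAl)⟩

/-- Differences of contents of closed walks at `A`. -/
def walkGroup (l : ℕ) (E : Set (Finset ι)) (A : Finset ι) : AddSubgroup (ι → ℤ) where
  carrier := {f | ∃ c₁ c₂, LWalk l E A A c₁ ∧ LWalk l E A A c₂ ∧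
    ∀ x, f x = (c₁.count x : ℤ) - c₂.count x}
  zero_mem' := ⟨0, 0, LWalk.nil, LWalk.nil, by simp⟩
  add_mem' := by
    rintro f g ⟨c₁, c₂, h1, h2, h3⟩ ⟨b₁, b₂, g1, g2, g3⟩
    refine ⟨c₁ + b₁, c₂ + b₂, h1.trans g1, h2.trans g2, fun x => ?_⟩
    rw [Pi.add_apply, h3, g3, Multiset.count_add, Multiset.count_add]
    push_cast; ring
  neg_mem' := by
    rintro f ⟨c₁, c₂, h1, h2, h3⟩
    exact ⟨c₂, c₁, h2, h1, fun x => by rw [Pi.neg_apply, h3]; ring⟩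

lemma count_val (s : Finset ι) (x : ι) : s.val.count x = if x ∈ s then 1 else 0 :=
  Multiset.count_eq_of_nodup s.nodup

lemma IsGadget.sub_mem_edge (hG : IsGadget k l d E X) {A : Finset ι} (hA : A ⊆ X)
    (hAl : A.card = l) {e : Finset ι} (he : e ∈ E) {x y : ι} (hx : x ∈ e) (hy : y ∈ e) :
    (Pi.single x 1 - Pi.single y 1 : ι → ℤ) ∈ walkGroup l E A := by
  by_cases hxy : x = y
  · rw [hxy, sub_self]; exact zero_mem _
  have h0 := hG.hl
  have h1 := hG.hlk
  have hk := hG.card_edge e he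
  have hxye : ({x, y} : Finset ι) ⊆ e := by
    intro a ha; simp at ha; rcases ha with rfl | rfl <;> assumption
  have hxyc : ({x, y} : Finset ι).card = 2 := Finset.card_pair hxy
  obtain ⟨B, hB, hBl⟩ := Finset.exists_subset_card_eq (s := e \ {x, y}) (n := l) (by
    rw [Finset.card_sdiff_of_subset hxye]; omega)
  obtain ⟨hBe, hBd⟩ := Finset.subset_sdiff.mp hB
  have hxB : x ∉ B := fun h => Finset.disjoint_left.mp hBd h (by simp)
  have hyB : y ∉ B := fun h => Finset.disjoint_left.mp hBd h (by simp)
  obtain ⟨P, hP, hPl⟩ := Finset.exists_subset_card_eq (s := (e \ {x, y}) \ B) (n := l - 1) (by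
    rw [Finset.card_sdiff_of_subset hB, Finset.card_sdiff_of_subset hxye]; omega)
  obtain ⟨hP1, hPB⟩ := Finset.subset_sdiff.mp hP
  obtain ⟨hPe, hPd⟩ := Finset.subset_sdiff.mp hP1
  have hxP : x ∉ P := fun h => Finset.disjoint_left.mp hPd h (by simp)
  have hyP : y ∉ P := fun h => Finset.disjoint_left.mp hPd h (by simp)
  have key : ∀ w ∈ e, w ∉ B → w ∉ P →
      LWalk l E B B ((e \ B).val + (e \ insert w P).val) := by
    intro w hw hwB hwP
    have hd : Disjoint B (insert w P) :=
      Finset.disjoint_insert_right.mpr ⟨hwB, hPB.symm⟩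
    exact LWalk.two_step he hBe (Finset.insert_subset hw hPe) hBe
      (by rw [Finset.card_insert_of_notMem hwP]; omega) hBl hd hd
  obtain ⟨⟨c, _, hc, _⟩, ⟨c', _, hc', _⟩⟩ := hG.evenConn_edge_X he hBe hA hBl hAl
  refine ⟨_, _, (hc'.trans (key y hy hyB hyP)).trans hc, (hc'.trans (key x hx hxB hxP)).trans hc,
    fun v => ?_⟩
  simp only [Multiset.count_add, count_val, Finset.mem_sdiff, Finset.mem_insert, Pi.sub_apply,
    Pi.single_apply]
  by_cases hvx : v = x
  · subst hvx; simp [hx, hxy, hxP, hxB]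
  · by_cases hvy : v = y
    · subst hvy; simp [hy, hyP, hyB, hvx]
    · simp [hvx, hvy]

lemma IsGadget.sub_mem (hG : IsGadget k l d E X) {A : Finset ι} (hA : A ⊆ X)
    (hAl : A.card = l) {e e' : Finset ι} (he : e ∈ E) (he' : e' ∈ E) {x y : ι} (hx : x ∈ e)
    (hy : y ∈ e') : (Pi.single x 1 - Pi.single y 1 : ι → ℤ) ∈ walkGroup l E A := by
  have h0 := hG.hl
  have h1 := hG.hld
  have ne : ∀ e ∈ E, ∃ x ∈ e, x ∈ X := by
    intro e he
    obtain ⟨x, hx⟩ := Finset.card_pos.mp (lt_of_lt_of_le (by omega) (hG.card_inter e he))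
    exact ⟨x, Finset.mem_inter.mp hx⟩
  obtain ⟨x', hxe, hxX⟩ := ne e he
  obtain ⟨y', hye, hyX⟩ := ne e' he'
  obtain ⟨D, hD1, hD2, hD3⟩ := Finset.exists_subsuperset_card_eq
    (s := {x', y'}) (t := X) (n := d)
    (by intro a ha; simp at ha; rcases ha with rfl | rfl <;> assumption)
    (Finset.card_le_two.trans (by omega)) hG.card_X
  obtain ⟨f, hf, hDf⟩ := hG.exists_edge D hD2 hD3
  have e1 := hG.sub_mem_edge hA hAl he hx hxe
  have e2 := hG.sub_mem_edge hA hAl hf (x := x') (y := y') (hDf (hD1 (by simp)))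
    (hDf (hD1 (by simp)))
  have e3 := hG.sub_mem_edge hA hAl he' hye hy
  have := add_mem (add_mem e1 e2) e3
  simpa using this

end Generic

section Generic

variable {ι : Type} [DecidableEq ι] {k l d : ℕ} {E : Set (Finset ι)} {X : Finset ι}

lemma LWalk.mem_edge {A B : Finset ι} {c : Multiset ι} (h : LWalk l E A B c) {x : ι} (hx : x ∈ c) :
    ∃ e ∈ E, x ∈ e := by
  induction h with
  | nil => simp at hx
  | cons _ he _ _ _ ih =>
    rcases Multiset.mem_add.mp hx with hx | hx
    · exact ih hx
    · exact ⟨_, he, (Finset.mem_sdiff.mp (Finset.mem_val.mp hx)).1⟩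

lemma walkGroup_support {A : Finset ι} {f : ι → ℤ} (hf : f ∈ walkGroup l E A) {x : ι}
    (hx : f x ≠ 0) : ∃ e ∈ E, x ∈ e := by
  obtain ⟨c₁, c₂, h1, h2, h3⟩ := hf
  by_cases hx1 : x ∈ c₁
  · exact h1.mem_edge hx1
  · by_cases hx2 : x ∈ c₂
    · exact h2.mem_edge hx2
    · rw [h3, Multiset.count_eq_zero_of_notMem hx1, Multiset.count_eq_zero_of_notMem hx2] at hx
      simp at hx

lemma LWalk.nsmul {A : Finset ι} {c : Multiset ι} (h : LWalk l E A A c) (m : ℕ) :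
    LWalk l E A A (m • c) := by
  induction m with
  | zero => rw [zero_nsmul]; exact LWalk.nil
  | succ m ih => rw [succ_nsmul]; exact ih.trans h

lemma IsGadget.exists_two_step (hG : IsGadget k l d E X) {A : Finset ι} (hA : A ⊆ X)
    (hAl : A.card = l) : ∃ e ∈ E, ∃ B, A ⊆ e ∧ B ⊆ e \ A ∧ B.card = l ∧
      LWalk l E A A ((e \ A).val + (e \ B).val) := by
  have h0 := hG.hlk
  have h1 := hG.hld
  obtain ⟨D, hD1, hD2, hD3⟩ := Finset.exists_subsuperset_card_eq hA (by omega) hG.card_X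
  obtain ⟨e, he, hDe⟩ := hG.exists_edge D hD2 hD3
  have hAe := hD1.trans hDe
  have hk := hG.card_edge e he
  obtain ⟨B, hB, hBl⟩ := Finset.exists_subset_card_eq (s := e \ A) (n := l) (by
    rw [card_sdiff_edge hk hAl hAe]; omega)
  obtain ⟨hBe, hBd⟩ := Finset.subset_sdiff.mp hB
  exact ⟨e, he, B, hAe, hB, hBl, LWalk.two_step he hAe hBe hAe hBl hAl hBd.symm hBd.symm⟩

lemma IsGadget.exists_sum_eq [Fintype ι] (hG : IsGadget k l d E X) {A : Finset ι} (hA : A ⊆ X)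
    (hAl : A.card = l) : ∃ f ∈ walkGroup l E A, ∑ x, f x = ((k - l : ℕ) : ℤ) := by
  obtain ⟨e, he, B, hAe, hB, hBl, hw⟩ := hG.exists_two_step hA hAl
  have hk := hG.card_edge e he
  have hBe := hB.trans Finset.sdiff_subset
  obtain ⟨-, c, m, hc, hcm⟩ := hG.evenConn_edge_X he hAe hA hAl hAl
  obtain ⟨⟨c, m, hc, hcm⟩, -⟩ := hG.evenConn_edge_X he hBe hA hBl hAl
  refine ⟨fun x => ((((e \ A).val + c).count x : ℕ) : ℤ) -
    (((m • ((e \ A).val + (e \ B).val)).count x : ℕ) : ℤ), ⟨_, _,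
    (LWalk.single he hAe hB hBl).trans hc, hw.nsmul m, fun x => rfl⟩, ?_⟩
  rw [Finset.sum_sub_distrib, ← Nat.cast_sum, ← Nat.cast_sum, Multiset.sum_count_eq_card,
    Multiset.sum_count_eq_card, Multiset.card_nsmul, Multiset.card_add, Multiset.card_add,
    Finset.card_val, Finset.card_val, card_sdiff_edge hk hAl hAe, card_sdiff_edge hk hBl hBe, hcm]
  · push_cast; ring
  · simp
  · simp

lemma IsGadget.mem_walkGroup [Fintype ι] (hG : IsGadget k l d E X) {A : Finset ι} (hA : A ⊆ X)
    (hAl : A.card = l) {f : ι → ℤ} (hf : ∀ x, f x ≠ 0 → ∃ e ∈ E, x ∈ e)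
    (hs : ((k - l : ℕ) : ℤ) ∣ ∑ x, f x) : f ∈ walkGroup l E A := by
  obtain ⟨f0, hf0, hf0s⟩ := hG.exists_sum_eq hA hAl
  obtain ⟨q, hq⟩ := hs
  obtain ⟨e0, he0, B, hAe, -⟩ := hG.exists_two_step hA hAl
  obtain ⟨u, hu⟩ : A.Nonempty := by rw [← Finset.card_pos, hAl]; exact hG.hl
  have key : ∀ g : ι → ℤ, (∀ x, g x ≠ 0 → ∃ e ∈ E, x ∈ e) → ∑ x, g x = 0 →
      g ∈ walkGroup l E A := by
    intro g hg hgs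
    have : g = ∑ x, g x • (Pi.single x 1 - Pi.single u 1 : ι → ℤ) := by
      simp_rw [smul_sub, Finset.sum_sub_distrib, ← Finset.sum_smul, hgs]
      ext y
      simp [Finset.sum_apply, Pi.single_apply]
    rw [this]
    refine AddSubgroup.sum_mem _ fun x _ => ?_
    by_cases hx : g x = 0
    · rw [hx, zero_smul]; exact zero_mem _
    · obtain ⟨e, he, hxe⟩ := hg x hx
      exact AddSubgroup.zsmul_mem _ (hG.sub_mem hA hAl he he0 hxe (hAe hu)) _
  have h1 := key (f - q • f0) (by
    intro x hx
    by_cases h1 : f x = 0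
    · by_cases h2 : f0 x = 0
      · simp [h1, h2] at hx
      · exact walkGroup_support hf0 h2
    · exact hf x h1) (by
    simp only [Pi.sub_apply, Pi.smul_apply, smul_eq_mul, Finset.sum_sub_distrib, ← Finset.mul_sum,
      hf0s, hq]
    ring)
  have := add_mem h1 (AddSubgroup.zsmul_mem _ hf0 q)
  simpa using this

/-- Two closed walks whose contents differ exactly by the set of constants `s j`. -/
lemma IsGadget.exists_absorbing_walks [Fintype ι] (hG : IsGadget k l d E X) {A : Finset ι}
    (hA : A ⊆ X) (hAl : A.card = l) {E' : Set (Finset ι)} (hE : E ⊆ E') {J : Type} [Fintype J]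
    (hJ : Fintype.card J = k - l) (s : J → ι) (hs : Function.Injective s)
    (hsE : ∀ j, ∀ e ∈ E, s j ∉ e) (G : J → Finset ι) (hGX : ∀ j, G j ⊆ X)
    (hGE : ∀ j, insert (s j) (G j) ∈ E') (hGc : ∀ j, (G j).card = k - 1) (hsX : ∀ j, s j ∉ X)
    (hXE : ∀ x ∈ X, ∃ e ∈ E, x ∈ e) :
    ∃ c : Multiset ι, c ≠ 0 ∧ (∀ j, s j ∉ c) ∧ LWalk l E' A A c ∧
      LWalk l E' A A (c + (Finset.univ.image s).val) := by
  classical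
  have h0 := hG.hl
  have h1 := hG.hlk
  have hcardE : ∀ j, (insert (s j) (G j)).card = k := by
    intro j
    rw [Finset.card_insert_of_notMem (fun h => hsX j (hGX j h)), hGc]; omega
  have hloop : ∀ j, ∃ c : Multiset ι, LWalk l E' A A c ∧ c.count (s j) = 1 ∧
      (∀ j', j' ≠ j → c.count (s j') = 0) ∧ (∀ x ∈ c, x ≠ s j → ∃ e ∈ E, x ∈ e) ∧
      (k - l) ∣ Multiset.card c := by
    intro j
    obtain ⟨P, hP, hPl⟩ := Finset.exists_subset_card_eq (s := G j) (n := l) (by rw [hGc]; omega)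
    obtain ⟨Q, hQ, hQl⟩ := Finset.exists_subset_card_eq (s := G j \ P) (n := l) (by
      rw [Finset.card_sdiff_of_subset hP, hGc]; omega)
    obtain ⟨hQG, hQP⟩ := Finset.subset_sdiff.mp hQ
    obtain ⟨c1, m1, hc1, hm1⟩ := hG.evenConn_X hA (hP.trans (hGX j)) hAl hPl
    obtain ⟨c2, m2, hc2, hm2⟩ := hG.evenConn_X (hQG.trans (hGX j)) hA hQl hAl
    have hPe : P ⊆ insert (s j) (G j) := hP.trans (Finset.subset_insert _ _)
    have hw := ((hc1.mono hE).trans (LWalk.single (hGE j) hPe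
      (hQ.trans (Finset.sdiff_subset_sdiff (Finset.subset_insert _ _) le_rfl)) hQl)).trans
      (hc2.mono hE)
    have n1 : ∀ j', c1.count (s j') = 0 := fun j' => Multiset.count_eq_zero_of_notMem fun h => by
      obtain ⟨e, he, hx⟩ := hc1.mem_edge h
      exact hsE j' e he hx
    have n2 : ∀ j', c2.count (s j') = 0 := fun j' => Multiset.count_eq_zero_of_notMem fun h => by
      obtain ⟨e, he, hx⟩ := hc2.mem_edge h
      exact hsE j' e he hx
    refine ⟨_, hw, ?_, ?_, ?_, ?_⟩
    · rw [Multiset.count_add, Multiset.count_add, n1, n2, count_val, if_pos]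
      refine Finset.mem_sdiff.mpr ⟨Finset.mem_insert_self _ _, fun h => hsX j (hGX j (hP h))⟩
    · intro j' hj'
      rw [Multiset.count_add, Multiset.count_add, n1, n2, count_val, if_neg]
      intro h
      rcases Finset.mem_insert.mp (Finset.mem_sdiff.mp h).1 with h | h
      · exact hj' (hs h)
      · exact hsX j' (hGX j h)
    · intro x hx hxs
      rcases Multiset.mem_add.mp hx with hx | hx
      · rcases Multiset.mem_add.mp hx with hx | hx
        · exact hc1.mem_edge hx
        · rcases Finset.mem_insert.mp (Finset.mem_sdiff.mp (Finset.mem_val.mp hx)).1 with h | h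
          · exact absurd h hxs
          · exact hXE x (hGX j h)
      · exact hc2.mem_edge hx
    · rw [Multiset.card_add, Multiset.card_add, hm1, hm2, Finset.card_val,
        card_sdiff_edge (hcardE j) hPl hPe]
      exact ⟨m1 * 2 + 1 + m2 * 2, by ring⟩
  choose c hc hc1 hc0 hcE hcd using hloop
  have hC : LWalk l E' A A (∑ j, c j) := by
    refine Finset.sum_induction c (fun c => LWalk l E' A A c) (fun _ _ => LWalk.trans) LWalk.nil
      fun j _ => hc j
  set C := ∑ j, c j with hCdef
  have hCs : ∀ j, C.count (s j) = 1 := by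
    intro j
    rw [hCdef, Multiset.count_sum', Finset.sum_eq_single j, hc1]
    · intro j' _ hj'; exact hc0 j' j hj'.symm
    · simp
  have hCd : (k - l) ∣ Multiset.card C := by
    rw [hCdef, Multiset.card_sum]; exact Finset.dvd_sum fun j _ => hcd j
  set S := Finset.univ.image s with hS
  have hSc : S.card = k - l := by
    rw [hS, Finset.card_image_of_injective _ hs, Finset.card_univ, hJ]
  obtain ⟨c₁, c₂, w1, w2, w3⟩ := hG.mem_walkGroup hA hAl
    (f := fun x => (C.count x : ℤ) - S.val.count x) (by
      intro x hx
      by_cases hxS : x ∈ S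
      · obtain ⟨j, -, rfl⟩ := Finset.mem_image.mp hxS
        rw [hCs, count_val, if_pos hxS] at hx
        simp at hx
      · rw [count_val, if_neg hxS] at hx
        have hxC : x ∈ C := by
          by_contra h
          rw [Multiset.count_eq_zero_of_notMem h] at hx
          simp at hx
        rw [hCdef, Multiset.mem_sum] at hxC
        obtain ⟨j, -, hj⟩ := hxC
        refine hcE j x hj ?_
        rintro rfl
        exact hxS (Finset.mem_image_of_mem _ (Finset.mem_univ _))) (by
      rw [Finset.sum_sub_distrib, ← Nat.cast_sum, ← Nat.cast_sum, Multiset.sum_count_eq_card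
        (by simp), Multiset.sum_count_eq_card (by simp), Finset.card_val, hSc]
      exact dvd_sub (by exact_mod_cast hCd) dvd_rfl)
  have hCS : C + c₂ = c₁ + S.val := by
    ext x
    have := w3 x
    rw [Multiset.count_add, Multiset.count_add]
    simp only at this
    omega
  obtain ⟨e, he, B, hAe, hB, hBl, hw⟩ := hG.exists_two_step hA hAl
  refine ⟨c₁ + ((e \ A).val + (e \ B).val), ?_, ?_, (w1.trans hw).mono hE, ?_⟩
  · intro h
    have h2 : Multiset.card (c₁ + ((e \ A).val + (e \ B).val)) = 0 := by rw [h]; rfl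
    rw [Multiset.card_add, Multiset.card_add, Finset.card_val,
      card_sdiff_edge (hG.card_edge e he) hAl hAe] at h2
    omega
  · intro j hj
    obtain ⟨f, hf, hjf⟩ := (w1.trans hw).mem_edge hj
    exact hsE j f hf hjf
  · have := (hC.trans (w2.mono hE)).trans (hw.mono hE)
    rw [hCS, add_right_comm] at this
    exact this

/-- A walk joining two given sets of constants. -/
lemma IsGadget.exists_connecting_walk (hG : IsGadget k l d E X)
    {E' : Set (Finset ι)} (hE : E ⊆ E') {Z Z' G G' : Finset ι} (hZ'l : Z'.card = l) (hZE : ∀ e ∈ E, Disjoint Z e) (hZE' : ∀ e ∈ E, Disjoint Z' e)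
    (hZG : Disjoint Z G) (hZG' : Disjoint Z' G') (hZ'G : Disjoint Z' G)
    (hZ'2 : Disjoint Z G')
    (hG1 : G ⊆ X) (hG2 : G' ⊆ X) (hG3 : Z ∪ G ∈ E') (hG4 : Z' ∪ G' ∈ E')
    (hGc : G.card = k - l) (hGc' : G'.card = k - l) :
    ∃ c : Multiset ι, (∀ x ∈ Z, x ∉ c) ∧ (∀ x ∈ Z', x ∉ c) ∧ LWalk l E' Z Z' (c + Z'.val) := by
  have h0 := hG.hl
  have h1 := hG.hlk
  obtain ⟨P, hP, hPl⟩ := Finset.exists_subset_card_eq (s := G) (n := l) (by rw [hGc]; omega)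
  obtain ⟨Q, hQ, hQl⟩ := Finset.exists_subset_card_eq (s := G') (n := l) (by rw [hGc']; omega)
  obtain ⟨c, m, hc, -⟩ := hG.evenConn_X (hP.trans hG1) (hQ.trans hG2) hPl hQl
  have s1 : LWalk l E' Z P ((Z ∪ G) \ Z).val := by
    refine LWalk.single hG3 Finset.subset_union_left ?_ hPl
    rw [Finset.union_sdiff_left, Finset.sdiff_eq_self_of_disjoint hZG.symm]
    exact hP
  have s2 : LWalk l E' Q Z' ((Z' ∪ G') \ Q).val := by
    refine LWalk.single hG4 (hQ.trans Finset.subset_union_right) ?_ hZ'l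
    exact Finset.subset_sdiff.mpr ⟨Finset.subset_union_left, hZG'.mono_right hQ⟩
  have hw := (s1.trans (hc.mono hE)).trans s2
  have e1 : (Z ∪ G) \ Z = G := by
    rw [Finset.union_sdiff_left, Finset.sdiff_eq_self_of_disjoint hZG.symm]
  have e2 : ((Z' ∪ G') \ Q).val = (G' \ Q).val + Z'.val := by
    rw [← union_val (hZG'.symm.mono_left Finset.sdiff_subset)]
    congr 1
    ext x
    have := fun hx : x ∈ Z' => Finset.disjoint_left.mp (hZG'.mono_right hQ) hx
    simp only [Finset.mem_sdiff, Finset.mem_union]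
    tauto
  rw [e1, e2, ← add_assoc] at hw
  have hno : ∀ W : Finset ι, (∀ e ∈ E, Disjoint W e) → Disjoint W G → Disjoint W G' →
      ∀ x ∈ W, x ∉ G.val + c + (G' \ Q).val := by
    intro W hWE hWG hWG' x hx h
    rcases Multiset.mem_add.mp h with h | h
    · rcases Multiset.mem_add.mp h with h | h
      · exact Finset.disjoint_left.mp hWG hx h
      · obtain ⟨e, he, hxe⟩ := hc.mem_edge h
        exact Finset.disjoint_left.mp (hWE e he) hx hxe
    · exact Finset.disjoint_left.mp hWG' hx (Finset.mem_sdiff.mp h).1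
  exact ⟨_, hno Z hZE hZG hZ'2, hno Z' hZE' hZ'G hZG', hw⟩

end Generic

/-- Every `d`-set lies in at least a `δ` proportion of the potential edges of `H`. -/
def DegCond {V : Type} [Fintype V] [DecidableEq V] (d k : ℕ) (H : Set (Finset V)) (δ : ℝ) : Prop :=
  (∀ e ∈ H, e.card = k) ∧ ∀ S : Finset V, S.card = d →
    δ * (Fintype.card V : ℝ) ^ (k - d) ≤
      cnt (fun t : Fin (k - d) → V => S ∪ Finset.univ.image t ∈ H)

section Gadget

set_option synthInstance.maxSize 1000

variable {V : Type} [Fintype V] [DecidableEq V]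

/-- An extension of a `d`-tuple is an edge if it is injective. -/
def ImpEdge {α : Type} [Fintype α] (H : Set (Finset V)) (w : α → V) : Prop :=
  Function.Injective w → Finset.univ.image w ∈ H

lemma DegCond.ext {d k : ℕ} {H : Set (Finset V)} {δ : ℝ} (hH : DegCond d k H δ) (hδ : δ ≤ 1)
    {α : Type} [Fintype α] (hα : Fintype.card α = d) (s : α → V) :
    δ * (Fintype.card V : ℝ) ^ (k - d) ≤
      cnt (fun t : Fin (k - d) → V => ImpEdge H (Sum.elim s t)) := by
  by_cases hs : Function.Injective s
  · refine (hH.2 (Finset.univ.image s) ?_).trans (cnt_mono fun t ht _ => ?_)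
    · rw [Finset.card_image_of_injective _ hs, Finset.card_univ, hα]
    · convert ht using 1
      ext x
      simp
  · have : (1 : ℝ) * (Fintype.card V : ℝ) ^ (k - d) ≤
        cnt (fun t : Fin (k - d) → V => ImpEdge H (Sum.elim s t)) := by
      rw [one_mul]
      have h1 : cnt (fun _ : Fin (k - d) → V => True) = (Fintype.card V : ℝ) ^ (k - d) := by
        rw [cnt_true]; simp
      rw [← h1]
      refine cnt_mono fun t _ ht => absurd (fun a b hab => ?_) hs
      have := @ht (Sum.inl a) (Sum.inl b) (by simpa using hab)
      simpa using this
    exact (mul_le_mul_of_nonneg_right hδ (by positivity)).trans this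

variable (J : Type) [Fintype J] [DecidableEq J] (z d k : ℕ)

/-- The base vertices of the gadget. -/
abbrev GBase : Type := J × (Fin (d - z) ⊕ Fin (k - d))

/-- The `d`-sets of base vertices. -/
abbrev GSets : Type := {D : Finset (GBase J z d k) // D.card = d}

/-- The variable vertices of the gadget. -/
abbrev GVar : Type := GBase J z d k ⊕ (GSets J z d k × Fin (k - d))

/-- All vertices of the gadget: the constants and the variable vertices. -/
abbrev GVert : Type := (J × Fin z) ⊕ GVar J z d k

variable {J z d k}

/-- The edge through the `j`-th block of constants. -/
def gBaseFun (j : J) : (Fin z ⊕ Fin (d - z)) ⊕ Fin (k - d) → GVert J z d k :=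
  Sum.elim (Sum.elim (fun a => Sum.inl (j, a)) (fun b => Sum.inr (Sum.inl (j, Sum.inl b))))
    (fun c => Sum.inr (Sum.inl (j, Sum.inr c)))

/-- The edge covering the `d`-set `D` of base vertices. -/
def gCovFun (D : GSets J z d k) : D.1 ⊕ Fin (k - d) → GVert J z d k :=
  Sum.elim (fun a => Sum.inr (Sum.inl a.1)) (fun c => Sum.inr (Sum.inr (D, c)))

lemma gBaseFun_injective (j : J) : Function.Injective (gBaseFun (z := z) (d := d) (k := k) j) := by
  rintro ((a | a) | a) ((b | b) | b) h <;> simp [gBaseFun] at h ⊢ <;> exact h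

lemma gCovFun_injective (D : GSets J z d k) : Function.Injective (gCovFun D) := by
  rintro (a | a) (b | b) h <;> simp [gCovFun] at h ⊢
  all_goals exact h

variable (J z d k) in
/-- The edges covering `d`-sets of base vertices. -/
def gCov : Set (Finset (GVert J z d k)) := Set.range fun D => Finset.univ.image (gCovFun D)

variable (J z d k) in
/-- All the edges of the gadget. -/
def gEdges : Set (Finset (GVert J z d k)) :=
  gCov J z d k ∪ Set.range fun j => Finset.univ.image (gBaseFun j)

variable (J z d k) in
/-- The set of base vertices. -/
def gX : Finset (GVert J z d k) := Finset.univ.image fun a => Sum.inr (Sum.inl a)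

lemma cnt_curry {α β : Type} [Fintype α] [Fintype β] (P : α → (β → V) → Prop) :
    cnt (fun x : α × β → V => ∀ a, P a fun b => x (a, b)) = ∏ a, cnt (P a) := by
  classical
  rw [← cnt_pi (fun a => P a), ← cnt_equiv (Equiv.curry α β V)]
  rfl

lemma _root_.Set.InjOn.injective_comp {α β γ : Type} {f : α → β} {g : β → γ}
    (h : Set.InjOn g (Set.range f)) (hf : Function.Injective f) : Function.Injective (g ∘ f) :=
  fun a b hab => hf (h ⟨a, rfl⟩ ⟨b, rfl⟩ hab)

lemma DegCond.cnt_gadget {H : Set (Finset V)} {δ : ℝ} (hH : DegCond d k H δ) (hδ0 : 0 ≤ δ)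
    (hδ : δ ≤ 1) (hzd : z ≤ d) (c : J × Fin z → V) :
    δ ^ (Fintype.card J + Fintype.card (GSets J z d k)) *
      (Fintype.card V : ℝ) ^ (Fintype.card (GVar J z d k)) ≤
    cnt (fun x : GVar J z d k → V => ∀ e ∈ gEdges J z d k, Set.InjOn (Sum.elim c x) e →
      e.image (Sum.elim c x) ∈ H) := by
  set n : ℝ := (Fintype.card V : ℝ) with hn
  have hn0 : 0 ≤ n := by positivity
  -- base vertices
  have h1 : (δ * n ^ ((d - z) + (k - d))) ^ Fintype.card J ≤
      cnt (fun x : GBase J z d k → V => ∀ j, ImpEdge H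
        (Sum.elim (Sum.elim (fun a => c (j, a)) (fun b => x (j, Sum.inl b)))
          (fun b => x (j, Sum.inr b)))) := by
    rw [cnt_curry (fun j (y : Fin (d - z) ⊕ Fin (k - d) → V) => ImpEdge H
        (Sum.elim (Sum.elim (fun a => c (j, a)) (fun b => y (Sum.inl b)))
          (fun b => y (Sum.inr b))))]
    rw [← Finset.card_univ, ← Finset.prod_const]
    refine Finset.prod_le_prod (fun _ _ => by positivity) fun j _ => ?_
    rw [← cnt_equiv (Equiv.sumArrowEquivProdArrow _ _ V).symm]
    have := cnt_prod (fun (y1 : Fin (d - z) → V) (y2 : Fin (k - d) → V) => ImpEdge H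
        (Sum.elim (Sum.elim (fun a => c (j, a)) y1) y2))
    refine le_trans ?_ (this.symm.le.trans (cnt_mono fun y hy => hy))
    calc δ * n ^ ((d - z) + (k - d)) = ∑ y1 : Fin (d - z) → V, δ * n ^ (k - d) := by
          simp [hn, pow_add]; ring
      _ ≤ _ := Finset.sum_le_sum fun y1 _ => hH.ext hδ (by simp [hzd]) _
  have h2 : ∀ x : GBase J z d k → V, (δ * n ^ (k - d)) ^ Fintype.card (GSets J z d k) ≤
      cnt (fun y : GSets J z d k × Fin (k - d) → V => ∀ D : GSets J z d k, ImpEdge H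
        (Sum.elim (fun a : D.1 => x a.1) (fun b => y (D, b)))) := by
    intro x
    rw [cnt_curry (fun (D : GSets J z d k) (y : Fin (k - d) → V) => ImpEdge H
        (Sum.elim (fun a : D.1 => x a.1) (fun b => y b)))]
    rw [← Finset.card_univ, ← Finset.prod_const]
    refine Finset.prod_le_prod (fun _ _ => by positivity) fun D _ => ?_
    exact hH.ext hδ (by simp [D.2]) _
  have h3 := cnt_and_prod_ge (by positivity) h1 fun x _ => h2 x
  rw [← cnt_equiv (Equiv.sumArrowEquivProdArrow _ _ V).symm]
  refine le_trans (le_of_eq ?_) (h3.trans (cnt_mono fun x hx => ?_))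
  · simp only [Fintype.card_sum, Fintype.card_prod, Fintype.card_fin]
    ring
  · obtain ⟨hx1, hx2⟩ := hx
    rintro e (⟨D, rfl⟩ | ⟨j, rfl⟩) hinj
    · have := hx2 D ?_
      · rw [Finset.image_image]
        convert this using 2
        ext (a | a) <;> rfl
      · have h := hinj
        simp only [Finset.coe_image, Finset.coe_univ, Set.image_univ] at h
        have h := h.injective_comp (gCovFun_injective D)
        convert h using 1
        ext (a | a) <;> rfl
    · have := hx1 j ?_
      · rw [Finset.image_image]
        convert this using 2
        ext ((a | a) | a) <;> rfl
      · have h := hinj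
        simp only [Finset.coe_image, Finset.coe_univ, Set.image_univ] at h
        have h := h.injective_comp (gBaseFun_injective j)
        convert h using 1
        ext ((a | a) | a) <;> rfl

end Gadget

lemma exists_subset_map_eq {K W : Type} [DecidableEq K] [DecidableEq W] {p : K → W} (S : Finset K)
    (c : Multiset W) (h : ∀ x ∈ c, c.card ≤ (S.filter (fun a => x = p a)).card) :
    ∃ X ⊆ S, X.val.map p = c := by
  have : c ≤ S.val.map p := by
    rw [Multiset.le_iff_count]
    intro x
    by_cases hx : x ∈ c
    · rw [Multiset.count_map]
      exact (Multiset.count_le_card _ _).trans (h x hx)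
    · simp [Multiset.count_eq_zero_of_notMem hx]
  obtain ⟨X, hX, hXc⟩ := exists_finset_le_map_eq this
  exact ⟨X, hX, hXc⟩

section Gadget

set_option synthInstance.maxSize 1000

variable {V : Type} [Fintype V] [DecidableEq V]
variable {J : Type} [Fintype J] [DecidableEq J] {z d k l : ℕ}

lemma mem_gX {x : GVert J z d k} : x ∈ gX J z d k ↔ ∃ a, x = Sum.inr (Sum.inl a) := by
  simp [gX, eq_comm]

lemma not_mem_gCov {e : Finset (GVert J z d k)} (he : e ∈ gCov J z d k) (a : J × Fin z) :
    Sum.inl a ∉ e := by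
  obtain ⟨D, rfl⟩ := he
  simp [gCovFun]

lemma isGadget_gCov (hl : 1 ≤ l) (hlk : 2 * l < k) (hld : l < d) (hdk : d ≤ k)
    (hzd : z ≤ d) (hJ : d ≤ Fintype.card J * (k - z)) :
    IsGadget k l d (gCov J z d k) (gX J z d k) := by
  have hX : (gX J z d k).card = Fintype.card (GBase J z d k) := by
    rw [gX, Finset.card_image_of_injective, Finset.card_univ]
    exact Sum.inr_injective.comp Sum.inl_injective
  refine ⟨hl, hlk, hld, ?_, ?_, ?_, ?_⟩
  · rintro e ⟨D, rfl⟩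
    rw [Finset.card_image_of_injective _ (gCovFun_injective D), Finset.card_univ]
    simp [D.2]
    omega
  · intro D hD hDc
    let D' : Finset (GBase J z d k) := Finset.univ.filter fun a => Sum.inr (Sum.inl a) ∈ D
    have h1 : D'.image (fun a => (Sum.inr (Sum.inl a) : GVert J z d k)) = D := by
      ext x
      constructor
      · intro hx
        obtain ⟨a, ha, rfl⟩ := Finset.mem_image.1 hx
        exact (Finset.mem_filter.1 ha).2
      · intro hx
        obtain ⟨a, rfl⟩ := mem_gX.1 (hD hx)
        exact Finset.mem_image.2 ⟨a, Finset.mem_filter.2 ⟨Finset.mem_univ _, hx⟩, rfl⟩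
    have h2 : D'.card = d := by
      refine Eq.trans ?_ hDc
      rw [← h1, Finset.card_image_of_injective]
      exact Sum.inr_injective.comp Sum.inl_injective
    refine ⟨_, ⟨⟨D', h2⟩, rfl⟩, ?_⟩
    rw [← h1]
    intro x hx
    obtain ⟨a, ha, rfl⟩ := Finset.mem_image.1 hx
    exact Finset.mem_image.2 ⟨Sum.inl ⟨a, ha⟩, Finset.mem_univ _, rfl⟩
  · rintro e ⟨D, rfl⟩
    have : (Finset.univ.image fun a : D.1 => (Sum.inr (Sum.inl a.1) : GVert J z d k)).card = d := by
      rw [Finset.card_image_of_injective, Finset.card_univ]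
      · simp [D.2]
      · exact Sum.inr_injective.comp (Sum.inl_injective.comp Subtype.val_injective)
    refine this.symm.le.trans (Finset.card_le_card fun x hx => ?_)
    obtain ⟨a, -, rfl⟩ := Finset.mem_image.1 hx
    exact Finset.mem_inter.2 ⟨Finset.mem_image.2 ⟨Sum.inl a, Finset.mem_univ _, rfl⟩,
      mem_gX.2 ⟨_, rfl⟩⟩
  · rw [hX]
    simp only [Fintype.card_prod, Fintype.card_sum, Fintype.card_fin]
    convert hJ using 2
    omega

/-- The projection of the blown up gadget. -/
def gProj (r : ℕ) : (J × Fin z) ⊕ (GVar J z d k × Fin r) → GVert J z d k := Sum.map id Prod.fst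

lemma image_lift_mem {H : Set (Finset V)} {r : ℕ} (hr : 0 < r) {c : J × Fin z → V}
    {g : GVar J z d k × Fin r → V} (hinj : Function.Injective (Sum.elim c g))
    (hg : ∀ σ : GVar J z d k → Fin r, ∀ e ∈ gEdges J z d k,
      Set.InjOn (Sum.elim c fun i => g (i, σ i)) e →
        e.image (Sum.elim c fun i => g (i, σ i)) ∈ H) :
    ∀ f ∈ liftEdges (gProj r) (gEdges J z d k), f.image (Sum.elim c g) ∈ H := by
  classical
  rintro f ⟨hf, hfE⟩
  have : Nonempty (Fin r) := ⟨⟨0, hr⟩⟩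
  let σ : GVar J z d k → Fin r := fun i =>
    if h : ∃ j, Sum.inr (i, j) ∈ f then h.choose else Classical.arbitrary _
  have hσ : ∀ i j, Sum.inr (i, j) ∈ f → σ i = j := by
    intro i j hij
    have h : ∃ j, Sum.inr (i, j) ∈ f := ⟨j, hij⟩
    have h1 : σ i = h.choose := dif_pos h
    have h2 := hf h.choose_spec hij rfl
    rw [h1]
    simpa using h2
  have := hg σ _ hfE ?_
  · rw [Finset.image_image] at this
    convert this using 1
    refine Finset.image_congr fun x hx => ?_
    rcases x with a | ⟨i, j⟩
    · rfl
    · simp [gProj, hσ i j hx]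
  · refine Function.Injective.injOn ?_
    rintro (a | a) (b | b) hab
    · simpa using @hinj (Sum.inl a) (Sum.inl b) hab
    · simpa using @hinj (Sum.inl a) (Sum.inr _) hab
    · simpa using @hinj (Sum.inr _) (Sum.inl b) hab
    · have := @hinj (Sum.inr _) (Sum.inr _) hab
      simp only [Sum.inr.injEq, Prod.mk.injEq] at this
      rw [this.1]

lemma DegCond.cnt_blowup_gadget (z d k : ℕ) (δ : ℝ) (hδ0 : 0 < δ)
    (hδ : δ ≤ 1) (hzd : z ≤ d) {r : ℕ} (hr : 0 < r) :
    ∃ ρ > (0 : ℝ), ∃ γ > (0 : ℝ), ∃ n0 : ℕ, ∀ (V : Type) [Fintype V] [DecidableEq V] (H : Set (Finset V)),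
      DegCond d k H δ → n0 ≤ Fintype.card V → ∀ (c : J × Fin z → V), Function.Injective c →
      ∀ F : Finset V, (F.card : ℝ) ≤ γ * Fintype.card V →
      ρ * (Fintype.card V : ℝ) ^ Fintype.card (GVar J z d k × Fin r) ≤
        cnt (fun g : GVar J z d k × Fin r → V => (∀ i, g i ∉ F) ∧
          Function.Injective (Sum.elim c g) ∧
          ∀ f ∈ liftEdges (gProj r) (gEdges J z d k), f.image (Sum.elim c g) ∈ H) := by
  set τ0 : ℝ := δ ^ (Fintype.card J + Fintype.card (GSets J z d k)) with hτ0
  set τ : ℝ := τ0 ^ r ^ (Fintype.card (GVar J z d k)) with hτ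
  have hτpos : 0 < τ := by positivity
  set b : ℕ := Fintype.card (GVar J z d k × Fin r) with hb
  set y : ℕ := Fintype.card (J × Fin z) with hy
  obtain ⟨n0, hn0⟩ := exists_nat_ge (((b : ℝ) ^ 2 + b * y) / (τ / 4))
  refine ⟨τ / 2, by positivity, τ / 4 / (b + 1), by positivity, n0 + 1, ?_⟩
  intro V _ _ H hH hV c hc F hF
  have h1 := hH.cnt_gadget hδ0.le hδ hzd c
  have h2 := cnt_blowup r _ (by positivity) h1
  have hF' : ((b : ℝ)) ^ 2 + b * ((F ∪ Finset.univ.image c).card : ℝ) ≤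
      τ / 2 * Fintype.card V := by
    have e1 : ((F ∪ Finset.univ.image c).card : ℝ) ≤ F.card + y := by
      have := (Finset.card_union_le F (Finset.univ.image c)).trans
        (Nat.add_le_add_left (Finset.card_image_le.trans (Finset.card_univ.le)) _)
      exact_mod_cast this
    have e2 : (b : ℝ) ^ 2 + b * y ≤ τ / 4 * Fintype.card V := by
      rw [div_le_iff₀ (by positivity)] at hn0
      have : (n0 : ℝ) ≤ Fintype.card V := by exact_mod_cast (by omega : n0 ≤ Fintype.card V)
      nlinarith
    have e3 : (b : ℝ) * F.card ≤ τ / 4 * Fintype.card V := by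
      have : (b : ℝ) * F.card ≤ (b + 1) * (τ / 4 / (b + 1) * Fintype.card V) := by
        gcongr
        linarith
      refine this.trans (le_of_eq ?_)
      field_simp
    have e4 : (b : ℝ) * ((F ∪ Finset.univ.image c).card : ℝ) ≤ b * (F.card + y) := by gcongr
    linarith
  have h3 := cnt_inj_avoid _ (F ∪ Finset.univ.image c) (τ := τ) (le_trans (le_of_eq (by
    rw [hτ, Fintype.card_prod, Fintype.card_fin])) h2) hF' (by omega)
  refine h3.trans (cnt_mono ?_)
  rintro g ⟨hg1, hg2, hg3⟩
  have hinj : Function.Injective (Sum.elim c g) := by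
    rintro (a | a) (b | b) hab
    · rw [hc hab]
    · exact absurd (Finset.mem_union_right _ (Finset.mem_image.2 ⟨a, Finset.mem_univ _, hab⟩))
        (hg3 b)
    · exact absurd (Finset.mem_union_right _ (Finset.mem_image.2 ⟨b, Finset.mem_univ _, hab.symm⟩))
        (hg3 a)
    · rw [hg2 hab]
  exact ⟨fun i hi => hg3 i (Finset.mem_union_left _ hi), hinj, image_lift_mem hr hinj hg1⟩

end Gadget

section Gadget

set_option synthInstance.maxSize 1000

variable {V : Type} [Fintype V] [DecidableEq V]
variable {J : Type} [Fintype J] [DecidableEq J] {z d k l : ℕ}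

/-- The `i`-th copy of a gadget vertex in the blown up gadget. -/
def gLift {r : ℕ} (i : Fin r) : GVert J z d k → (J × Fin z) ⊕ (GVar J z d k × Fin r) :=
  Sum.map id fun v => (v, i)

lemma gProj_gLift {r : ℕ} (i : Fin r) (x : GVert J z d k) : gProj r (gLift i x) = x := by
  rcases x with a | a <;> rfl

lemma map_gProj_image {r : ℕ} (i : Fin r) (A : Finset (GVert J z d k)) :
    (A.image (gLift i)).val.map (gProj r) = A.val := by
  rw [Finset.image_val_of_injOn, Multiset.map_map]
  · simp [gProj_gLift]
  · intro x _ y _ h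
    rw [← gProj_gLift i x, h, gProj_gLift]

lemma card_image_gLift {r : ℕ} (i : Fin r) (A : Finset (GVert J z d k)) :
    (A.image (gLift i)).card = A.card := by
  rw [← Finset.card_val A, ← map_gProj_image i A, Multiset.card_map, Finset.card_val]

/-- The variable vertices of the edge through the `j`-th block of constants. -/
def gRest (j : J) : Finset (GVert J z d k) := Finset.univ.image fun y => Sum.inr (Sum.inl (j, y))

lemma gRest_subset (j : J) : gRest j ⊆ gX J z d k := by
  intro x hx
  obtain ⟨y, -, rfl⟩ := Finset.mem_image.1 hx
  exact mem_gX.2 ⟨_, rfl⟩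

lemma card_gRest (j : J) : (gRest (z := z) (d := d) (k := k) j).card = (d - z) + (k - d) := by
  rw [gRest, Finset.card_image_of_injective, Finset.card_univ]
  · simp
  · intro a b h
    simpa using h

lemma union_gRest_mem (j : J) :
    Finset.univ.image (fun a => Sum.inl (j, a)) ∪ gRest j ∈ gEdges J z d k := by
  refine Or.inr ⟨j, ?_⟩
  ext x
  simp only [gBaseFun, gRest, Finset.mem_union, Finset.mem_image, Finset.mem_univ, true_and]
  constructor
  · rintro ⟨(a | a) | a, rfl⟩
    · exact Or.inl ⟨a, rfl⟩
    · exact Or.inr ⟨_, rfl⟩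
    · exact Or.inr ⟨_, rfl⟩
  · rintro (⟨a, rfl⟩ | ⟨a | a, rfl⟩)
    · exact ⟨Sum.inl (Sum.inl a), rfl⟩
    · exact ⟨Sum.inl (Sum.inr a), rfl⟩
    · exact ⟨Sum.inr a, rfl⟩

lemma exists_copies {r s : ℕ} (c : Multiset (GVert J z d k)) (hc : ∀ a, Sum.inl a ∉ c)
    (hr : c.card + s ≤ r) :
    ∃ X : Finset ((J × Fin z) ⊕ (GVar J z d k × Fin r)),
      (∀ x ∈ X, ∃ v i, x = Sum.inr (v, i) ∧ s ≤ i.val) ∧ X.val.map (gProj r) = c := by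
  classical
  obtain ⟨X, hX, hXc⟩ := exists_subset_map_eq (p := gProj (J := J) (z := z) (d := d) (k := k) r)
    (Finset.univ.filter fun x => ∃ v i, x = Sum.inr (v, i) ∧ s ≤ i.val) c (by
      intro x hx
      rcases x with a | v
      · exact absurd hx (hc a)
      · have : (Finset.univ : Finset (Fin c.card)).card ≤ _ := Finset.card_le_card_of_injOn
          (t := ((Finset.univ.filter fun x : (J × Fin z) ⊕ (GVar J z d k × Fin r) =>
            ∃ v i, x = Sum.inr (v, i) ∧ s ≤ i.val).filter fun a => Sum.inr v = gProj r a))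
          (fun i => Sum.inr (v, ⟨i.val + s, by omega⟩)) (by
            intro i _
            have h2 : s ≤ i.val + s := Nat.le_add_left _ _
            simp only [Finset.coe_filter, Finset.mem_filter, Finset.mem_univ, true_and,
              Set.mem_ofPred_eq]
            exact ⟨⟨v, _, rfl, h2⟩, rfl⟩) (by
            intro i _ j _ hij
            simp only [Sum.inr.injEq, Prod.mk.injEq, Fin.mk.injEq, true_and] at hij
            exact Fin.ext (by omega))
        simpa using this)
  exact ⟨X, fun x hx => (Finset.mem_filter.1 (hX hx)).2, hXc⟩

lemma exists_eq_image_inr {α β : Type} [Fintype β] [DecidableEq α] [DecidableEq β]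
    (X : Finset (α ⊕ β)) (hX : ∀ x ∈ X, ∃ b, x = Sum.inr b) : ∃ T : Finset β, T.image Sum.inr = X := by
  obtain ⟨T, -, hT⟩ := (Finset.subset_image_iff (s := Finset.univ) (t := X)
    (f := (Sum.inr : β → α ⊕ β))).1 (by
      intro x hx
      obtain ⟨b, rfl⟩ := hX x hx
      simp)
  exact ⟨T, hT⟩

lemma exists_absorber_gadget (hl : 1 ≤ l) (hlk : 2 * l < k) (hld : l < d) (hdk : d ≤ k - 1) :
    ∃ r > 0, ∃ α β τ : Finset (GVar (Fin (k - l)) 1 d k × Fin r),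
      α.card = l ∧ β.card = l ∧ β ⊆ τ ∧ Disjoint α τ ∧
      LWalk l (liftEdges (gProj r) (gEdges (Fin (k - l)) 1 d k)) (α.image Sum.inr)
        (β.image Sum.inr) (τ.image Sum.inr).val ∧
      LWalk l (liftEdges (gProj r) (gEdges (Fin (k - l)) 1 d k)) (α.image Sum.inr)
        (β.image Sum.inr) (τ.image Sum.inr ∪ Finset.univ.image Sum.inl).val := by
  have hG : IsGadget k l d (gCov (Fin (k - l)) 1 d k) (gX (Fin (k - l)) 1 d k) :=
    isGadget_gCov hl hlk hld (by omega) (by omega) (by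
      rw [Fintype.card_fin]
      have : 1 * (k - 1) ≤ (k - l) * (k - 1) := Nat.mul_le_mul_right _ (by omega)
      omega)
  obtain ⟨A, hA, hAl⟩ := Finset.exists_subset_card_eq (show l ≤ (gX (Fin (k - l)) 1 d k).card from
    hld.le.trans hG.card_X)
  obtain ⟨c, hc0, hsc, hw1, hw2⟩ := hG.exists_absorbing_walks hA hAl
    (E' := gEdges (Fin (k - l)) 1 d k) Set.subset_union_left (J := Fin (k - l)) (by simp)
    (fun j => Sum.inl (j, 0)) (fun a b h => by simpa using h)
    (fun j e he => not_mem_gCov he _) (fun j => gRest j) (fun j => gRest_subset j)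
    (fun j => by
      have := union_gRest_mem (z := 1) (d := d) (k := k) j
      simpa using this)
    (fun j => by rw [card_gRest]; omega)
    (fun j h => by
      obtain ⟨a, ha⟩ := mem_gX.1 h
      simp at ha)
    (fun x hx => by
      obtain ⟨D, hxD, hDX, hDc⟩ := Finset.exists_subsuperset_card_eq
        (Finset.singleton_subset_iff.2 hx) (n := d) (by simp; omega) hG.card_X
      obtain ⟨e, he, hDe⟩ := hG.exists_edge D hDX hDc
      exact ⟨e, he, hDe (hxD (by simp))⟩)
  have hcl : ∀ a, Sum.inl a ∉ c := by
    rintro ⟨j, a⟩ h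
    have : a = 0 := Subsingleton.elim _ _
    subst this
    exact hsc j h
  have hAc : A.val ≤ c := hw1.end_le_of_ne hc0
  let r := c.card + 2
  have hinr : ∀ (i : Fin r), ∀ x ∈ A.image (gLift i), ∃ v, x = Sum.inr (v, i) := by
    intro i x hx
    obtain ⟨a, ha, rfl⟩ := Finset.mem_image.1 hx
    obtain ⟨b, rfl⟩ := mem_gX.1 (hA ha)
    exact ⟨_, rfl⟩
  obtain ⟨X2, hX2, hX2c⟩ := exists_copies (r := r) (s := 2) (c - A.val)
    (fun a h => hcl a (Multiset.mem_of_le (Multiset.sub_le_self _ _) h))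
    (Nat.add_le_add_right (Multiset.card_le_card (Multiset.sub_le_self _ _)) _)
  have hdA : ∀ (i j : Fin r), i ≠ j → Disjoint (A.image (gLift i)) (A.image (gLift j)) := by
    intro i j hij
    rw [Finset.disjoint_left]
    intro x hx hy
    obtain ⟨v, rfl⟩ := hinr i x hx
    obtain ⟨w, hw⟩ := hinr j _ hy
    simp only [Sum.inr.injEq, Prod.mk.injEq] at hw
    exact hij hw.2
  have hd2 : ∀ i : Fin r, i.val < 2 → Disjoint (A.image (gLift i)) X2 := by
    intro i hi
    rw [Finset.disjoint_left]
    intro x hx hy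
    obtain ⟨v, rfl⟩ := hinr i x hx
    obtain ⟨w, j, hw, hj⟩ := hX2 _ hy
    simp only [Sum.inr.injEq, Prod.mk.injEq] at hw
    rw [← hw.2] at hj
    omega
  set At := A.image (gLift (0 : Fin r)) with hAt
  set Bt := A.image (gLift (1 : Fin r)) with hBt
  have h01 : Disjoint At Bt := hdA 0 1 (by
    intro h
    have := congrArg Fin.val h
    simp [r] at this)
  have h02 : Disjoint At X2 := hd2 0 (by simp)
  have h12 : Disjoint Bt X2 := hd2 1 (by simp [r])
  have hX : (Bt ∪ X2).val.map (gProj r) = c := by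
    rw [union_val h12, Multiset.map_add, hX2c, hBt, map_gProj_image, add_tsub_cancel_of_le hAc]
  have hdisj : Disjoint At (Bt ∪ X2) := Finset.disjoint_union_right.2 ⟨h01, h02⟩
  have hXinr : ∀ x ∈ Bt ∪ X2, ∃ b, x = Sum.inr b := by
    intro x hx
    rcases Finset.mem_union.1 hx with h | h
    · obtain ⟨v, hv⟩ := hinr _ x h
      exact ⟨_, hv⟩
    · obtain ⟨v, i, hv, -⟩ := hX2 x h
      exact ⟨_, hv⟩
  have hk1 := LWalk.lift (p := gProj r) hl hw1 hc0 (map_gProj_image 0 A) hX hdisj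
    Finset.subset_union_left (map_gProj_image 1 A)
  set s : Finset ((Fin (k - l) × Fin 1) ⊕ (GVar (Fin (k - l)) 1 d k × Fin r)) :=
    Finset.univ.image Sum.inl with hs
  have hXs : Disjoint (Bt ∪ X2) s := by
    rw [Finset.disjoint_left]
    intro x hx hy
    obtain ⟨b, rfl⟩ := hXinr x hx
    simp [hs] at hy
  have hAs : Disjoint At s := by
    rw [Finset.disjoint_left]
    intro x hx hy
    obtain ⟨b, rfl⟩ := hinr 0 x hx
    simp [hs] at hy
  have hsval : s.val.map (gProj r) =
      (Finset.univ.image fun j : Fin (k - l) => (Sum.inl (j, 0) : GVert (Fin (k - l)) 1 d k)).val := by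
    have : s = (Finset.univ.image
        fun j : Fin (k - l) => (Sum.inl (j, 0) : GVert (Fin (k - l)) 1 d k)).image
          (gLift (0 : Fin r)) := by
      ext x
      simp only [hs, Finset.mem_image, Finset.mem_univ, true_and, exists_exists_eq_and, gLift]
      constructor
      · rintro ⟨⟨j, a⟩, rfl⟩
        exact ⟨j, by simp [Subsingleton.elim a 0]⟩
      · rintro ⟨j, rfl⟩
        exact ⟨(j, 0), rfl⟩
    rw [this, map_gProj_image]
  have hk2 := LWalk.lift (p := gProj r) (X := (Bt ∪ X2) ∪ s) hl hw2
    (fun h => hc0 (by simpa using congrArg (fun m => m) (add_eq_zero.1 h).1)) (map_gProj_image 0 A)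
    (by rw [union_val hXs, Multiset.map_add, hX, hsval])
    (Finset.disjoint_union_right.2 ⟨hdisj, hAs⟩)
    (Finset.subset_union_left.trans Finset.subset_union_left) (map_gProj_image 1 A)
  obtain ⟨α, hα⟩ := exists_eq_image_inr At fun x hx => by
    obtain ⟨v, hv⟩ := hinr _ x hx
    exact ⟨_, hv⟩
  obtain ⟨β, hβ⟩ := exists_eq_image_inr Bt fun x hx => by
    obtain ⟨v, hv⟩ := hinr _ x hx
    exact ⟨_, hv⟩
  obtain ⟨τ, hτ⟩ := exists_eq_image_inr (Bt ∪ X2) hXinr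
  refine ⟨r, by positivity, α, β, τ, ?_, ?_, ?_, ?_, ?_, ?_⟩
  · refine Eq.trans ?_ hAl
    rw [← card_image_gLift (0 : Fin r) A, ← hAt, ← hα,
      Finset.card_image_of_injective _ Sum.inr_injective]
  · refine Eq.trans ?_ hAl
    rw [← card_image_gLift (1 : Fin r) A, ← hBt, ← hβ,
      Finset.card_image_of_injective _ Sum.inr_injective]
  · rw [← Finset.image_subset_image_iff (Sum.inr_injective (α := Fin (k - l) × Fin 1)), hβ, hτ]
    exact Finset.subset_union_left
  · rw [← Finset.disjoint_image (Sum.inr_injective (α := Fin (k - l) × Fin 1)), hα, hτ]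
    exact hdisj
  · rw [hα, hβ, hτ]
    exact hk1
  · rw [hα, hβ, hτ]
    exact hk2

lemma exists_connector_gadget (hl : 1 ≤ l) (hlk : 2 * l < k) (hld : l < d) (hdk : d ≤ k - 1) :
    ∃ r > 0, ∃ τ : Finset (GVar Bool l d k × Fin r),
      LWalk l (liftEdges (gProj r) (gEdges Bool l d k))
        (Finset.univ.image fun a => Sum.inl (false, a))
        (Finset.univ.image fun a => Sum.inl (true, a))
        (τ.image Sum.inr ∪ Finset.univ.image fun a => Sum.inl (true, a)).val := by
  have hG : IsGadget k l d (gCov Bool l d k) (gX Bool l d k) :=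
    isGadget_gCov hl hlk hld (by omega) (by omega) (by
      rw [Fintype.card_bool]
      omega)
  let Z : Bool → Finset (GVert Bool l d k) := fun j => Finset.univ.image fun a => Sum.inl (j, a)
  have hZl : ∀ j, (Z j).card = l := by
    intro j
    simp only [Z]
    rw [Finset.card_image_of_injective, Finset.card_univ, Fintype.card_fin]
    intro a b h
    simpa using h
  have hZE : ∀ j, ∀ e ∈ gCov Bool l d k, Disjoint (Z j) e := by
    intro j e he
    rw [Finset.disjoint_left]
    intro x hx
    obtain ⟨a, -, rfl⟩ := Finset.mem_image.1 hx
    exact not_mem_gCov he _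
  have hZG : ∀ i j, Disjoint (Z i) (gRest j) := by
    intro i j
    rw [Finset.disjoint_left]
    intro x hx hy
    obtain ⟨a, -, rfl⟩ := Finset.mem_image.1 hx
    simp [gRest] at hy
  obtain ⟨c, hc1, hc2, hw⟩ := hG.exists_connecting_walk (E' := gEdges Bool l d k)
    Set.subset_union_left (Z := Z false) (Z' := Z true) (G := gRest false) (G' := gRest true)
    (hZl true) (hZE false) (hZE true) (hZG _ _) (hZG _ _) (hZG _ _) (hZG _ _)
    (gRest_subset _) (gRest_subset _) (union_gRest_mem _) (union_gRest_mem _)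
    (by rw [card_gRest]; omega) (by rw [card_gRest]; omega)
  have hcl : ∀ a, Sum.inl a ∉ c := by
    rintro ⟨j, a⟩ h
    cases j
    · exact hc1 _ (Finset.mem_image.2 ⟨a, Finset.mem_univ _, rfl⟩) h
    · exact hc2 _ (Finset.mem_image.2 ⟨a, Finset.mem_univ _, rfl⟩) h
  let r := c.card + 1
  obtain ⟨X, hX, hXc⟩ := exists_copies (r := r) (s := 0) c hcl (by omega)
  have hXinr : ∀ x ∈ X, ∃ b, x = Sum.inr b := by
    intro x hx
    obtain ⟨v, i, hv, -⟩ := hX x hx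
    exact ⟨_, hv⟩
  obtain ⟨τ, hτ⟩ := exists_eq_image_inr X hXinr
  let Zt : Bool → Finset ((Bool × Fin l) ⊕ (GVar Bool l d k × Fin r)) :=
    fun j => Finset.univ.image fun a => Sum.inl (j, a)
  have hZt : ∀ j, Zt j = (Z j).image (gLift (0 : Fin r)) := by
    intro j
    simp only [Z, Zt, Finset.image_image]
    rfl
  have hZX : ∀ j, Disjoint X (Zt j) := by
    intro j
    rw [Finset.disjoint_left]
    intro x hx hy
    obtain ⟨b, rfl⟩ := hXinr x hx
    simp [Zt] at hy
  have hZval : ∀ j, (Zt j).val.map (gProj r) = (Z j).val := by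
    intro j
    rw [hZt, map_gProj_image]
  have := LWalk.lift (p := gProj r) (At := Zt false) (X := X ∪ Zt true) (Bt := Zt true) hl hw
    (by
      intro h
      have := (add_eq_zero.1 h).2
      have h2 := hZl true
      rw [Finset.val_eq_zero.1 this] at h2
      simp at h2
      omega) (hZval _)
    (by rw [union_val (hZX _), Multiset.map_add, hXc, hZval])
    (Finset.disjoint_union_right.2 ⟨(hZX _).symm, by
      rw [Finset.disjoint_left]
      intro x hx hy
      obtain ⟨a, -, rfl⟩ := Finset.mem_image.1 hx
      simp [Zt] at hy⟩) Finset.subset_union_right (hZval _)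
  refine ⟨r, by positivity, τ, ?_⟩
  rw [hτ]
  exact this

/-- Every set of size `k - l` has many absorbers. -/
lemma exists_many_absorbers (hl : 1 ≤ l) (hlk : 2 * l < k) (hld : l < d) (hdk : d ≤ k - 1)
    {δ : ℝ} (hδ0 : 0 < δ) (hδ : δ ≤ 1) :
    ∃ (b : ℕ) (α β τ : Finset (Fin b)) (ρ : ℝ) (n0 : ℕ), 0 < ρ ∧ α.card = l ∧ β.card = l ∧
      β ⊆ τ ∧ Disjoint α τ ∧ ∀ (V : Type) [Fintype V] [DecidableEq V] (H : Set (Finset V)),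
      DegCond d k H δ → n0 ≤ Fintype.card V → ∀ S : Finset V, S.card = k - l →
      ρ * (Fintype.card V : ℝ) ^ b ≤
        cnt (fun g : Fin b → V => Function.Injective g ∧ (∀ i, g i ∉ S) ∧
          LWalk l H (α.image g) (β.image g) (τ.image g).val ∧
          LWalk l H (α.image g) (β.image g) (τ.image g ∪ S).val) := by
  obtain ⟨r, hr, α, β, τ, hα, hβ, hβτ, hατ, hw1, hw2⟩ := exists_absorber_gadget hl hlk hld hdk
  obtain ⟨ρ, hρ, γ, hγ, n0, hn0⟩ := DegCond.cnt_blowup_gadget (J := Fin (k - l)) 1 d k δ hδ0 hδ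
    (by omega) hr
  let B := GVar (Fin (k - l)) 1 d k × Fin r
  let e : B ≃ Fin (Fintype.card B) := Fintype.equivFin B
  refine ⟨Fintype.card B, α.image e, β.image e, τ.image e, ρ, n0, hρ, ?_, ?_, ?_, ?_, ?_⟩
  · rw [Finset.card_image_of_injective _ e.injective, hα]
  · rw [Finset.card_image_of_injective _ e.injective, hβ]
  · exact Finset.image_subset_image hβτ
  · rwa [Finset.disjoint_image e.injective]
  intro V _ _ H hH hV S hS
  let c0 : Fin (k - l) × Fin 1 ≃ S := (Equiv.prodUnique _ _).trans (S.equivFinOfCardEq hS).symm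
  let c : Fin (k - l) × Fin 1 → V := fun x => (c0 x : V)
  have hc : Function.Injective c := Subtype.val_injective.comp c0.injective
  have hcS : Finset.univ.image c = S := by
    ext x
    simp only [Finset.mem_image, Finset.mem_univ, true_and]
    constructor
    · rintro ⟨a, rfl⟩
      exact (c0 a).2
    · intro hx
      exact ⟨c0.symm ⟨x, hx⟩, by simp [c]⟩
  have h := hn0 V H hH hV c hc ∅ (by simp; positivity)
  refine h.trans ?_
  rw [← cnt_equiv (Equiv.arrowCongr e (Equiv.refl V))]
  refine cnt_mono ?_
  rintro g ⟨-, hinj, hg⟩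
  have hge : (Equiv.arrowCongr e (Equiv.refl V)) g ∘ e = g := by
    ext x
    simp
  have himg : ∀ T : Finset B, (T.image e).image ((Equiv.arrowCongr e (Equiv.refl V)) g) =
      (T.image Sum.inr).image (Sum.elim c g) := by
    intro T
    rw [Finset.image_image, hge, Finset.image_image]
    rfl
  have hmap : ∀ f ∈ liftEdges (gProj r) (gEdges (Fin (k - l)) 1 d k),
      Set.InjOn (Sum.elim c g) f ∧ f.image (Sum.elim c g) ∈ H := fun f hf => ⟨hinj.injOn, hg f hf⟩
  refine ⟨?_, ?_, ?_, ?_⟩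
  · have : (Equiv.arrowCongr e (Equiv.refl V)) g = Sum.elim c g ∘ Sum.inr ∘ e.symm := by
      ext x
      simp
    rw [this]
    exact hinj.comp (Sum.inr_injective.comp e.symm.injective)
  · intro i hi
    rw [← hcS] at hi
    obtain ⟨a, -, ha⟩ := Finset.mem_image.1 hi
    have := @hinj (Sum.inl a) (Sum.inr (e.symm i)) (by simpa using ha)
    simp at this
  · have := hw1.map hmap
    rw [himg, himg, himg]
    rwa [← Finset.image_val_of_injOn hinj.injOn] at this
  · have := hw2.map hmap
    rw [himg, himg, himg]
    rw [← Finset.image_val_of_injOn hinj.injOn, Finset.image_union] at this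
    convert this using 3
    rw [Finset.image_image, ← hcS]
    rfl

/-- Two `l`-sets can be connected by a short walk avoiding a small set. -/
lemma exists_connector (hl : 1 ≤ l) (hlk : 2 * l < k) (hld : l < d) (hdk : d ≤ k - 1)
    {δ : ℝ} (hδ0 : 0 < δ) (hδ : δ ≤ 1) :
    ∃ (γ : ℝ) (c0 n0 : ℕ), 0 < γ ∧
      ∀ (V : Type) [Fintype V] [DecidableEq V] (H : Set (Finset V)),
      DegCond d k H δ → n0 ≤ Fintype.card V → ∀ A B F : Finset V, A.card = l → B.card = l →
      Disjoint A B → (F.card : ℝ) ≤ γ * Fintype.card V →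
      ∃ R : Finset V, Disjoint R F ∧ Disjoint R A ∧ Disjoint R B ∧ R.card ≤ c0 ∧
        LWalk l H A B (R ∪ B).val := by
  obtain ⟨r, hr, τ, hw⟩ := exists_connector_gadget hl hlk hld hdk
  obtain ⟨ρ, hρ, γ, hγ, n0, hn0⟩ := DegCond.cnt_blowup_gadget (J := Bool) l d k δ hδ0 hδ
    (by omega) hr
  refine ⟨γ, τ.card, n0 + 1, hγ, ?_⟩
  intro V _ _ H hH hV A B F hA hB hAB hF
  let eA : Fin l ≃ A := (A.equivFinOfCardEq hA).symm
  let eB : Fin l ≃ B := (B.equivFinOfCardEq hB).symm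
  let c : Bool × Fin l → V := fun x => if x.1 then (eB x.2 : V) else (eA x.2 : V)
  have hcA : (Finset.univ.image fun a => c (false, a)) = A := by
    ext x
    simp only [Finset.mem_image, Finset.mem_univ, true_and, c]
    constructor
    · rintro ⟨a, rfl⟩
      exact (eA a).2
    · intro hx
      exact ⟨eA.symm ⟨x, hx⟩, by simp⟩
  have hcB : (Finset.univ.image fun a => c (true, a)) = B := by
    ext x
    simp only [Finset.mem_image, Finset.mem_univ, true_and, c]
    constructor
    · rintro ⟨a, rfl⟩
      exact (eB a).2
    · intro hx
      exact ⟨eB.symm ⟨x, hx⟩, by simp⟩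
  have hc : Function.Injective c := by
    rintro ⟨i, a⟩ ⟨j, b⟩ h
    cases i <;> cases j <;> simp only [c] at h
    · simpa using h
    · exact absurd ((eA a).2) (Finset.disjoint_right.1 hAB (by
        have : ((eA a : V)) = eB b := by simpa using h
        rw [this]
        exact (eB b).2))
    · exact absurd ((eA b).2) (Finset.disjoint_right.1 hAB (by
        have : ((eB a : V)) = eA b := by simpa using h
        rw [← this]
        exact (eB a).2))
    · simpa using h
  have h := hn0 V H hH (by omega) c hc F hF
  have hV0 : (0 : ℝ) < Fintype.card V := by
    have : 0 < Fintype.card V := by omega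
    exact_mod_cast this
  obtain ⟨g, hgF, hinj, hg⟩ := exists_of_cnt_pos (lt_of_lt_of_le (by positivity) h)
  have hmap : ∀ f ∈ liftEdges (gProj r) (gEdges Bool l d k),
      Set.InjOn (Sum.elim c g) f ∧ f.image (Sum.elim c g) ∈ H := fun f hf => ⟨hinj.injOn, hg f hf⟩
  have hcR : ∀ j, Disjoint (τ.image g) (Finset.univ.image fun a => c (j, a)) := by
    intro j
    rw [Finset.disjoint_left]
    intro x hx hy
    obtain ⟨b, -, rfl⟩ := Finset.mem_image.1 hx
    obtain ⟨a, -, ha⟩ := Finset.mem_image.1 hy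
    have := @hinj (Sum.inl (j, a)) (Sum.inr b) (by simpa using ha)
    simp at this
  refine ⟨τ.image g, ?_, ?_, ?_, Finset.card_image_le, ?_⟩
  · rw [Finset.disjoint_left]
    intro x hx
    obtain ⟨b, -, rfl⟩ := Finset.mem_image.1 hx
    exact hgF b
  · rw [← hcA]
    exact hcR false
  · rw [← hcB]
    exact hcR true
  · have := hw.map hmap
    rw [← Finset.image_val_of_injOn hinj.injOn, Finset.image_union, Finset.image_image,
      Finset.image_image, Finset.image_image] at this
    rw [← hcA, ← hcB]
    exact this

end Gadget

lemma exists_heavy {X Y : Type} [Fintype X] (T : Finset Y) (w : Y → ℝ)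
    (hw : ∀ y ∈ T, 0 ≤ w y) (Q : Y → X → Prop) [∀ x, DecidablePred fun y => Q y x]
    {ρ : ℝ} (hQ : ∀ y ∈ T, ρ * Fintype.card X ≤ cnt (Q y)) [Nonempty X] :
    ∃ x : X, ρ * ∑ y ∈ T, w y ≤ ∑ y ∈ T with Q y x, w y := by
  classical
  by_contra! h
  have h1 : ∑ x : X, ∑ y ∈ T with Q y x, w y < ∑ x : X, ρ * ∑ y ∈ T, w y :=
    Finset.sum_lt_sum_of_nonempty Finset.univ_nonempty fun x _ => h x
  have h2 : ∑ x : X, ∑ y ∈ T with Q y x, w y = ∑ y ∈ T, w y * cnt (Q y) := by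
    simp_rw [Finset.sum_filter]
    rw [Finset.sum_comm]
    refine Finset.sum_congr rfl fun y _ => ?_
    rw [cnt_eq_sum, Finset.mul_sum]
    refine Finset.sum_congr rfl fun x _ => ?_
    split_ifs <;> simp
  rw [h2, Finset.sum_const, nsmul_eq_mul, Finset.card_univ] at h1
  have h3 : ∑ y ∈ T, w y * (ρ * Fintype.card X) ≤ ∑ y ∈ T, w y * cnt (Q y) :=
    Finset.sum_le_sum fun y hy => mul_le_mul_of_nonneg_left (hQ y hy) (hw y hy)
  rw [← Finset.sum_mul] at h3
  nlinarith

section Greedy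

variable {V : Type} [Fintype V] [DecidableEq V]

open Classical in
lemma greedy_family {Y : Type} (T : Finset Y) (hT : T.Nonempty) {b M : ℕ}
    (P : Y → (Fin b → V) → Prop) {ρ : ℝ} (hρ : 0 < ρ) (hρ1 : ρ ≤ 1)
    (hP : ∀ S ∈ T, ρ * (Fintype.card V : ℝ) ^ b ≤ cnt (P S))
    (hM : (b : ℝ) ^ 2 + b * (b * M) ≤ ρ / 2 * Fintype.card V) (hV : 0 < Fintype.card V) :
    ∀ m ≤ M, ∃ ω : ℕ → Fin b → V, (∀ i < m, Function.Injective (ω i)) ∧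
      (∀ i < m, ∀ j < m, i ≠ j → ∀ a c, ω i a ≠ ω j c) ∧
      (∀ i < m, ∃ S ∈ T, P S (ω i)) ∧
      ∑ S ∈ T, (1 / 2 : ℝ) ^ ((Finset.range m).filter fun i => P S (ω i)).card ≤
        T.card * (1 - ρ / 4) ^ m := by
  intro m
  induction m with
  | zero =>
    intro _
    have : Nonempty V := Fintype.card_pos_iff.1 hV
    exact ⟨fun _ _ => Classical.arbitrary V, by simp, by simp, by simp, by simp⟩
  | succ m ih =>
    intro hm
    obtain ⟨ω, h1, h2, h3, h4⟩ := ih (by omega)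
    set F : Finset V := (Finset.range m).biUnion fun i => Finset.univ.image (ω i) with hF
    have hFc : (F.card : ℝ) ≤ b * M := by
      have : F.card ≤ m * b := by
        refine (Finset.card_biUnion_le_card_mul _ _ b fun i _ => ?_).trans (by simp)
        exact Finset.card_image_le.trans (by simp)
      have h : F.card ≤ b * M := by nlinarith
      exact_mod_cast h
    have hQ : ∀ S ∈ T, ρ / 2 * (Fintype.card (Fin b → V) : ℝ) ≤
        cnt (fun g => P S g ∧ Function.Injective g ∧ ∀ i, g i ∉ F) := by
      intro S hS
      have := cnt_inj_avoid (P S) F (τ := ρ) (by simpa using hP S hS) (by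
        simp only [Fintype.card_fin]
        have : (b : ℝ) * F.card ≤ b * (b * M) := by gcongr
        linarith) hV
      simpa using this
    have : Nonempty V := Fintype.card_pos_iff.1 hV
    set w : Y → ℝ := fun S => (1 / 2 : ℝ) ^ ((Finset.range m).filter fun i => P S (ω i)).card with hw
    have hwpos : ∀ S, 0 < w S := fun S => by positivity
    obtain ⟨g, hg⟩ := exists_heavy T w (fun y _ => (hwpos y).le) _ hQ
    have hsum : 0 < ∑ S ∈ T, w S := Finset.sum_pos (fun S _ => hwpos S) hT
    obtain ⟨S0, hS0⟩ : (T.filter fun S => P S g ∧ Function.Injective g ∧ ∀ i, g i ∉ F).Nonempty := by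
      by_contra hne
      rw [Finset.not_nonempty_iff_eq_empty] at hne
      rw [hne, Finset.sum_empty] at hg
      have : 0 < ρ / 2 * ∑ S ∈ T, w S := by positivity
      linarith
    obtain ⟨hS0T, hS0g, hginj, hgF⟩ := Finset.mem_filter.1 hS0
    have hgF' : ∀ i < m, ∀ a c, ω i a ≠ g c := by
      intro i hi a c h
      exact hgF c (Finset.mem_biUnion.2 ⟨i, Finset.mem_range.2 hi,
        Finset.mem_image.2 ⟨a, Finset.mem_univ _, h⟩⟩)
    have hup : ∀ i < m, Function.update ω m g i = ω i := fun i hi =>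
      Function.update_of_ne (by omega) _ _
    have hupm : Function.update ω m g m = g := Function.update_self _ _ _
    refine ⟨Function.update ω m g, ?_, ?_, ?_, ?_⟩
    · intro i hi
      rcases Nat.lt_succ_iff_lt_or_eq.1 hi with hi | rfl
      · rw [hup i hi]
        exact h1 i hi
      · rw [hupm]
        exact hginj
    · intro i hi j hj hij a c
      rcases Nat.lt_succ_iff_lt_or_eq.1 hi with hi | hi <;>
      rcases Nat.lt_succ_iff_lt_or_eq.1 hj with hj | hj
      · rw [hup i hi, hup j hj]
        exact h2 i hi j hj hij a c
      · rw [hup i hi, hj, hupm]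
        exact hgF' i hi a c
      · rw [hup j hj, hi, hupm]
        exact (hgF' j hj c a).symm
      · omega
    · intro i hi
      rcases Nat.lt_succ_iff_lt_or_eq.1 hi with hi | rfl
      · rw [hup i hi]
        exact h3 i hi
      · rw [hupm]
        exact ⟨S0, hS0T, hS0g⟩
    · have hcard : ∀ S, (1 / 2 : ℝ) ^ ((Finset.range (m + 1)).filter fun i =>
          P S (Function.update ω m g i)).card = if P S g then w S / 2 else w S := by
        intro S
        have hfil : ((Finset.range m).filter fun i => P S (Function.update ω m g i)) =
            (Finset.range m).filter fun i => P S (ω i) := by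
          refine Finset.filter_congr fun i hi => ?_
          rw [hup i (Finset.mem_range.1 hi)]
        rw [Finset.range_add_one, Finset.filter_insert, hupm, hfil]
        split_ifs
        · rw [Finset.card_insert_of_notMem (by simp), pow_succ]
          simp only [hw]
          ring
        · rfl
      simp_rw [hcard]
      have e1 : ∑ S ∈ T, (if P S g then w S / 2 else w S) =
          ∑ S ∈ T, w S - 1 / 2 * ∑ S ∈ T with P S g, w S := by
        rw [Finset.sum_filter, Finset.mul_sum, ← Finset.sum_sub_distrib]
        refine Finset.sum_congr rfl fun S _ => ?_
        split_ifs <;> ring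
      have e2 : ∑ S ∈ T with (P S g ∧ Function.Injective g ∧ ∀ i, g i ∉ F), w S ≤
          ∑ S ∈ T with P S g, w S := by
        refine Finset.sum_le_sum_of_subset_of_nonneg ?_ fun S _ _ => (hwpos S).le
        intro S hS
        rw [Finset.mem_filter] at hS ⊢
        exact ⟨hS.1, hS.2.1⟩
      rw [e1, pow_succ]
      have h5 : (∑ S ∈ T, w S) * (1 - ρ / 4) ≤ T.card * (1 - ρ / 4) ^ m * (1 - ρ / 4) :=
        mul_le_mul_of_nonneg_right h4 (by linarith)
      linarith

open Filter Topology in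
open Classical in
lemma exists_absorber_family (k b : ℕ) {ρ ζ : ℝ} (hρ : 0 < ρ) (hρ1 : ρ ≤ 1) (hζ : 0 < ζ)
    (hζρ : 4 * (b : ℝ) ^ 2 * ζ ≤ ρ) :
    ∃ ξ > (0 : ℝ), ∃ n0 : ℕ, ∀ (V : Type) [Fintype V] [DecidableEq V], n0 ≤ Fintype.card V →
      ∀ (T : Finset (Finset V)), T.Nonempty → (T.card : ℝ) ≤ (Fintype.card V : ℝ) ^ k →
      ∀ (P : Finset V → (Fin b → V) → Prop),
      (∀ S ∈ T, ρ * (Fintype.card V : ℝ) ^ b ≤ cnt (P S)) →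
      ∃ (M : ℕ) (ω : ℕ → Fin b → V), (M : ℝ) ≤ ζ * Fintype.card V ∧
        (∀ i < M, Function.Injective (ω i)) ∧
        (∀ i < M, ∀ j < M, i ≠ j → ∀ a c, ω i a ≠ ω j c) ∧
        (∀ i < M, ∃ S ∈ T, P S (ω i)) ∧
        ∀ S ∈ T, ξ * Fintype.card V ≤ ((Finset.range M).filter fun i => P S (ω i)).card := by
  set ξ := ρ * ζ / 8 with hξ
  have hξ0 : 0 < ξ := by positivity
  have hlim : Tendsto (fun n : ℕ => (n : ℝ) ^ k * Real.exp (-ξ * n)) atTop (𝓝 0) := by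
    have := Real.tendsto_pow_mul_exp_neg_atTop_nhds_zero k
    have h2 : Tendsto (fun n : ℕ => (ξ * n : ℝ)) atTop atTop :=
      Tendsto.const_mul_atTop hξ0 tendsto_natCast_atTop_atTop
    have h3 := (this.comp h2).const_mul ((ξ ^ k)⁻¹)
    rw [mul_zero] at h3
    refine h3.congr fun n => ?_
    simp only [Function.comp]
    rw [mul_pow, neg_mul]
    field_simp
  obtain ⟨n1, hn1⟩ := eventually_atTop.1
    (hlim.eventually (gt_mem_nhds (show 0 < Real.exp (-(ρ / 4)) from Real.exp_pos _)))
  obtain ⟨n2, hn2⟩ := exists_nat_ge ((b : ℝ) ^ 2 / (ρ / 4))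
  refine ⟨ξ, hξ0, max (max n1 n2) 1, ?_⟩
  intro V _ _ hV T hT hTc P hP
  set n := Fintype.card V with hn
  have hnn1 : n1 ≤ n := (le_max_left _ _).trans ((le_max_left _ _).trans hV)
  have hnn2 : n2 ≤ n := (le_max_right _ _).trans ((le_max_left _ _).trans hV)
  have hn0 : 0 < n := lt_of_lt_of_le Nat.one_pos ((le_max_right _ _).trans hV)
  set M := ⌊ζ * n⌋₊ with hM
  have hM1 : (M : ℝ) ≤ ζ * n := Nat.floor_le (by positivity)
  have hM2 : ζ * n - 1 ≤ M := (Nat.sub_one_lt_floor _).le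
  have hb : (b : ℝ) ^ 2 + b * (b * M) ≤ ρ / 2 * n := by
    have e1 : (b : ℝ) ^ 2 ≤ ρ / 4 * n := by
      rw [div_le_iff₀ (by positivity)] at hn2
      have : (n2 : ℝ) ≤ n := by exact_mod_cast hnn2
      nlinarith
    have e2 : (b : ℝ) * (b * M) ≤ ρ / 4 * n := by
      calc (b : ℝ) * (b * M) = (b : ℝ) ^ 2 * M := by ring
        _ ≤ (b : ℝ) ^ 2 * (ζ * n) := by gcongr
        _ ≤ ρ / 4 * n := by
          have : (0 : ℝ) ≤ n := by positivity
          nlinarith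
    linarith
  obtain ⟨ω, h1, h2, h3, h4⟩ := greedy_family T hT P hρ hρ1 hP hb hn0 M le_rfl
  refine ⟨M, ω, hM1, h1, h2, h3, ?_⟩
  intro S hS
  by_contra! hlt
  set x := ((Finset.range M).filter fun i => P S (ω i)).card with hx
  have h5 : (1 / 2 : ℝ) ^ x ≤ T.card * (1 - ρ / 4) ^ M :=
    (Finset.single_le_sum (f := fun S => (1 / 2 : ℝ) ^
      ((Finset.range M).filter fun i => P S (ω i)).card) (fun _ _ => by positivity) hS).trans h4
  have h6 : Real.exp (-(ξ * n)) ≤ (1 / 2 : ℝ) ^ x := by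
    have e : Real.exp (-1) ≤ 1 / 2 := by
      rw [Real.exp_neg, one_div]
      exact inv_anti₀ (by norm_num) (by
        have := Real.add_one_le_exp (1 : ℝ)
        linarith)
    calc Real.exp (-(ξ * n)) ≤ Real.exp (-(x : ℝ)) := Real.exp_le_exp.2 (by linarith)
      _ = Real.exp (-1) ^ x := by rw [← Real.exp_nat_mul]; ring_nf
      _ ≤ _ := by gcongr
  have h7 : (1 - ρ / 4) ^ M ≤ Real.exp (ρ / 4) * Real.exp (-(2 * ξ * n)) := by
    calc (1 - ρ / 4) ^ M ≤ Real.exp (-(ρ / 4)) ^ M := by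
          gcongr
          · linarith
          · have := Real.add_one_le_exp (-(ρ / 4))
            linarith
      _ = Real.exp (-(ρ / 4) * M) := by rw [← Real.exp_nat_mul]; ring_nf
      _ ≤ Real.exp (ρ / 4 + -(2 * ξ * n)) := by
          refine Real.exp_le_exp.2 ?_
          rw [hξ]
          nlinarith
      _ = _ := Real.exp_add _ _
  have h8 := hn1 n hnn1
  have h9 : Real.exp (-(ξ * n)) ≤ (n : ℝ) ^ k * (Real.exp (ρ / 4) * Real.exp (-(2 * ξ * n))) :=
    h6.trans (h5.trans (mul_le_mul hTc h7 (pow_nonneg (by linarith) _) (by positivity)))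
  have h10 : Real.exp (-(2 * ξ * n)) = Real.exp (-(ξ * n)) * Real.exp (-ξ * n) := by
    rw [← Real.exp_add]
    ring_nf
  have h11 : (n : ℝ) ^ k * (Real.exp (ρ / 4) * Real.exp (-(2 * ξ * n))) =
      Real.exp (-(ξ * n)) * (Real.exp (ρ / 4) * ((n : ℝ) ^ k * Real.exp (-ξ * n))) := by
    rw [h10]
    ring
  have h12 : Real.exp (ρ / 4) * ((n : ℝ) ^ k * Real.exp (-ξ * n)) < 1 := by
    calc _ < Real.exp (ρ / 4) * Real.exp (-(ρ / 4)) := by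
          exact mul_lt_mul_of_pos_left h8 (Real.exp_pos _)
      _ = 1 := by rw [← Real.exp_add]; simp
  rw [h11] at h9
  have := Real.exp_pos (-(ξ * n))
  nlinarith

end Greedy

section Chain

variable {V : Type} [Fintype V] [DecidableEq V]

lemma exists_chain {l c0 : ℕ} {L : ℝ} {H : Set (Finset V)}
    (hconn : ∀ A B F : Finset V, A.card = l → B.card = l → Disjoint A B → (F.card : ℝ) ≤ L →
      ∃ R : Finset V, Disjoint R F ∧ Disjoint R A ∧ Disjoint R B ∧ R.card ≤ c0 ∧
        LWalk l H A B (R ∪ B).val)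
    {ι : Type} [DecidableEq ι] {A B : ι → Finset V} {F : Finset V} {I : Finset ι}
    (hI : I.Nonempty) (hA : ∀ i ∈ I, (A i).card = l)
    (hB : ∀ i ∈ I, (B i).card = l) (hAB : ∀ i ∈ I, ∀ j ∈ I, Disjoint (A i) (B j))
    (hF : (F.card : ℝ) + c0 * I.card ≤ L) :
    ∃ i0 ∈ I, ∃ i1 ∈ I, ∃ R : Finset V, Disjoint R F ∧ R.card ≤ c0 * I.card ∧
      ∀ K : ι → Finset V, (∀ i ∈ I, PathOn l H (A i) (B i) (K i)) →
        (∀ i ∈ I, ∀ j ∈ I, i ≠ j → Disjoint (K i) (K j)) → (∀ i ∈ I, Disjoint (K i) R) →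
        PathOn l H (A i0) (B i1) (I.biUnion K ∪ R) := by
  induction hI using Finset.Nonempty.cons_induction with
  | singleton a =>
    refine ⟨a, by simp, a, by simp, ∅, by simp, by simp, fun K hK _ _ => ?_⟩
    simpa using hK a (by simp)
  | cons a I ha hI ih =>
    rw [Finset.cons_eq_insert] at *
    obtain ⟨i0, hi0, i1, hi1, R, hR1, hR2, hR3⟩ := ih (fun i hi => hA i (by simp [hi]))
      (fun i hi => hB i (by simp [hi]))
      (fun i hi j hj => hAB i (by simp [hi]) j (by simp [hj])) (by
        rw [Finset.card_insert_of_notMem ha] at hF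
        push_cast at hF
        have : (0 : ℝ) ≤ c0 := by positivity
        linarith)
    obtain ⟨R', h1, h2, h3, h4, h5⟩ := hconn (B i1) (A a) (F ∪ R) (hB _ (by simp [hi1]))
      (hA a (by simp)) (hAB a (by simp) i1 (by simp [hi1])).symm (by
        have e1 : ((F ∪ R).card : ℝ) ≤ F.card + c0 * I.card := by
          have := (Finset.card_union_le F R).trans (Nat.add_le_add_left hR2 _)
          exact_mod_cast this
        rw [Finset.card_insert_of_notMem ha] at hF
        push_cast at hF
        have : (0 : ℝ) ≤ c0 := by positivity
        linarith)
    rw [Finset.disjoint_union_right] at h1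
    refine ⟨i0, by simp [hi0], a, by simp, R ∪ R', Finset.disjoint_union_left.2 ⟨hR1, h1.1⟩, ?_, ?_⟩
    · rw [Finset.card_insert_of_notMem ha]
      refine (Finset.card_union_le _ _).trans ?_
      rw [Nat.mul_add_one]
      exact Nat.add_le_add hR2 h4
    · intro K hK hKd hKR
      have hP := hR3 K (fun i hi => hK i (by simp [hi]))
        (fun i hi j hj => hKd i (by simp [hi]) j (by simp [hj]))
        (fun i hi => (Finset.disjoint_union_right.1 (hKR i (by simp [hi]))).1)
      have hj := hP.join h5 (hK a (by simp)) ?_ ?_ ?_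
      · convert hj using 1
        rw [Finset.biUnion_insert]
        ext x
        simp only [Finset.mem_union]
        tauto
      · rw [Finset.disjoint_union_left, Finset.disjoint_biUnion_left]
        exact ⟨fun i hi => (Finset.disjoint_union_right.1 (hKR i (by simp [hi]))).2, h1.2.symm⟩
      · rw [Finset.disjoint_union_left, Finset.disjoint_biUnion_left]
        exact ⟨fun i hi => hKd i (by simp [hi]) a (by simp) (by rintro rfl; exact ha hi),
          (Finset.disjoint_union_right.1 (hKR a (by simp))).1.symm⟩
      · exact (Finset.disjoint_union_right.1 (hKR a (by simp))).2.symm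

open Classical in
lemma exists_assignment {c M t : ℕ} (P : Finset V → ℕ → Prop)
    (hP : ∀ S : Finset V, S.card = c → t ≤ ((Finset.range M).filter fun i => P S i).card) :
    ∀ h ≤ t, ∀ U : Finset V, U.card = h * c → ∃ s : ℕ → Finset V,
      (∀ i < M, s i = ∅ ∨ (s i).card = c ∧ P (s i) i) ∧ (∀ i, s i ⊆ U) ∧
      (∀ i < M, ∀ j < M, i ≠ j → Disjoint (s i) (s j)) ∧ (Finset.range M).biUnion s = U ∧
      ((Finset.range M).filter fun i => s i ≠ ∅).card ≤ h := by
  intro h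
  induction h with
  | zero =>
    intro _ U hU
    have : U = ∅ := by simpa using hU
    subst this
    exact ⟨fun _ => ∅, by simp, by simp, by simp, by ext; simp, by simp⟩
  | succ h ih =>
    intro ht U hU
    obtain ⟨S, hSU, hSc⟩ := Finset.exists_subset_card_eq (show c ≤ U.card by
      rw [hU]
      nlinarith)
    obtain ⟨s, h1, h2, h3, h4, h5⟩ := ih (by omega) (U \ S) (by
      rw [Finset.card_sdiff_of_subset hSU, hU, hSc, Nat.add_one_mul]
      omega)
    obtain ⟨a, ha⟩ : (((Finset.range M).filter fun i => P S i) \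
        ((Finset.range M).filter fun i => s i ≠ ∅)).Nonempty := by
      rw [← Finset.card_pos]
      have e1 := Finset.le_card_sdiff ((Finset.range M).filter fun i => s i ≠ ∅)
        ((Finset.range M).filter fun i => P S i)
      have e2 := hP S hSc
      omega
    simp only [Finset.mem_sdiff, Finset.mem_filter, Finset.mem_range, not_and, not_not] at ha
    obtain ⟨⟨haM, haP⟩, has⟩ := ha
    have has := has haM
    have hd : ∀ i, Disjoint (s i) S := fun i =>
      Finset.disjoint_of_subset_left (h2 i) Finset.sdiff_disjoint
    refine ⟨Function.update s a S, ?_, ?_, ?_, ?_, ?_⟩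
    · intro i hi
      by_cases hia : i = a
      · subst hia
        rw [Function.update_self]
        exact Or.inr ⟨hSc, haP⟩
      · rw [Function.update_of_ne hia]
        exact h1 i hi
    · intro i
      by_cases hia : i = a
      · subst hia
        rwa [Function.update_self]
      · rw [Function.update_of_ne hia]
        exact (h2 i).trans Finset.sdiff_subset
    · intro i hi j hj hij
      by_cases hia : i = a
      · subst hia
        rw [Function.update_self, Function.update_of_ne hij.symm]
        exact (hd j).symm
      · rw [Function.update_of_ne hia]
        by_cases hja : j = a
        · subst hja
          rw [Function.update_self]
          exact hd i
        · rw [Function.update_of_ne hja]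
          exact h3 i hi j hj hij
    · rw [← Finset.sdiff_union_of_subset hSU, ← h4]
      ext x
      simp only [Finset.mem_biUnion, Finset.mem_range, Finset.mem_union]
      constructor
      · rintro ⟨i, hi, hx⟩
        by_cases hia : i = a
        · subst hia
          rw [Function.update_self] at hx
          exact Or.inr hx
        · rw [Function.update_of_ne hia] at hx
          exact Or.inl ⟨i, hi, hx⟩
      · rintro (⟨i, hi, hx⟩ | hx)
        · refine ⟨i, hi, ?_⟩
          have hia : i ≠ a := by
            rintro rfl
            rw [has] at hx
            simp at hx
          rwa [Function.update_of_ne hia]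
        · exact ⟨a, haM, by rwa [Function.update_self]⟩
    · have : ((Finset.range M).filter fun i => Function.update s a S i ≠ ∅) ⊆
          insert a ((Finset.range M).filter fun i => s i ≠ ∅) := by
        intro i hi
        rw [Finset.mem_filter] at hi
        by_cases hia : i = a
        · simp [hia]
        · rw [Function.update_of_ne hia] at hi
          exact Finset.mem_insert_of_mem (Finset.mem_filter.2 hi)
      exact (Finset.card_le_card this).trans ((Finset.card_insert_le _ _).trans (by omega))

/-- The absorbing path. -/
lemma exists_absorbing_path {k l d : ℕ} (hl : 1 ≤ l) (hlk : 2 * l < k) (hld : l < d)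
    (hdk : d ≤ k - 1) {δ : ℝ} (hδ0 : 0 < δ) (hδ : δ ≤ 1) {κ : ℝ} (hκ : 0 < κ) :
    ∃ ξ > (0 : ℝ), ∃ n0 : ℕ, ∀ (V : Type) [Fintype V] [DecidableEq V] (H : Set (Finset V)),
      DegCond d k H δ → n0 ≤ Fintype.card V → ∃ A B X : Finset V, A.card = l ∧ B.card = l ∧
        Disjoint A B ∧ (X.card : ℝ) ≤ κ * Fintype.card V ∧
        ∀ U : Finset V, Disjoint U X → (k - l) ∣ U.card → (U.card : ℝ) ≤ ξ * Fintype.card V →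
          PathOn l H A B (X ∪ U) := by
  classical
  obtain ⟨b, α, β, τ, ρ0, n1, hρ0, hα, hβ, hβτ, hατ, habs⟩ :=
    exists_many_absorbers hl hlk hld hdk hδ0 hδ
  obtain ⟨γ, c0, n2, hγ, hconn⟩ := exists_connector hl hlk hld hdk hδ0 hδ
  set ρ := min ρ0 1 with hρ
  have hρpos : 0 < ρ := lt_min hρ0 one_pos
  set D : ℝ := 4 * (b : ℝ) ^ 2 + b + c0 + 1 with hD
  have hDpos : 0 < D := by positivity
  set ζ := min (min κ γ) ρ / D with hζ
  have hmpos : 0 < min (min κ γ) ρ := lt_min (lt_min hκ hγ) hρpos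
  have hζ0 : 0 < ζ := by positivity
  have hζD : ζ * D = min (min κ γ) ρ := by
    rw [hζ]
    field_simp
  have hζκ : ζ * (b + c0) ≤ κ := by
    have : ζ * (b + c0) ≤ ζ * D := by
      gcongr
      rw [hD]
      have : (0 : ℝ) ≤ (b : ℝ) ^ 2 := by positivity
      linarith
    exact this.trans (hζD.le.trans ((min_le_left _ _).trans (min_le_left _ _)))
  have hζγ : ζ * (b + c0) ≤ γ := by
    have : ζ * (b + c0) ≤ ζ * D := by
      gcongr
      rw [hD]
      have : (0 : ℝ) ≤ (b : ℝ) ^ 2 := by positivity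
      linarith
    exact this.trans (hζD.le.trans ((min_le_left _ _).trans (min_le_right _ _)))
  have hζρ : 4 * (b : ℝ) ^ 2 * ζ ≤ ρ := by
    have : 4 * (b : ℝ) ^ 2 * ζ ≤ ζ * D := by
      rw [hD, mul_comm]
      gcongr
      have h1 : (0 : ℝ) ≤ b := by positivity
      have h2 : (0 : ℝ) ≤ c0 := by positivity
      linarith
    exact this.trans (hζD.le.trans (min_le_right _ _))
  obtain ⟨ξ, hξ, n3, hfam⟩ := exists_absorber_family (k - l) b hρpos (min_le_right _ _) hζ0 hζρ
  refine ⟨ξ, hξ, max (max n1 n2) (max n3 (k + 1)), ?_⟩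
  intro V _ _ H hH hV
  simp only [max_le_iff] at hV
  obtain ⟨⟨hV1, hV2⟩, hV3, hV4⟩ := hV
  set n := Fintype.card V with hn
  have hn0 : (0 : ℝ) < n := by
    have : 0 < n := by omega
    exact_mod_cast this
  have hT : (Finset.powersetCard (k - l) (Finset.univ : Finset V)).Nonempty := by
    rw [Finset.powersetCard_nonempty, Finset.card_univ]
    omega
  obtain ⟨M, ω, hM, h1, h2, h3, h4⟩ := hfam V hV3 _ hT (by
      rw [Finset.card_powersetCard, Finset.card_univ]
      exact_mod_cast Nat.choose_le_pow _ _)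
    (fun S g => Function.Injective g ∧ (∀ i, g i ∉ S) ∧
          LWalk l H (α.image g) (β.image g) (τ.image g).val ∧
          LWalk l H (α.image g) (β.image g) (τ.image g ∪ S).val) (by
      intro S hS
      refine le_trans ?_ (habs V H hH hV1 S (Finset.mem_powersetCard.1 hS).2)
      gcongr
      exact min_le_left _ _)
  set A : ℕ → Finset V := fun i => α.image (ω i) with hAdef
  set B : ℕ → Finset V := fun i => β.image (ω i) with hBdef
  set T : ℕ → Finset V := fun i => τ.image (ω i) with hTdef
  set F : Finset V := (Finset.range M).biUnion fun i => Finset.univ.image (ω i) with hF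
  have hAT : ∀ i < M, ∀ j < M, Disjoint (A i) (T j) := by
    intro i hi j hj
    by_cases hij : i = j
    · subst hij
      exact (Finset.disjoint_image (h1 i hi)).2 hατ
    · rw [Finset.disjoint_left]
      intro x hx hy
      obtain ⟨a, -, rfl⟩ := Finset.mem_image.1 hx
      obtain ⟨c, -, hc⟩ := Finset.mem_image.1 hy
      exact h2 i hi j hj hij a c hc.symm
  have hBT : ∀ i, B i ⊆ T i := fun i => Finset.image_subset_image hβτ
  have hMpos : 0 < M := by
    obtain ⟨S, hS⟩ := hT
    have := h4 S hS
    have h6 := Nat.cast_pos.1 (lt_of_lt_of_le (by positivity) this)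
    rcases Nat.eq_zero_or_pos M with h0 | h0
    · rw [h0, Finset.range_zero] at h6
      exact absurd h6 (by simp)
    · exact h0
  have hFc : F.card ≤ M * b := by
    refine (Finset.card_biUnion_le_card_mul _ _ b fun i _ => ?_).trans (by simp)
    exact Finset.card_image_le.trans (by simp)
  have hFc0 : (F.card : ℝ) + c0 * M ≤ ζ * (b + c0) * n := by
    have : (F.card : ℝ) ≤ M * b := by exact_mod_cast hFc
    have h2 : (M : ℝ) * (b + c0) ≤ ζ * n * (b + c0) := by gcongr
    linarith
  obtain ⟨i0, hi0, i1, hi1, R, hR1, hR2, hR3⟩ := exists_chain (L := γ * n) (c0 := c0)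
    (fun A B F hA hB hAB hF => hconn V H hH hV2 A B F hA hB hAB hF)
    (A := A) (B := B) (F := F) (I := Finset.range M) ⟨0, Finset.mem_range.2 hMpos⟩
    (fun i hi => by
      simp only [A]
      rw [Finset.card_image_of_injective _ (h1 i (Finset.mem_range.1 hi)), hα])
    (fun i hi => by
      simp only [B]
      rw [Finset.card_image_of_injective _ (h1 i (Finset.mem_range.1 hi)), hβ])
    (fun i hi j hj => Finset.disjoint_of_subset_right (hBT j)
      (hAT i (Finset.mem_range.1 hi) j (Finset.mem_range.1 hj)))
    (by
      rw [Finset.card_range]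
      exact hFc0.trans (by gcongr))
  rw [Finset.mem_range] at hi0 hi1
  rw [Finset.card_range] at hR2
  have hsubF : ∀ i < M, A i ∪ T i ⊆ F := by
    intro i hi x hx
    refine Finset.mem_biUnion.2 ⟨i, Finset.mem_range.2 hi, ?_⟩
    simp only [A, T, ← Finset.image_union] at hx
    exact Finset.image_subset_image (Finset.subset_univ _) hx
  have hKd : ∀ i < M, ∀ j < M, i ≠ j → Disjoint (A i ∪ T i) (A j ∪ T j) := by
    intro i hi j hj hij
    rw [Finset.disjoint_left]
    intro x hx hy
    simp only [A, T, ← Finset.image_union] at hx hy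
    obtain ⟨a, -, rfl⟩ := Finset.mem_image.1 hx
    obtain ⟨c, -, hc⟩ := Finset.mem_image.1 hy
    exact h2 i hi j hj hij a c hc.symm
  refine ⟨A i0, B i1, (Finset.range M).biUnion (fun i => A i ∪ T i) ∪ R, ?_, ?_, ?_, ?_, ?_⟩
  · simp only [A]
    rw [Finset.card_image_of_injective _ (h1 i0 hi0), hα]
  · simp only [B]
    rw [Finset.card_image_of_injective _ (h1 i1 hi1), hβ]
  · exact Finset.disjoint_of_subset_right (hBT i1) (hAT i0 hi0 i1 hi1)
  · have e1 : ((Finset.range M).biUnion fun i => A i ∪ T i).card ≤ M * b :=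
      (Finset.card_le_card (Finset.biUnion_subset.2 fun i hi =>
        hsubF i (Finset.mem_range.1 hi))).trans hFc
    have e2 : ((((Finset.range M).biUnion (fun i => A i ∪ T i) ∪ R).card : ℕ) : ℝ) ≤
        M * b + c0 * M := by
      exact_mod_cast (Finset.card_union_le _ _).trans (Nat.add_le_add e1 hR2)
    have h2 : (M : ℝ) * (b + c0) ≤ ζ * n * (b + c0) := by gcongr
    have h3 : ζ * (b + c0) * n ≤ κ * n := by gcongr
    linarith
  · intro U hUX hUd hUc
    obtain ⟨h, hh⟩ := hUd
    obtain ⟨s, hs1, hs2, hs3, hs4, -⟩ := exists_assignment (c := k - l) (M := M)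
      (t := ⌈ξ * n⌉₊) (fun S i => Function.Injective (ω i) ∧ (∀ a, ω i a ∉ S) ∧
          LWalk l H (α.image (ω i)) (β.image (ω i)) (τ.image (ω i)).val ∧
          LWalk l H (α.image (ω i)) (β.image (ω i)) (τ.image (ω i) ∪ S).val)
      (fun S hS => Nat.ceil_le.2 (h4 S (Finset.mem_powersetCard.2 ⟨Finset.subset_univ _, hS⟩)))
      h (by
        have e1 : h ≤ U.card := by
          rw [hh]
          nlinarith [show 1 ≤ k - l by omega]
        have e2 : (h : ℝ) ≤ ξ * n := le_trans (by exact_mod_cast e1) hUc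
        have e3 : (h : ℝ) ≤ ⌈ξ * n⌉₊ := e2.trans (Nat.le_ceil _)
        exact_mod_cast e3) U (by rw [hh, mul_comm])
    have hsX : ∀ i, Disjoint (s i) ((Finset.range M).biUnion (fun i => A i ∪ T i) ∪ R) := fun i =>
      Finset.disjoint_of_subset_left (hs2 i) hUX
    have hsK : ∀ i, ∀ j < M, Disjoint (s i) (A j ∪ T j) := fun i j hj =>
      Finset.disjoint_of_subset_right (fun x hx => Finset.mem_union_left _
        (Finset.mem_biUnion.2 ⟨j, Finset.mem_range.2 hj, hx⟩)) (hsX i)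
    have hsR : ∀ i, Disjoint (s i) R := fun i => (Finset.disjoint_union_right.1 (hsX i)).2
    have := hR3 (fun i => A i ∪ (T i ∪ s i)) ?_ ?_ ?_
    · convert this using 1
      rw [← hs4]
      ext x
      simp only [Finset.mem_union, Finset.mem_biUnion]
      constructor
      · rintro ((⟨i, hi, hx⟩ | hx) | ⟨i, hi, hx⟩)
        · exact Or.inl ⟨i, hi, by tauto⟩
        · exact Or.inr hx
        · exact Or.inl ⟨i, hi, by tauto⟩
      · rintro (⟨i, hi, hx⟩ | hx)
        · rcases hx with hx | hx | hx
          · exact Or.inl (Or.inl ⟨i, hi, by tauto⟩)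
          · exact Or.inl (Or.inl ⟨i, hi, by tauto⟩)
          · exact Or.inr ⟨i, hi, hx⟩
        · exact Or.inl (Or.inr hx)
    · intro i hi
      have hi := Finset.mem_range.1 hi
      have hd : Disjoint (A i) (T i ∪ s i) := Finset.disjoint_union_right.2 ⟨hAT i hi i hi,
        ((Finset.disjoint_union_right.1 (hsK i i hi)).1).symm⟩
      refine ⟨Finset.subset_union_left, ?_, ?_⟩
      · simp only [A]
        rw [Finset.card_image_of_injective _ (h1 i hi), hα]
      · rw [Finset.union_sdiff_cancel_left hd]
        rcases hs1 i hi with h0 | ⟨-, -, -, -, h0⟩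
        · rw [h0, Finset.union_empty]
          obtain ⟨S, -, hS⟩ := h3 i hi
          exact hS.2.2.1
        · exact h0
    · intro i hi j hj hij
      have hi := Finset.mem_range.1 hi
      have hj := Finset.mem_range.1 hj
      rw [← Finset.union_assoc, ← Finset.union_assoc]
      exact Finset.disjoint_union_left.2
        ⟨Finset.disjoint_union_right.2 ⟨hKd i hi j hj hij, (hsK j i hi).symm⟩,
          Finset.disjoint_union_right.2 ⟨hsK i j hj, hs3 i hi j hj hij⟩⟩
    · intro i hi
      have hi := Finset.mem_range.1 hi
      rw [← Finset.union_assoc, Finset.disjoint_union_left]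
      exact ⟨Finset.disjoint_of_subset_left (hsubF i hi) hR1.symm, hsR i⟩

end Chain

section Tiles

variable {W : Type} [Fintype W] [DecidableEq W]

/-- `T` is the vertex set of a balanced blow-up, with parts of size `r`, of a pair of `k`-sets
meeting in `2 * l` elements, all of whose transversals are edges of `H`. -/
def IsTile (k l r : ℕ) (H : Set (Finset W)) (T : Finset W) : Prop :=
  ∃ (m : ℕ) (e₁ e₂ : Finset (Fin m)) (g : Fin m → Fin r → W),
    e₁.card = k ∧ e₂.card = k ∧ (e₁ ∩ e₂).card = 2 * l ∧
    (∀ i ∈ e₁ ∪ e₂, ∀ j ∈ e₁ ∪ e₂, ∀ a b, g i a = g j b → i = j ∧ a = b) ∧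
    (∀ σ : Fin m → Fin r,
      e₁.image (fun i => g i (σ i)) ∈ H ∧ e₂.image (fun i => g i (σ i)) ∈ H) ∧
    T = (e₁ ∪ e₂).biUnion fun i => Finset.univ.image (g i)

/-- `Z` is a disjoint union of tiles. -/
inductive Tileable (k l r : ℕ) (H : Set (Finset W)) : Finset W → Prop
  | empty : Tileable k l r H ∅
  | add {Z T : Finset W} : Tileable k l r H Z → IsTile k l r H T → Disjoint T Z →
      Tileable k l r H (T ∪ Z)

lemma IsTile.tileable {k l r : ℕ} {H : Set (Finset W)} {T : Finset W} (h : IsTile k l r H T) :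
    Tileable k l r H T := by
  have := Tileable.add Tileable.empty h (Finset.disjoint_empty_right T)
  rwa [Finset.union_empty] at this

lemma Tileable.union {k l r : ℕ} {H : Set (Finset W)} {Z Z' : Finset W}
    (h : Tileable k l r H Z) (h' : Tileable k l r H Z') (hd : Disjoint Z Z') :
    Tileable k l r H (Z ∪ Z') := by
  induction h with
  | empty => rwa [Finset.empty_union]
  | add hZ hT hTZ ih =>
    rw [Finset.disjoint_union_left] at hd
    rw [Finset.union_assoc]
    exact (ih hd.2).add hT (Finset.disjoint_union_right.2 ⟨hTZ, hd.1⟩)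

lemma Tileable.biUnion {k l r : ℕ} {H : Set (Finset W)} {ι : Type} [DecidableEq ι]
    (s : Finset ι) (Z : ι → Finset W) (h : ∀ i ∈ s, Tileable k l r H (Z i))
    (hd : ∀ i ∈ s, ∀ j ∈ s, i ≠ j → Disjoint (Z i) (Z j)) :
    Tileable k l r H (s.biUnion Z) := by
  induction s using Finset.induction_on with
  | empty => simpa using Tileable.empty
  | insert a s ha ih =>
    rw [Finset.biUnion_insert]
    refine (h a (Finset.mem_insert_self a s)).union
      (ih (fun i hi => h i (Finset.mem_insert_of_mem hi)) fun i hi j hj hij =>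
        hd i (Finset.mem_insert_of_mem hi) j (Finset.mem_insert_of_mem hj) hij) ?_
    rw [Finset.disjoint_biUnion_right]
    intro i hi
    exact hd a (Finset.mem_insert_self a s) i (Finset.mem_insert_of_mem hi)
      fun h => ha (h ▸ hi)

lemma IsTile.split {k l r p : ℕ} {H : Set (Finset W)} {T : Finset W}
    (h : IsTile k l (p * r) H T) : Tileable k l r H T := by
  classical
  obtain ⟨m, e₁, e₂, g, h1, h2, h3, hg, hH, rfl⟩ := h
  have key : ((e₁ ∪ e₂).biUnion fun i => Finset.univ.image (g i)) =
      (Finset.univ : Finset (Fin p)).biUnion fun c => (e₁ ∪ e₂).biUnion fun i =>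
        Finset.univ.image fun a : Fin r => g i (finProdFinEquiv (c, a)) := by
    ext x
    simp only [Finset.mem_biUnion, Finset.mem_image, Finset.mem_univ, true_and]
    constructor
    · rintro ⟨i, hi, a, rfl⟩
      refine ⟨(finProdFinEquiv.symm a).1, i, hi, (finProdFinEquiv.symm a).2, ?_⟩
      rw [Prod.mk.eta, Equiv.apply_symm_apply]
    · rintro ⟨c, i, hi, a, rfl⟩
      exact ⟨i, hi, _, rfl⟩
  rw [key]
  refine Tileable.biUnion _ _ (fun c _ => IsTile.tileable ?_) ?_
  · refine ⟨m, e₁, e₂, fun i a => g i (finProdFinEquiv (c, a)), h1, h2, h3, ?_,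
      fun σ => hH fun i => finProdFinEquiv (c, σ i), rfl⟩
    intro i hi j hj a b hab
    obtain ⟨h, h'⟩ := hg i hi j hj _ _ hab
    refine ⟨h, ?_⟩
    have := finProdFinEquiv.injective h'
    simpa using this
  · intro c _ c' _ hcc
    rw [Finset.disjoint_left]
    intro x hx hx'
    simp only [Finset.mem_biUnion, Finset.mem_image, Finset.mem_univ, true_and] at hx hx'
    obtain ⟨i, hi, a, rfl⟩ := hx
    obtain ⟨j, hj, b, hb⟩ := hx'
    have := finProdFinEquiv.injective (hg j hj i hi _ _ hb).2
    simp only [Prod.mk.injEq] at this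
    exact hcc this.1.symm

lemma Tileable.split {k l r p : ℕ} {H : Set (Finset W)} {Z : Finset W}
    (h : Tileable k l (p * r) H Z) : Tileable k l r H Z := by
  induction h with
  | empty => exact Tileable.empty
  | add hZ hT hTZ ih => exact hT.split.union ih hTZ

/-- The parts of the tiles of a tiling; shrinking all of them to equal sizes leaves a tiling. -/
lemma Tileable.exists_clusters {k l r : ℕ} (hr : 0 < r) {H : Set (Finset W)} {Z : Finset W}
    (h : Tileable k l r H Z) : ∃ C : Finset (Finset W), (∀ c ∈ C, c.card = r) ∧
      (∀ c ∈ C, ∀ c' ∈ C, c ≠ c' → Disjoint c c') ∧ C.biUnion id = Z ∧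
      ∀ (ρ : ℕ) (S : Finset W → Finset W), (∀ c ∈ C, S c ⊆ c ∧ (S c).card = ρ) →
        Tileable k l ρ H (C.biUnion S) := by
  classical
  induction h with
  | empty => exact ⟨∅, by simp, by simp, by simp, fun ρ S _ => by simpa using Tileable.empty⟩
  | @add Z T hZ hT hTZ ih =>
    obtain ⟨C, hC1, hC2, hC3, hC4⟩ := ih
    obtain ⟨m, e₁, e₂, g, h1, h2, h3, hg, hH, rfl⟩ := hT
    set D : Finset (Finset W) := (e₁ ∪ e₂).image fun i => Finset.univ.image (g i) with hD
    have hDT : D.biUnion id = (e₁ ∪ e₂).biUnion fun i => Finset.univ.image (g i) := by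
      rw [hD, Finset.image_biUnion]
      rfl
    have hDd : ∀ i ∈ e₁ ∪ e₂, ∀ j ∈ e₁ ∪ e₂, i ≠ j →
        Disjoint (Finset.univ.image (g i)) (Finset.univ.image (g j)) := by
      intro i hi j hj hij
      rw [Finset.disjoint_left]
      intro x hx hx'
      obtain ⟨a, -, rfl⟩ := Finset.mem_image.1 hx
      obtain ⟨b, -, hb⟩ := Finset.mem_image.1 hx'
      exact hij (hg j hj i hi _ _ hb).1.symm
    have hDC : ∀ c ∈ D, ∀ c' ∈ C, Disjoint c c' := by
      intro c hc c' hc'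
      refine Finset.disjoint_of_subset_left ?_ (Finset.disjoint_of_subset_right ?_ hTZ)
      · rw [← hDT]
        exact Finset.subset_biUnion_of_mem id hc
      · rw [← hC3]
        exact Finset.subset_biUnion_of_mem id hc'
    refine ⟨D ∪ C, ?_, ?_, ?_, ?_⟩
    · intro c hc
      rcases Finset.mem_union.1 hc with hc | hc
      · obtain ⟨i, hi, rfl⟩ := Finset.mem_image.1 hc
        rw [Finset.card_image_of_injective _ fun a b hab => (hg i hi i hi a b hab).2]
        simp
      · exact hC1 c hc
    · intro c hc c' hc' hcc
      rcases Finset.mem_union.1 hc with hc | hc <;> rcases Finset.mem_union.1 hc' with hc' | hc'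
      · obtain ⟨i, hi, rfl⟩ := Finset.mem_image.1 hc
        obtain ⟨j, hj, rfl⟩ := Finset.mem_image.1 hc'
        exact hDd i hi j hj fun h => hcc (by rw [h])
      · exact hDC c hc c' hc'
      · exact (hDC c' hc' c hc).symm
      · exact hC2 c hc c' hc' hcc
    · rw [Finset.union_biUnion, hDT, hC3]
    · intro ρ S hS
      rw [Finset.union_biUnion]
      refine Tileable.union (IsTile.tileable ?_)
        (hC4 ρ S fun c hc => hS c (Finset.mem_union_right _ hc)) ?_
      · have hS' : ∀ i ∈ e₁ ∪ e₂, S (Finset.univ.image (g i)) ⊆ Finset.univ.image (g i) ∧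
            (S (Finset.univ.image (g i))).card = ρ := fun i hi =>
          hS _ (Finset.mem_union_left _ (Finset.mem_image_of_mem _ hi))
        have hex : ∀ i, ∃ f : Fin ρ → Fin r, i ∈ e₁ ∪ e₂ → Function.Injective f ∧
            Finset.univ.image (fun a => g i (f a)) = S (Finset.univ.image (g i)) := by
          intro i
          by_cases hi : i ∈ e₁ ∪ e₂
          · obtain ⟨hs1, hs2⟩ := hS' i hi
            obtain ⟨e⟩ : Nonempty (Fin ρ ≃ S (Finset.univ.image (g i))) :=
              ⟨(Fintype.equivFinOfCardEq (by simpa using hs2)).symm⟩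
            have : ∀ a : Fin ρ, ∃ b : Fin r, g i b = e a := fun a => by
              simpa using hs1 (e a).2
            choose f hf using this
            refine ⟨f, fun _ => ⟨fun a b hab => ?_, ?_⟩⟩
            · apply e.injective
              apply Subtype.ext
              rw [← hf, ← hf, hab]
            · ext x
              simp only [hf, Finset.mem_image, Finset.mem_univ, true_and]
              constructor
              · rintro ⟨a, rfl⟩
                exact (e a).2
              · intro hx
                exact ⟨e.symm ⟨x, hx⟩, by simp⟩
          · by_cases hρ : ρ = 0
            · subst hρ
              exact ⟨Fin.elim0, fun h => absurd h hi⟩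
            · exact ⟨fun _ => ⟨0, hr⟩, fun h => absurd h hi⟩
        choose f hf using hex
        refine ⟨m, e₁, e₂, fun i a => g i (f i a), h1, h2, h3, ?_,
          fun σ => hH fun i => f i (σ i), ?_⟩
        · intro i hi j hj a b hab
          obtain ⟨h, h'⟩ := hg i hi j hj _ _ hab
          subst h
          exact ⟨rfl, (hf i hi).1 h'⟩
        · rw [hD, Finset.image_biUnion]
          exact Finset.biUnion_congr rfl fun i hi => ((hf i hi).2).symm
      · rw [Finset.disjoint_biUnion_left]
        intro c hc
        rw [Finset.disjoint_biUnion_right]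
        intro c' hc'
        exact Finset.disjoint_of_subset_left (hS c (Finset.mem_union_left _ hc)).1
          (Finset.disjoint_of_subset_right (hS c' (Finset.mem_union_right _ hc')).1
            (hDC c hc c' hc'))

end Tiles

section Perms

variable {α β : Type} [Fintype α] [Fintype β] [DecidableEq α]

lemma exists_perm_comp_eq {b j : β → α} (hb : Function.Injective b) (hj : Function.Injective j) :
    ∃ σ : Equiv.Perm α, ∀ i, σ (b i) = j i := by
  classical
  let e : {x // x ∈ Set.range b} ≃ {x // x ∈ Set.range j} :=
    (Equiv.ofInjective b hb).symm.trans (Equiv.ofInjective j hj)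
  refine ⟨e.extendSubtype, fun i => ?_⟩
  rw [Equiv.extendSubtype_apply_of_mem e (b i) ⟨i, rfl⟩]
  have : (Equiv.ofInjective b hb).symm ⟨b i, ⟨i, rfl⟩⟩ = i := by
    rw [Equiv.symm_apply_eq]
    rfl
  simp only [e, Equiv.trans_apply, this]
  rfl

/-- Averaging over permutations is averaging over injections. -/
lemma cnt_perm_mul {b : β → α} (hb : Function.Injective b) (F : (β → α) → Prop) :
    cnt (fun π : Equiv.Perm α => F fun i => π (b i)) *
        cnt (fun j : β → α => Function.Injective j) =
      Fintype.card (Equiv.Perm α) * cnt (fun j : β → α => Function.Injective j ∧ F j) := by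
  classical
  have h1 := cnt_prod (fun (π : Equiv.Perm α) (j : β → α) =>
    Function.Injective j ∧ F fun i => π (j i))
  have h2 := cnt_prod' (fun (π : Equiv.Perm α) (j : β → α) =>
    Function.Injective j ∧ F fun i => π (j i))
  have h3 : ∀ π : Equiv.Perm α, cnt (fun j : β → α => Function.Injective j ∧ F fun i => π (j i)) =
      cnt (fun j : β → α => Function.Injective j ∧ F j) := by
    intro π
    rw [← cnt_equiv (Equiv.arrowCongr (Equiv.refl β) π)
      (fun j : β → α => Function.Injective j ∧ F j)]
    refine cnt_congr fun j => ?_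
    have : Function.Injective ((Equiv.arrowCongr (Equiv.refl β) π) j) ↔ Function.Injective j :=
      π.injective.of_comp_iff j
    rw [this]
    rfl
  have h4 : ∀ j : β → α, cnt (fun π : Equiv.Perm α => Function.Injective j ∧ F fun i => π (j i)) =
      if Function.Injective j then cnt (fun π : Equiv.Perm α => F fun i => π (b i)) else 0 := by
    intro j
    split_ifs with hj
    · obtain ⟨σ, hσ⟩ := exists_perm_comp_eq hb hj
      rw [← cnt_equiv (Equiv.mulRight σ) (fun π : Equiv.Perm α => F fun i => π (b i))]
      refine cnt_congr fun π => ?_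
      simp [hσ, hj]
    · rw [cnt_eq_sum]
      simp [hj]
  simp_rw [h3] at h1
  simp_rw [h4] at h2
  rw [h1, Finset.sum_const, Finset.card_univ, nsmul_eq_mul] at h2
  rw [h2, cnt_eq_sum (fun j : β → α => Function.Injective j), Finset.mul_sum]
  refine Finset.sum_congr rfl fun j _ => ?_
  split_ifs <;> simp

end Perms

section Sampling

variable {W ι : Type} [Fintype W] [Fintype ι] [DecidableEq ι]

lemma one_sub_exp_neg_ge {a : ℝ} (ha : 0 ≤ a) : a - a ^ 2 / 2 ≤ 1 - Real.exp (-a) := by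
  have h := Real.quadratic_le_exp_of_nonneg ha
  have h1 : Real.exp (-a) * Real.exp a = 1 := by rw [← Real.exp_add]; simp
  have h2 : 0 < Real.exp (-a) := Real.exp_pos _
  have h3 : Real.exp (-a) * (1 + a + a ^ 2 / 2) ≤ 1 := by
    calc _ ≤ Real.exp (-a) * Real.exp a := by gcongr
      _ = 1 := h1
  have h4 : 0 < 1 + a + a ^ 2 / 2 := by positivity
  have h5 : Real.exp (-a) ≤ 1 - a + a ^ 2 / 2 := by
    by_contra hc
    push Not at hc
    have := mul_lt_mul_of_pos_right hc h4
    nlinarith [sq_nonneg (a ^ 2)]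
  linarith

/-- A lower tail bound for the number of injections `j` with `f (z ∘ j)`, for random `z`. -/
lemma cnt_lower_tail (B p : ℕ) (hB : 0 < B) (e : Fin B × Fin p ≃ ι) (f : (Fin p → W) → Prop)
    {μ a : ℝ} (ha : 0 ≤ a) (hμ : 0 ≤ μ) (hμ1 : μ ≤ 1) (hf : μ * (Fintype.card W : ℝ) ^ p ≤ cnt f) :
    cnt (fun z : ι → W => cnt (fun j : Fin p → ι => Function.Injective j ∧ f fun i => z (j i)) <
        (μ - a) * cnt (fun j : Fin p → ι => Function.Injective j)) ≤
      Real.exp (-(B * a ^ 2 / 2)) * (Fintype.card W : ℝ) ^ Fintype.card ι := by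
  classical
  set n : ℝ := (Fintype.card W : ℝ) with hn
  have hn0 : 0 ≤ n := by positivity
  set J := cnt (fun j : Fin p → ι => Function.Injective j) with hJ
  have hBr : (0 : ℝ) < B := by exact_mod_cast hB
  set I : (ι → W) → Fin B → ℝ := fun z c => if f (fun i => z (e (c, i))) then 1 else 0 with hI
  set Y : (ι → W) → ℝ := fun z => ∑ c, I z c with hY
  have hblk : ∀ c : Fin B, Function.Injective fun i : Fin p => e (c, i) := fun c i i' h => by
    have := e.injective h
    simpa using this
  have hJ0 : 0 < J := by
    rw [hJ, cnt, Nat.cast_pos, Nat.card_pos_iff]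
    exact ⟨⟨⟨_, hblk ⟨0, hB⟩⟩⟩, inferInstance⟩
  set P : ℝ := (Fintype.card (Equiv.Perm ι) : ℝ) with hP
  have hP0 : 0 < P := by
    rw [hP]
    exact_mod_cast Fintype.card_pos
  have hsum : ∀ z : ι → W, (∑ π : Equiv.Perm ι, Y fun i => z (π i)) * J =
      B * P * cnt (fun j : Fin p → ι => Function.Injective j ∧ f fun i => z (j i)) := by
    intro z
    have h1 : ∀ c : Fin B, (∑ π : Equiv.Perm ι, I (fun i => z (π i)) c) * J =
        P * cnt (fun j : Fin p → ι => Function.Injective j ∧ f fun i => z (j i)) := by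
      intro c
      rw [← cnt_perm_mul (hblk c) (fun j => f fun i => z (j i)), cnt_eq_sum]
    simp only [hY]
    rw [Finset.sum_comm, Finset.sum_mul, Finset.sum_congr rfl fun c _ => h1 c]
    simp
    ring
  have hblock : ∑ z : ι → W, Real.exp (-a * Y z) ≤
      n ^ Fintype.card ι * Real.exp (-(a - a ^ 2 / 2) * μ) ^ B := by
    have h1 : ∑ y : Fin p → W, Real.exp (-a * if f y then 1 else 0) ≤
        n ^ p * Real.exp (-(a - a ^ 2 / 2) * μ) := by
      have e1 : ∀ y : Fin p → W, Real.exp (-a * if f y then 1 else 0) =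
          1 - (1 - Real.exp (-a)) * if f y then 1 else 0 := by
        intro y
        split_ifs <;> simp
      rw [Finset.sum_congr rfl fun y _ => e1 y, Finset.sum_sub_distrib, ← Finset.mul_sum,
        ← cnt_eq_sum]
      have e2 : ∑ _y : Fin p → W, (1 : ℝ) = n ^ p := by simp [hn]
      rw [e2]
      have e3 : 0 ≤ 1 - Real.exp (-a) := by
        rw [sub_nonneg, Real.exp_le_one_iff]
        linarith
      have e4 : (1 - Real.exp (-a)) * (μ * n ^ p) ≤ (1 - Real.exp (-a)) * cnt f := by gcongr
      have e5 : (a - a ^ 2 / 2) * μ ≤ (1 - Real.exp (-a)) * μ :=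
        mul_le_mul_of_nonneg_right (one_sub_exp_neg_ge ha) hμ
      have e6 := Real.add_one_le_exp (-(a - a ^ 2 / 2) * μ)
      have e7 : n ^ p * (1 - (1 - Real.exp (-a)) * μ) ≤
          n ^ p * Real.exp (-(a - a ^ 2 / 2) * μ) := by
        gcongr
        linarith
      linarith
    have h2 : ∑ z : ι → W, Real.exp (-a * Y z) =
        (∑ y : Fin p → W, Real.exp (-a * if f y then 1 else 0)) ^ B := by
      have : (∑ y : Fin p → W, Real.exp (-a * if f y then 1 else 0)) ^ B =
          ∏ _c : Fin B, ∑ y : Fin p → W, Real.exp (-a * if f y then 1 else 0) := by simp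
      rw [this, Finset.prod_univ_sum, Fintype.piFinset_univ]
      let E : (ι → W) ≃ (Fin B → Fin p → W) :=
        (Equiv.arrowCongr e.symm (Equiv.refl W)).trans (Equiv.curry _ _ _)
      refine Fintype.sum_equiv E _ _ fun z => ?_
      rw [← Real.exp_sum, ← Finset.mul_sum]
      rfl
    rw [h2]
    refine (pow_le_pow_left₀ (Finset.sum_nonneg fun y _ => (Real.exp_pos _).le) h1 B).trans ?_
    rw [mul_pow, ← pow_mul, ← Fintype.card_congr e]
    simp [mul_comm]
  have hbad : ∀ z : ι → W,
      (if cnt (fun j : Fin p → ι => Function.Injective j ∧ f fun i => z (j i)) < (μ - a) * J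
        then (1 : ℝ) else 0) * (P * Real.exp (-a * (B * (μ - a)))) ≤
      ∑ π : Equiv.Perm ι, Real.exp (-a * Y fun i => z (π i)) := by
    intro z
    split_ifs with hz
    · rw [one_mul]
      have hlt : ∑ π : Equiv.Perm ι, Y (fun i => z (π i)) ≤ P * (B * (μ - a)) := by
        have := hsum z
        have h3 : B * P * cnt (fun j : Fin p → ι => Function.Injective j ∧ f fun i => z (j i)) ≤
            B * P * ((μ - a) * J) := by gcongr
        rw [← this] at h3
        refine le_of_mul_le_mul_right (h3.trans_eq ?_) hJ0
        ring
      have h4 : ∀ π : Equiv.Perm ι, Real.exp (-a * (B * (μ - a))) *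
          (1 + (-a * Y (fun i => z (π i)) + a * (B * (μ - a)))) ≤
          Real.exp (-a * Y fun i => z (π i)) := by
        intro π
        have h5 := Real.add_one_le_exp (-a * Y (fun i => z (π i)) + a * (B * (μ - a)))
        calc _ ≤ Real.exp (-a * (B * (μ - a))) *
              Real.exp (-a * Y (fun i => z (π i)) + a * (B * (μ - a))) := by
              gcongr
              linarith
          _ = _ := by
              rw [← Real.exp_add]
              congr 1
              ring
      refine le_trans ?_ (Finset.sum_le_sum fun π _ => h4 π)
      rw [← Finset.mul_sum, Finset.sum_add_distrib, Finset.sum_add_distrib, ← Finset.mul_sum]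
      simp only [Finset.sum_const, Finset.card_univ, nsmul_eq_mul, mul_one]
      rw [← hP, mul_comm]
      gcongr
      nlinarith
    · rw [zero_mul]
      exact Finset.sum_nonneg fun π _ => (Real.exp_pos _).le
  have htot := Finset.sum_le_sum fun (z : ι → W) (_ : z ∈ Finset.univ) => hbad z
  rw [← Finset.sum_mul, ← cnt_eq_sum, Finset.sum_comm] at htot
  have hre : ∀ π : Equiv.Perm ι, ∑ z : ι → W, Real.exp (-a * Y fun i => z (π i)) =
      ∑ z : ι → W, Real.exp (-a * Y z) := fun π =>
    Fintype.sum_equiv (Equiv.arrowCongr π.symm (Equiv.refl W)) _ _ fun z => rfl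
  rw [Finset.sum_congr rfl fun π _ => hre π, Finset.sum_const, Finset.card_univ,
    nsmul_eq_mul, ← hP] at htot
  have hfin : cnt (fun z : ι → W =>
      cnt (fun j : Fin p → ι => Function.Injective j ∧ f fun i => z (j i)) < (μ - a) * J) *
        Real.exp (-a * (B * (μ - a))) ≤
      n ^ Fintype.card ι * Real.exp (-(a - a ^ 2 / 2) * μ) ^ B := by
    refine le_trans ?_ hblock
    refine le_of_mul_le_mul_left ?_ hP0
    linarith
  have hpos := Real.exp_pos (-a * (B * (μ - a)))
  refine le_of_mul_le_mul_right (hfin.trans ?_) hpos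
  rw [← Real.exp_nat_mul, mul_comm (n ^ _), mul_right_comm, ← Real.exp_add]
  refine mul_le_mul_of_nonneg_right (Real.exp_le_exp.2 ?_) (by positivity)
  have : 0 ≤ B * a ^ 2 * (1 - μ) := mul_nonneg (by positivity) (by linarith)
  nlinarith

end Sampling

section Degrees

lemma cnt_le_of_injective {X Y : Type} [Fintype X] [Fintype Y] {P : X → Prop} {Q : Y → Prop}
    (f : X → Y) (hf : Function.Injective f) (h : ∀ x, P x → Q (f x)) : cnt P ≤ cnt Q := by
  unfold cnt
  have : Function.Injective (fun x : {x // P x} => (⟨f x.1, h x.1 x.2⟩ : {y // Q y})) := by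
    intro x y hxy
    exact Subtype.ext (hf (congrArg Subtype.val hxy))
  exact_mod_cast Nat.card_le_card_of_injective _ this

/-- Counting sets through their enumerations. -/
lemma cnt_tuple {α : Type} [Fintype α] [DecidableEq α] (p : ℕ) (Q : Finset α → Prop) :
    cnt (fun j : Fin p → α => Function.Injective j ∧ Q (Finset.univ.image j)) =
      p.factorial * cnt (fun T : Finset α => T.card = p ∧ Q T) := by
  classical
  have h1 := cnt_prod' (fun (j : Fin p → α) (T : Finset α) =>
    (Function.Injective j ∧ Q (Finset.univ.image j)) ∧ Finset.univ.image j = T)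
  have h2 := cnt_prod (fun (j : Fin p → α) (T : Finset α) =>
    (Function.Injective j ∧ Q (Finset.univ.image j)) ∧ Finset.univ.image j = T)
  rw [h1] at h2
  have h3 : ∀ j : Fin p → α, cnt (fun T : Finset α =>
      (Function.Injective j ∧ Q (Finset.univ.image j)) ∧ Finset.univ.image j = T) =
      if Function.Injective j ∧ Q (Finset.univ.image j) then 1 else 0 := by
    intro j
    rw [cnt_eq_sum]
    by_cases hj : Function.Injective j ∧ Q (Finset.univ.image j)
    · simp only [hj, true_and, and_self, if_true]
      rw [Finset.sum_ite_eq]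
      simp
    · simp [hj]
  have h4 : ∀ T : Finset α, cnt (fun j : Fin p → α =>
      (Function.Injective j ∧ Q (Finset.univ.image j)) ∧ Finset.univ.image j = T) =
      p.factorial * if T.card = p ∧ Q T then 1 else 0 := by
    intro T
    split_ifs with hT
    · rw [mul_one, cnt]
      let E : {j : Fin p → α // (Function.Injective j ∧ Q (Finset.univ.image j)) ∧
          Finset.univ.image j = T} ≃ (Fin p ↪ T) :=
        { toFun := fun j => ⟨fun i => ⟨j.1 i, by
              have h := j.2.2
              have h' := Finset.mem_image_of_mem j.1 (Finset.mem_univ i)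
              rwa [h] at h'⟩, fun i i' h => j.2.1.1 (congrArg Subtype.val h)⟩
          invFun := fun f => ⟨fun i => (f i).1, by
            have hinj : Function.Injective fun i => (f i).1 :=
              Subtype.val_injective.comp f.injective
            have him : Finset.univ.image (fun i => (f i).1) = T := by
              refine Finset.eq_of_subset_of_card_le ?_ ?_
              · intro x hx
                obtain ⟨i, -, rfl⟩ := Finset.mem_image.1 hx
                exact (f i).2
              · rw [Finset.card_image_of_injective _ hinj, hT.1]
                simp
            exact ⟨⟨hinj, by rw [him]; exact hT.2⟩, him⟩⟩
          left_inv := fun j => rfl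
          right_inv := fun f => rfl }
      rw [Nat.card_congr E, Nat.card_eq_fintype_card, Fintype.card_embedding_eq]
      simp [hT.1, Nat.descFactorial_self]
    · rw [mul_zero, cnt_eq_sum]
      refine Finset.sum_eq_zero fun j _ => if_neg ?_
      rintro ⟨⟨hj, hQ⟩, rfl⟩
      refine hT ⟨?_, hQ⟩
      rw [Finset.card_image_of_injective _ hj]
      simp
  simp_rw [h3, h4] at h2
  rw [cnt_eq_sum, ← h2, ← Finset.mul_sum, cnt_eq_sum]

lemma cnt_injective (α : Type) [Fintype α] (p : ℕ) :
    cnt (fun j : Fin p → α => Function.Injective j) =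
      p.factorial * ((Fintype.card α).choose p : ℝ) := by
  classical
  rw [cnt, Nat.card_congr (Equiv.subtypeInjectiveEquivEmbedding (Fin p) α),
    Nat.card_eq_fintype_card, Fintype.card_embedding_eq, Fintype.card_fin,
    Nat.descFactorial_eq_factorial_mul_choose]
  push_cast
  rfl

lemma hDeg_le {n k : ℕ} (H : Finset (Finset (Fin n))) (S : Finset (Fin n)) :
    hDeg n k H S ≤ n.choose (k - S.card) := by
  classical
  unfold hDeg
  rw [Nat.card_eq_fintype_card, Fintype.card_subtype]
  calc _ ≤ (Finset.powersetCard (k - S.card) (Finset.univ : Finset (Fin n))).card := by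
        refine Finset.card_le_card fun T hT => ?_
        rw [Finset.mem_powersetCard]
        exact ⟨Finset.subset_univ _, (Finset.mem_filter.1 hT).2.1⟩
    _ = _ := by rw [Finset.card_powersetCard, Finset.card_univ, Fintype.card_fin]

lemma minDeg_le {n k d : ℕ} (H : Finset (Finset (Fin n))) {S : Finset (Fin n)}
    (hS : S.card = d) : minDeg n k d H ≤ hDeg n k H S :=
  Nat.sInf_le ⟨S, hS, rfl⟩

lemma le_minDeg {n k d : ℕ} (hd : d ≤ n) (H : Finset (Finset (Fin n))) {t : ℕ}
    (h : ∀ S : Finset (Fin n), S.card = d → t ≤ hDeg n k H S) : t ≤ minDeg n k d H := by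
  obtain ⟨S, -, hS⟩ := Finset.exists_subset_card_eq
    (show d ≤ (Finset.univ : Finset (Fin n)).card by simpa using hd)
  obtain ⟨S', hS', h'⟩ := Nat.sInf_mem
    (⟨_, S, hS, rfl⟩ : { m : ℕ | ∃ S : Finset (Fin n), S.card = d ∧ hDeg n k H S = m }.Nonempty)
  exact (h S' hS').trans h'.le

lemma minDeg_le_choose {n k d : ℕ} (H : Finset (Finset (Fin n))) :
    minDeg n k d H ≤ n.choose (k - d) := by
  by_cases hd : d ≤ n
  · obtain ⟨S, -, hS⟩ := Finset.exists_subset_card_eq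
      (show d ≤ (Finset.univ : Finset (Fin n)).card by simpa using hd)
    have := (minDeg_le H hS).trans (hDeg_le (k := k) H S)
    rwa [hS] at this
  · have : { m : ℕ | ∃ S : Finset (Fin n), S.card = d ∧ hDeg n k H S = m } = ∅ := by
      ext m
      simp only [Set.mem_ofPred_eq, Set.mem_empty_iff_false, iff_false]
      rintro ⟨S, hS, -⟩
      have := Finset.card_le_univ S
      simp at this
      omega
    rw [minDeg, this, Nat.sInf_empty]
    exact Nat.zero_le _

lemma tThreshold_spec {k d l n : ℕ} {ε : ℝ} {H : Finset (Finset (Fin n))}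
    (hH : IsKGraph n k H) (h : tThreshold k d l n ε ≤ minDeg n k d H) :
    HasYTilingCover n l H (ε * n) := by
  have hne : { t : ℕ | ∀ H : Finset (Finset (Fin n)), IsKGraph n k H →
      t ≤ minDeg n k d H → HasYTilingCover n l H (ε * n) }.Nonempty :=
    ⟨n.choose (k - d) + 1, fun H _ h => by
      have := minDeg_le_choose (k := k) (d := d) H
      omega⟩
  exact Nat.sInf_mem hne H hH h

lemma tThreshold_le (k d l n : ℕ) (ε : ℝ) : tThreshold k d l n ε ≤ n.choose (k - d) + 1 :=
  Nat.sInf_le fun H _ h => by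
    have := minDeg_le_choose (k := k) (d := d) H
    omega

lemma ratio_le_two {k d n x : ℕ} (hn : k ≤ n) (h : x ≤ n.choose (k - d) + 1) :
    (x : ℝ) / (n.choose (k - d) : ℝ) ≤ 2 := by
  have h1 : 0 < n.choose (k - d) := Nat.choose_pos (by omega)
  have h2 : (0 : ℝ) < n.choose (k - d) := by exact_mod_cast h1
  rw [div_le_iff₀ h2]
  have : x ≤ 2 * n.choose (k - d) := by omega
  exact_mod_cast this

open Filter in
lemma exists_eventually_tThreshold {k d l : ℕ} {μ ε0 : ℝ} (hμ : tVal k d l < μ) (hε0 : 0 < ε0) :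
    ∃ ε : ℝ, 0 < ε ∧ ε ≤ ε0 ∧ ∀ᶠ m : ℕ in atTop,
      (tThreshold k d l m ε : ℝ) / (m.choose (k - d) : ℝ) < μ := by
  have hb : ∀ ε : ℝ, ∀ᶠ n : ℕ in atTop,
      (tThreshold k d l n ε : ℝ) / (n.choose (k - d) : ℝ) ≤ 2 := fun ε => by
    filter_upwards [eventually_ge_atTop k] with n hn
    exact ratio_le_two hn (tThreshold_le k d l n ε)
  have hc : ∀ ε : ℝ, IsCoboundedUnder (· ≤ ·) atTop fun n : ℕ =>
      (tThreshold k d l n ε : ℝ) / (n.choose (k - d) : ℝ) := fun ε => by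
    refine IsCoboundedUnder.of_frequently_ge (a := 0) ?_
    exact (Eventually.of_forall fun n => by positivity).frequently
  have hout : ∀ ε : ℝ, limsup (fun n : ℕ =>
      (tThreshold k d l n ε : ℝ) / (n.choose (k - d) : ℝ)) atTop ≤ 2 := fun ε =>
    limsup_le_of_le (hc ε) (hb ε)
  have h1 := eventually_lt_of_limsup_lt hμ ⟨2, by
    rw [eventually_map]
    exact Eventually.of_forall hout⟩
  have h2 : ∀ᶠ ε : ℝ in nhdsWithin (0 : ℝ) (Set.Ioi (0 : ℝ)), ε ∈ Set.Ioc 0 ε0 :=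
    Ioc_mem_nhdsGT hε0
  obtain ⟨ε, hε, hε1, hε2⟩ := (h1.and h2).exists
  exact ⟨ε, hε1, hε2, eventually_lt_of_limsup_lt hε ⟨2, by
    rw [eventually_map]
    exact hb ε⟩⟩

open Filter in
lemma tendsto_choose_ratio (d p : ℕ) : Tendsto
    (fun m : ℕ => ((m - d).choose p : ℝ) / (m.choose p : ℝ)) atTop (nhds 1) := by
  have h1 : Tendsto (fun m : ℕ => ((m : ℝ) ^ p) / (m + d : ℕ) ^ p) atTop (nhds 1) := by
    have : Tendsto (fun m : ℕ => (m : ℝ) / (m + d : ℝ)) atTop (nhds 1) :=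
      tendsto_natCast_div_add_atTop (d : ℝ)
    have := this.pow p
    rw [one_pow] at this
    refine this.congr fun m => ?_
    rw [div_pow]
    push_cast
    rfl
  have h2 := isEquivalent_choose p
  have h3 : Tendsto (fun m : ℕ => (m.choose p : ℝ) / ((m + d).choose p : ℝ)) atTop (nhds 1) := by
    have h4 := h2.comp_tendsto (tendsto_add_atTop_nat d)
    have h5 := h2.div h4
    refine (h5.symm.tendsto_nhds ?_)
    refine h1.congr fun m => ?_
    simp only [Pi.div_apply, Function.comp]
    rw [div_div_div_cancel_right₀ (by positivity)]
  rw [← tendsto_add_atTop_iff_nat d]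
  refine h3.congr fun m => ?_
  rw [Nat.add_sub_cancel]

end Degrees

section Pattern

variable {W : Type} [Fintype W] [DecidableEq W]

open Classical in
/-- The `k`-graph induced by `H` on the indices of a tuple of vertices. -/
noncomputable def pat {m : ℕ} (k : ℕ) (H : Set (Finset W)) (x : Fin m → W) :
    Finset (Finset (Fin m)) :=
  Finset.univ.filter fun e => e.card = k ∧ e.image x ∈ H

lemma mem_pat {m k : ℕ} {H : Set (Finset W)} {x : Fin m → W} {e : Finset (Fin m)} :
    e ∈ pat k H x ↔ e.card = k ∧ e.image x ∈ H := by
  classical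
  simp [pat]

lemma le_hDeg_pat {m k d : ℕ} {H : Set (Finset W)} {x : Fin m → W}
    {D : Finset (Fin m)} (hD : D.card = d) (hdk : d ≤ k) :
    cnt (fun j : Fin (k - d) → {i // i ∉ D} => Function.Injective j ∧
      D.image x ∪ Finset.univ.image (fun i => x (j i)) ∈ H) ≤
      (k - d).factorial * (hDeg m k (pat k H x) D : ℝ) := by
  classical
  have h1 := cnt_tuple (α := Fin m) (k - d) (fun T => Disjoint D T ∧ D ∪ T ∈ pat k H x)
  have h2 : (hDeg m k (pat k H x) D : ℝ) = cnt (fun T : Finset (Fin m) => T.card = k - d ∧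
      (Disjoint D T ∧ D ∪ T ∈ pat k H x)) := by
    rw [hDeg, cnt, hD]
  rw [h2, ← h1]
  refine cnt_le_of_injective (fun j i => (j i).1) (fun j j' h => ?_) fun j hj => ?_
  · funext i
    exact Subtype.ext (congrFun h i)
  · have hinj : Function.Injective fun i => (j i).1 := Subtype.val_injective.comp hj.1
    have hdis : Disjoint D (Finset.univ.image fun i => (j i).1) := by
      rw [Finset.disjoint_right]
      intro a ha
      obtain ⟨i, -, rfl⟩ := Finset.mem_image.1 ha
      exact (j i).2
    refine ⟨hinj, hdis, mem_pat.2 ⟨?_, ?_⟩⟩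
    · rw [Finset.card_union_of_disjoint hdis, Finset.card_image_of_injective _ hinj, hD]
      simp
      omega
    · rw [Finset.image_union, Finset.image_image]
      exact hj.2

/-- For a random tuple of vertices, a given `d`-set of indices rarely has small degree. -/
lemma cnt_small_degree {m k d B : ℕ} (hB : 0 < B) (hm : m = d + B * (k - d))
    {H : Set (Finset W)} {μ a : ℝ} (ha : 0 ≤ a) (hμ : 0 ≤ μ) (hμ1 : μ ≤ 1)
    (hH : DegCond d k H μ) {D : Finset (Fin m)} (hD : D.card = d) :
    cnt (fun x : Fin m → W => Function.Injective x ∧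
      cnt (fun j : Fin (k - d) → {i // i ∉ D} => Function.Injective j ∧
        D.image x ∪ Finset.univ.image (fun i => x (j i)) ∈ H) <
      (μ - a) * cnt (fun j : Fin (k - d) → {i // i ∉ D} => Function.Injective j)) ≤
    Real.exp (-(B * a ^ 2 / 2)) * (Fintype.card W : ℝ) ^ m := by
  classical
  have hcard : Fintype.card {i // i ∉ D} = B * (k - d) := by
    rw [Fintype.card_subtype_compl]
    simp [hD, hm]
  obtain ⟨e⟩ : Nonempty (Fin B × Fin (k - d) ≃ {i // i ∉ D}) := by
    refine ⟨Fintype.equivOfCardEq ?_⟩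
    rw [hcard]
    simp
  let E := Equiv.piEquivPiSubtypeProd (fun i : Fin m => i ∈ D) (fun _ => W)
  let Q : ({i // i ∈ D} → W) → ({i // i ∉ D} → W) → Prop := fun y z =>
    (Finset.univ.image y).card = d ∧
      cnt (fun j : Fin (k - d) → {i // i ∉ D} => Function.Injective j ∧
        Finset.univ.image y ∪ Finset.univ.image (fun i => z (j i)) ∈ H) <
      (μ - a) * cnt (fun j : Fin (k - d) → {i // i ∉ D} => Function.Injective j)
  refine le_trans (cnt_mono (Q := fun x => Q (E x).1 (E x).2) ?_) ?_
  · rintro x ⟨hx, hx'⟩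
    have himg : Finset.univ.image (fun i : {i // i ∈ D} => x i.1) = D.image x := by
      ext w
      simp
    refine ⟨?_, ?_⟩
    · show (Finset.univ.image (fun i : {i // i ∈ D} => x i.1)).card = d
      rw [himg, Finset.card_image_of_injective _ hx, hD]
    · show cnt (fun j : Fin (k - d) → {i // i ∉ D} => Function.Injective j ∧
        Finset.univ.image (fun i : {i // i ∈ D} => x i.1) ∪
          Finset.univ.image (fun i => x (j i).1) ∈ H) < _
      rw [himg]
      exact hx'
  · rw [cnt_equiv E (fun z => Q z.1 z.2), cnt_prod Q]
    have h1 : ∀ y, cnt (Q y) ≤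
        Real.exp (-(B * a ^ 2 / 2)) * (Fintype.card W : ℝ) ^ Fintype.card {i // i ∉ D} := by
      intro y
      by_cases hy : (Finset.univ.image y).card = d
      · refine le_trans (cnt_mono fun z hz => hz.2) ?_
        exact cnt_lower_tail B (k - d) hB e
          (fun t => Finset.univ.image y ∪ Finset.univ.image t ∈ H) ha hμ hμ1 (hH.2 _ hy)
      · rw [cnt_eq_sum, Finset.sum_eq_zero fun z _ => if_neg fun h => hy h.1]
        positivity
    refine (Finset.sum_le_sum fun y _ => h1 y).trans_eq ?_
    rw [Finset.sum_const, Finset.card_univ, nsmul_eq_mul, hcard]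
    have : Fintype.card ({i // i ∈ D} → W) = Fintype.card W ^ d := by
      simp [hD]
    rw [this, hm, pow_add]
    push_cast
    ring

lemma cnt_not_injective_mul (m : ℕ) :
    cnt (fun x : Fin m → W => ¬ Function.Injective x) * Fintype.card W ≤
      (m : ℝ) ^ 2 * (Fintype.card W : ℝ) ^ m := by
  classical
  have h1 : cnt (fun x : Fin m → W => ¬ Function.Injective x) ≤
      cnt (fun x : Fin m → W => ∃ z : Fin m × Fin m, z.1 ≠ z.2 ∧ x z.1 = x z.2) := by
    refine cnt_mono fun x hx => ?_
    simp only [Function.Injective, not_forall] at hx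
    obtain ⟨i, j, h, hij⟩ := hx
    exact ⟨(i, j), hij, h⟩
  have h2 := cnt_exists_le (fun (z : Fin m × Fin m) (x : Fin m → W) =>
    z.1 ≠ z.2 ∧ x z.1 = x z.2)
  have h3 : ∀ z : Fin m × Fin m, cnt (fun x : Fin m → W => z.1 ≠ z.2 ∧ x z.1 = x z.2) *
      Fintype.card W ≤ (Fintype.card W : ℝ) ^ m := by
    intro z
    by_cases hz : z.1 = z.2
    · rw [cnt_eq_sum, Finset.sum_eq_zero fun x _ => if_neg fun h => h.1 hz, zero_mul]
      positivity
    · have := cnt_eq_coord_mul_le (V := W) hz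
      rw [Fintype.card_fin] at this
      refine le_trans ?_ this
      gcongr
      exact cnt_mono fun x hx => hx.2
  calc _ ≤ (∑ z : Fin m × Fin m, cnt (fun x : Fin m → W => z.1 ≠ z.2 ∧ x z.1 = x z.2)) *
        Fintype.card W := by
        gcongr
        exact h1.trans h2
    _ ≤ ∑ _z : Fin m × Fin m, (Fintype.card W : ℝ) ^ m := by
        rw [Finset.sum_mul]
        exact Finset.sum_le_sum fun z _ => h3 z
    _ = _ := by
        rw [Finset.sum_const, Finset.card_univ, Fintype.card_prod, Fintype.card_fin, nsmul_eq_mul]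
        push_cast
        ring

end Pattern

open Filter in
/-- Random tuples induce `k`-graphs with almost perfect tilings. -/
lemma exists_sampling {k l d : ℕ} (hdk : d < k) {μ ε0 ε2 : ℝ} (hμ : tVal k d l < μ)
    (hμ0 : 0 ≤ μ) (hε0 : 0 < ε0) (hε2 : 0 < ε2) :
    ∃ m : ℕ, 0 < m ∧ ∃ n0 : ℕ, ∀ (W : Type) [Fintype W] [DecidableEq W] (H : Set (Finset W)),
      DegCond d k H μ → n0 ≤ Fintype.card W →
      cnt (fun x : Fin m → W => ¬ (Function.Injective x ∧
        HasYTilingCover m l (pat k H x) (ε0 * m))) ≤ ε2 * (Fintype.card W : ℝ) ^ m := by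
  classical
  obtain ⟨μ', hμ'1, hμ'2⟩ := exists_between hμ
  obtain ⟨ε, hε, hεε, hev⟩ := exists_eventually_tThreshold hμ'1 hε0
  set a : ℝ := (μ - μ') / 2 with ha
  have ha0 : 0 < a := by linarith
  set p := k - d with hp
  have hp0 : 0 < p := by omega
  have hratio := tendsto_choose_ratio d p
  have hratio' : ∀ᶠ m : ℕ in atTop,
      μ' < (μ - a) * (((m - d).choose p : ℝ) / (m.choose p : ℝ)) := by
    have h1 := hratio.const_mul (μ - a)
    rw [mul_one] at h1
    exact h1.eventually_const_lt (by linarith)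
  have hmB : Tendsto (fun B : ℕ => d + B * p) atTop atTop := by
    refine tendsto_atTop_mono (fun B => ?_) tendsto_id
    show B ≤ d + B * p
    nlinarith
  have hexp : Tendsto (fun B : ℕ => ((d + p : ℕ) : ℝ) ^ d *
      ((B : ℝ) ^ d * Real.exp (-(a ^ 2 / 2)) ^ B)) atTop (nhds 0) := by
    have := (tendsto_pow_const_mul_const_pow_of_abs_lt_one d
      (r := Real.exp (-(a ^ 2 / 2))) (by
        rw [abs_of_pos (Real.exp_pos _), Real.exp_lt_one_iff]
        have : 0 < a ^ 2 := by positivity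
        linarith)).const_mul (((d + p : ℕ) : ℝ) ^ d)
    rwa [mul_zero] at this
  have hexp' := hexp.eventually_lt_const (half_pos hε2)
  obtain ⟨B, ⟨⟨hB1, hB2⟩, hB3⟩, hB4⟩ := (((hmB.eventually hev).and (hmB.eventually hratio')).and
    hexp').and (eventually_gt_atTop (0 : ℕ)) |>.exists
  obtain ⟨m, hm⟩ : ∃ m, m = d + B * p := ⟨_, rfl⟩
  rw [← hm] at hB1 hB2
  have hmp : p ≤ m := by
    rw [hm]
    nlinarith
  have hch : (0 : ℝ) < m.choose p := by exact_mod_cast Nat.choose_pos hmp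
  have hthr : (tThreshold k d l m ε : ℝ) ≤ (μ - a) * ((m - d).choose p : ℝ) := by
    rw [div_lt_iff₀ hch] at hB1
    rw [← mul_div_assoc, lt_div_iff₀ hch] at hB2
    exact (hB1.trans hB2).le
  obtain ⟨n1, hn1⟩ := exists_nat_ge (2 * (m : ℝ) ^ 2 / ε2)
  refine ⟨m, by omega, max n1 (d + 1), ?_⟩
  intro W _ _ H hH hW
  have hWn1 : n1 ≤ Fintype.card W := (le_max_left _ _).trans hW
  have hWd : d + 1 ≤ Fintype.card W := (le_max_right _ _).trans hW
  have hW0 : (0 : ℝ) < Fintype.card W := by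
    have : 0 < Fintype.card W := by omega
    exact_mod_cast this
  have hμ1 : μ ≤ 1 := by
    obtain ⟨S, -, hS⟩ := Finset.exists_subset_card_eq
      (show d ≤ (Finset.univ : Finset W).card by rw [Finset.card_univ]; omega)
    have h1 := (hH.2 S hS).trans (cnt_le_card _)
    rw [Fintype.card_fun, Fintype.card_fin] at h1
    push_cast at h1
    have h2 : (0 : ℝ) < (Fintype.card W : ℝ) ^ (k - d) := by positivity
    nlinarith
  have hsub : ∀ x : Fin m → W, ¬ (Function.Injective x ∧
        HasYTilingCover m l (pat k H x) (ε0 * m)) → (¬ Function.Injective x) ∨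
      ∃ D : {D : Finset (Fin m) // D.card = d}, Function.Injective x ∧
        cnt (fun j : Fin (k - d) → {i // i ∉ D.1} => Function.Injective j ∧
          D.1.image x ∪ Finset.univ.image (fun i => x (j i)) ∈ H) <
        (μ - a) * cnt (fun j : Fin (k - d) → {i // i ∉ D.1} => Function.Injective j) := by
    intro x hx
    by_contra hcon
    push Not at hcon
    obtain ⟨hinj, hdeg⟩ := hcon
    refine hx ⟨hinj, ?_⟩
    have hkg : IsKGraph m k (pat k H x) := fun e he => (mem_pat.1 he).1
    have hmin : tThreshold k d l m ε ≤ minDeg m k d (pat k H x) := by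
      refine le_minDeg (by omega) _ fun D hD => ?_
      have h1 := (hdeg ⟨D, hD⟩ hinj).trans (le_hDeg_pat hD hdk.le)
      rw [cnt_injective, Fintype.card_subtype_compl] at h1
      simp only [Fintype.card_fin, Fintype.card_coe, hD] at h1
      have h2 : (0 : ℝ) < (k - d).factorial := by exact_mod_cast Nat.factorial_pos _
      have h3 : (μ - a) * ((m - d).choose p : ℝ) ≤ hDeg m k (pat k H x) D := by
        refine le_of_mul_le_mul_left (le_trans (le_of_eq ?_) h1) h2
        ring
      exact_mod_cast hthr.trans h3
    obtain ⟨M, e1, e2, h1, h2, h3⟩ := tThreshold_spec hkg hmin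
    refine ⟨M, e1, e2, h1, h2, h3.trans ?_⟩
    gcongr
  refine (cnt_mono hsub).trans ((cnt_or_le _ _).trans ?_)
  have hA : cnt (fun x : Fin m → W => ¬ Function.Injective x) ≤
      ε2 / 2 * (Fintype.card W : ℝ) ^ m := by
    have h1 := cnt_not_injective_mul (W := W) m
    have h2 : 2 * (m : ℝ) ^ 2 / ε2 ≤ Fintype.card W := hn1.trans (by exact_mod_cast hWn1)
    rw [div_le_iff₀ hε2] at h2
    refine le_of_mul_le_mul_right (h1.trans ?_) hW0
    have h3 : (m : ℝ) ^ 2 ≤ ε2 / 2 * Fintype.card W := by linarith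
    calc _ ≤ (ε2 / 2 * Fintype.card W) * (Fintype.card W : ℝ) ^ m := by gcongr
      _ = _ := by ring
  have hBd : cnt (fun x : Fin m → W => ∃ D : {D : Finset (Fin m) // D.card = d},
      Function.Injective x ∧
        cnt (fun j : Fin (k - d) → {i // i ∉ D.1} => Function.Injective j ∧
          D.1.image x ∪ Finset.univ.image (fun i => x (j i)) ∈ H) <
        (μ - a) * cnt (fun j : Fin (k - d) → {i // i ∉ D.1} => Function.Injective j)) ≤
      ε2 / 2 * (Fintype.card W : ℝ) ^ m := by
    refine (cnt_exists_le _).trans ?_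
    refine (Finset.sum_le_sum fun D _ =>
      cnt_small_degree hB4 hm ha0.le hμ0 hμ1 hH D.2).trans ?_
    rw [Finset.sum_const, nsmul_eq_mul, Finset.card_univ, ← mul_assoc]
    gcongr
    have h1 : (Fintype.card {D : Finset (Fin m) // D.card = d} : ℝ) ≤
        ((d + p : ℕ) : ℝ) ^ d * (B : ℝ) ^ d := by
      rw [← mul_pow]
      have h2 : Fintype.card {D : Finset (Fin m) // D.card = d} ≤ ((d + p) * B) ^ d := by
        rw [Fintype.card_finset_len, Fintype.card_fin]
        refine (Nat.choose_le_pow _ _).trans (Nat.pow_le_pow_left ?_ d)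
        rw [hm]
        nlinarith
      exact_mod_cast h2
    have h3 : Real.exp (-(B * a ^ 2 / 2)) = Real.exp (-(a ^ 2 / 2)) ^ B := by
      rw [← Real.exp_nat_mul]
      congr 1
      ring
    rw [h3]
    calc _ ≤ ((d + p : ℕ) : ℝ) ^ d * (B : ℝ) ^ d * Real.exp (-(a ^ 2 / 2)) ^ B := by gcongr
      _ ≤ _ := by
        rw [mul_assoc]
        exact hB3.le
  linarith

section Block

variable {W : Type} [Fintype W] [DecidableEq W]

lemma exists_pattern {k l m r : ℕ} {H : Set (Finset W)} (cl : Fin m → Fin r → W) {u : ℝ}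
    (h : 1 / 2 * (r : ℝ) ^ m ≤ cnt (fun t : Fin m → Fin r =>
      HasYTilingCover m l (pat k H fun i => cl i (t i)) u)) (hr : 0 < r) :
    ∃ P : Finset (Finset (Fin m)), HasYTilingCover m l P u ∧
      1 / (2 * (Fintype.card (Finset (Finset (Fin m))) : ℝ)) * (r : ℝ) ^ m ≤
        cnt (fun t : Fin m → Fin r => pat k H (fun i => cl i (t i)) = P) := by
  classical
  set c : ℝ := (Fintype.card (Finset (Finset (Fin m))) : ℝ) with hc
  have hc0 : 0 < c := by
    rw [hc]
    exact_mod_cast Fintype.card_pos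
  have hr0 : (0 : ℝ) < (r : ℝ) ^ m := by positivity
  by_contra hcon
  push Not at hcon
  have h1 : cnt (fun t : Fin m → Fin r => HasYTilingCover m l (pat k H fun i => cl i (t i)) u) ≤
      cnt (fun t : Fin m → Fin r => ∃ P : Finset (Finset (Fin m)),
        HasYTilingCover m l P u ∧ pat k H (fun i => cl i (t i)) = P) :=
    cnt_mono fun t ht => ⟨_, ht, rfl⟩
  have h2 := cnt_exists_le (fun (P : Finset (Finset (Fin m))) (t : Fin m → Fin r) =>
    HasYTilingCover m l P u ∧ pat k H (fun i => cl i (t i)) = P)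
  have h3 : ∑ P : Finset (Finset (Fin m)), cnt (fun t : Fin m → Fin r =>
      HasYTilingCover m l P u ∧ pat k H (fun i => cl i (t i)) = P) <
      ∑ _P : Finset (Finset (Fin m)), 1 / (2 * c) * (r : ℝ) ^ m := by
    refine Finset.sum_lt_sum_of_nonempty Finset.univ_nonempty fun P _ => ?_
    by_cases hP : HasYTilingCover m l P u
    · refine lt_of_le_of_lt (cnt_mono fun t ht => ht.2) (hcon P hP)
    · rw [cnt_eq_sum, Finset.sum_eq_zero fun t _ => if_neg fun h => hP h.1]
      positivity
  rw [Finset.sum_const, Finset.card_univ, nsmul_eq_mul, ← hc] at h3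
  have h4 : c * (1 / (2 * c) * (r : ℝ) ^ m) = 1 / 2 * (r : ℝ) ^ m := by
    field_simp
  rw [h4] at h3
  linarith

lemma cnt_avoid {m r : ℕ} (hr0 : 0 < r) {τ : ℝ} {N : ℕ} (hrq : (N : ℝ) * m ≤ τ / 2 * r)
    {Q : (Fin m → Fin r) → Prop} (hP : τ * (r : ℝ) ^ m ≤ cnt Q)
    {T : Fin m → Finset (Fin r)} (hT1 : ∀ i, (T i).card ≤ N) :
    τ / 2 * (r : ℝ) ^ m ≤ cnt (fun t : Fin m → Fin r => Q t ∧ ∀ i, t i ∉ T i) := by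
  classical
  have hrr : (0 : ℝ) < r := by exact_mod_cast hr0
  have h0 := cnt_and_ge Q (fun t : Fin m → Fin r => ∀ i, t i ∉ T i)
  have h1 : cnt (fun t : Fin m → Fin r => ¬ ∀ i, t i ∉ T i) ≤
      ∑ i, cnt (fun t : Fin m → Fin r => t i ∈ T i) := by
    have e : (fun t : Fin m → Fin r => ¬ ∀ i, t i ∉ T i) =
        fun t : Fin m → Fin r => ∃ i, t i ∈ T i := by
      funext t
      simp only [not_forall, not_not]
    rw [e]
    exact cnt_exists_le fun (i : Fin m) (t : Fin m → Fin r) => t i ∈ T i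
  have h2 : ∀ i, cnt (fun t : Fin m → Fin r => t i ∈ T i) * r ≤ (N : ℝ) * (r : ℝ) ^ m := by
    intro i
    have h := cnt_mem_coord_mul_le (V := Fin r) i (T i)
    rw [Fintype.card_fin, Fintype.card_fin] at h
    have h' : ((T i).card : ℝ) ≤ N := by exact_mod_cast hT1 i
    exact h.trans (mul_le_mul_of_nonneg_right h' (by positivity))
  have h3 : (∑ i, cnt (fun t : Fin m → Fin r => t i ∈ T i)) * r ≤
      (τ / 2 * (r : ℝ) ^ m) * r := by
    rw [Finset.sum_mul]
    refine (Finset.sum_le_sum fun i _ => h2 i).trans ?_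
    rw [Finset.sum_const, Finset.card_univ, Fintype.card_fin, nsmul_eq_mul]
    calc (m : ℝ) * ((N : ℝ) * (r : ℝ) ^ m) = ((N : ℝ) * m) * (r : ℝ) ^ m := by ring
      _ ≤ (τ / 2 * r) * (r : ℝ) ^ m := mul_le_mul_of_nonneg_right hrq (by positivity)
      _ = _ := by ring
  have h4 := le_of_mul_le_mul_right h3 hrr
  linarith

lemma exists_selection {k m r r' q : ℕ} (hr0 : 0 < r)
    {H : Set (Finset W)} {cl : Fin m → Fin r → W} {τ : ℝ} (hτ0 : 0 < τ)
    (hrq : ((q * r' : ℕ) : ℝ) * m ≤ τ / 2 * r)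
    (hrbig : 2 * ((m : ℝ) * r') ^ 2 ≤ r * (τ / 2) ^ r' ^ m)
    {P : Finset (Finset (Fin m))}
    (hP : τ * (r : ℝ) ^ m ≤ cnt (fun t : Fin m → Fin r => pat k H (fun i => cl i (t i)) = P))
    {T : Fin m → Finset (Fin r)} (hT1 : ∀ i, (T i).card ≤ q * r') :
    ∃ g : Fin m × Fin r' → Fin r, Function.Injective g ∧
      ∀ σ : Fin m → Fin r', pat k H (fun i => cl i (g (i, σ i))) = P ∧ ∀ i, g (i, σ i) ∉ T i := by
  classical
  have hrr : (0 : ℝ) < r := by exact_mod_cast hr0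
  set τ' : ℝ := (τ / 2) ^ r' ^ m with hτ'
  have hτ'0 : 0 < τ' := by positivity
  have hcount : τ / 2 * (Fintype.card (Fin r) : ℝ) ^ Fintype.card (Fin m) ≤
      cnt (fun t : Fin m → Fin r => pat k H (fun i => cl i (t i)) = P ∧ ∀ i, t i ∉ T i) := by
    rw [Fintype.card_fin, Fintype.card_fin]
    exact cnt_avoid hr0 hrq hP hT1
  have hblow := cnt_blowup (V := Fin r) r' _ (by positivity) hcount
  rw [Fintype.card_fin, Fintype.card_fin, ← hτ'] at hblow
  have hinj := cnt_inj_avoid (V := Fin r) (β := Fin m × Fin r') _ ∅ (τ := τ') (by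
      simpa using hblow) (by
      simp only [Fintype.card_prod, Fintype.card_fin, Finset.card_empty]
      push_cast
      linarith) (by simpa using hr0)
  obtain ⟨g, hg1, hg2, -⟩ := exists_of_cnt_pos (lt_of_lt_of_le (by
    rw [Fintype.card_fin]
    positivity) hinj)
  exact ⟨g, hg2, hg1⟩

lemma tileable_selection {k l m r r' M : ℕ} (hr' : 0 < r')
    {H : Set (Finset W)} {cl : Fin m → Fin r → W}
    (hcl : ∀ i j a b, cl i a = cl j b → i = j ∧ a = b) {P : Finset (Finset (Fin m))}
    {e1 e2 : Fin M → Finset (Fin m)}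
    (hP1 : ∀ j, e1 j ∈ P ∧ e2 j ∈ P ∧ (e1 j ∩ e2 j).card = 2 * l)
    (hP2 : ∀ j j', j ≠ j' → Disjoint (e1 j ∪ e2 j) (e1 j' ∪ e2 j'))
    {T : Fin m → Finset (Fin r)} {g : Fin m × Fin r' → Fin r} (hg2 : Function.Injective g)
    (hg1 : ∀ σ : Fin m → Fin r', pat k H (fun i => cl i (g (i, σ i))) = P ∧ ∀ i, g (i, σ i) ∉ T i)
    (hT2 : Tileable k l r' H
      ((Finset.univ.biUnion fun j => e1 j ∪ e2 j).biUnion fun i => (T i).image (cl i))) :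
    Tileable k l r' H ((Finset.univ.biUnion fun j => e1 j ∪ e2 j).biUnion fun i =>
      (T i ∪ Finset.univ.image fun a => g (i, a)).image (cl i)) := by
  classical
  set K : Finset (Fin m) := Finset.univ.biUnion fun j => e1 j ∪ e2 j with hK
  have hgT : ∀ i a, g (i, a) ∉ T i := fun i a => (hg1 fun _ => a).2 i
  have hsplit : (K.biUnion fun i => (T i ∪ Finset.univ.image fun a => g (i, a)).image (cl i)) =
      (K.biUnion fun i => (T i).image (cl i)) ∪
      (Finset.univ : Finset (Fin M)).biUnion fun j => (e1 j ∪ e2 j).biUnion fun i =>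
        Finset.univ.image fun a => cl i (g (i, a)) := by
    rw [← Finset.biUnion_biUnion, ← hK, ← Finset.biUnion_union]
    refine Finset.biUnion_congr rfl fun i _ => ?_
    rw [Finset.image_union, Finset.image_image]
    rfl
  rw [hsplit]
  refine hT2.union (Tileable.biUnion _ _ (fun j _ => IsTile.tileable ?_) ?_) ?_
  · refine ⟨m, e1 j, e2 j, fun i a => cl i (g (i, a)), ?_, ?_, (hP1 j).2.2, ?_, ?_, rfl⟩
    · have := (hg1 fun _ => ⟨0, hr'⟩).1
      have h1 := (hP1 j).1
      rw [← this] at h1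
      exact (mem_pat.1 h1).1
    · have := (hg1 fun _ => ⟨0, hr'⟩).1
      have h1 := (hP1 j).2.1
      rw [← this] at h1
      exact (mem_pat.1 h1).1
    · intro i _ j _ a b hab
      have := hg2 (hcl _ _ _ _ hab).2
      simpa using this
    · intro σ
      have := (hg1 σ).1
      have h1 := (hP1 j).1
      have h2 := (hP1 j).2.1
      rw [← this] at h1 h2
      exact ⟨(mem_pat.1 h1).2, (mem_pat.1 h2).2⟩
  · intro j _ j' _ hjj
    rw [Finset.disjoint_biUnion_left]
    intro i hi
    rw [Finset.disjoint_biUnion_right]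
    intro i' hi'
    rw [Finset.disjoint_left]
    intro x hx hx'
    obtain ⟨a, -, rfl⟩ := Finset.mem_image.1 hx
    obtain ⟨b, -, hb⟩ := Finset.mem_image.1 hx'
    have := (hcl _ _ _ _ hb).1
    subst this
    exact Finset.disjoint_left.1 (hP2 j j' hjj) hi hi'
  · rw [Finset.disjoint_biUnion_left]
    intro i _
    rw [Finset.disjoint_biUnion_right]
    intro j _
    rw [Finset.disjoint_biUnion_right]
    intro i' _
    rw [Finset.disjoint_left]
    intro x hx hx'
    obtain ⟨a, ha, rfl⟩ := Finset.mem_image.1 hx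
    obtain ⟨b, -, hb⟩ := Finset.mem_image.1 hx'
    obtain ⟨h1, h2⟩ := hcl _ _ _ _ hb
    subst h1
    rw [← h2] at ha
    exact hgT _ _ ha

lemma exists_block_of_pattern {k l m r r' q : ℕ} (hr0 : 0 < r) (hr' : 0 < r')
    {H : Set (Finset W)} {cl : Fin m → Fin r → W} {u τ : ℝ} (hτ0 : 0 < τ)
    (hrq : ((q * r' : ℕ) : ℝ) * m ≤ τ / 2 * r)
    (hrbig : 2 * ((m : ℝ) * r') ^ 2 ≤ r * (τ / 2) ^ r' ^ m)
    (hcl : ∀ i j a b, cl i a = cl j b → i = j ∧ a = b) {P : Finset (Finset (Fin m))}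
    (hPu : HasYTilingCover m l P u)
    (hP : τ * (r : ℝ) ^ m ≤ cnt (fun t : Fin m → Fin r => pat k H (fun i => cl i (t i)) = P)) :
    ∃ (K : Finset (Fin m)) (T : Fin m → Finset (Fin r)),
      (m : ℝ) - K.card ≤ u ∧ (∀ i, (T i).card = q * r') ∧
      Tileable k l r' H (K.biUnion fun i => (T i).image (cl i)) := by
  classical
  obtain ⟨M, e1, e2, hP1, hP2, hP3⟩ := hPu
  set K : Finset (Fin m) := Finset.univ.biUnion fun j => e1 j ∪ e2 j with hK
  have hgreedy : ∀ j ≤ q, ∃ T : Fin m → Finset (Fin r), (∀ i, (T i).card = j * r') ∧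
      Tileable k l r' H (K.biUnion fun i => (T i).image (cl i)) := by
    intro j
    induction j with
    | zero =>
      refine fun _ => ⟨fun _ => ∅, by simp, ?_⟩
      have : (K.biUnion fun i => (∅ : Finset (Fin r)).image (cl i)) = ∅ := by
        ext x
        simp
      rw [this]
      exact Tileable.empty
    | succ j ih =>
      intro hj
      obtain ⟨T, hT1, hT2⟩ := ih (by omega)
      obtain ⟨g, hg2, hg1⟩ := exists_selection hr0 hτ0 hrq hrbig hP (T := T) fun i => by
        rw [hT1]
        gcongr
        omega
      refine ⟨fun i => T i ∪ Finset.univ.image fun a => g (i, a), fun i => ?_,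
        tileable_selection hr' hcl hP1 hP2 hg2 hg1 hT2⟩
      rw [Finset.card_union_of_disjoint, hT1, Finset.card_image_of_injective]
      · simp
        ring
      · intro a b hab
        have := hg2 hab
        simpa using this
      · rw [Finset.disjoint_right]
        intro x hx
        obtain ⟨a, -, rfl⟩ := Finset.mem_image.1 hx
        exact (hg1 fun _ => a).2 i
  obtain ⟨T, hT1, hT2⟩ := hgreedy q le_rfl
  exact ⟨K, T, hP3, hT1, hT2⟩

/-- From `m` clusters many of whose transversals span `k`-graphs with almost perfect tilings,
a fixed proportion of almost all of the clusters can be tiled. -/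
lemma exists_block {k l m : ℕ} (hm : 0 < m) : ∃ S : ℕ, 1 < S ∧ ∀ r' : ℕ, 0 < r' →
    ∃ q : ℕ, 0 < q ∧ ∀ (W : Type) [Fintype W] [DecidableEq W] (H : Set (Finset W))
      (cl : Fin m → Fin (r' * (S * q)) → W) (u : ℝ),
      (∀ i j a b, cl i a = cl j b → i = j ∧ a = b) →
      1 / 2 * ((r' * (S * q) : ℕ) : ℝ) ^ m ≤ cnt (fun t : Fin m → Fin (r' * (S * q)) =>
        HasYTilingCover m l (pat k H fun i => cl i (t i)) u) →
      ∃ (K : Finset (Fin m)) (T : Fin m → Finset (Fin (r' * (S * q)))),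
        (m : ℝ) - K.card ≤ u ∧ (∀ i, (T i).card = q * r') ∧
        Tileable k l r' H (K.biUnion fun i => (T i).image (cl i)) := by
  obtain ⟨c, hc⟩ : ∃ c : ℕ, c = Fintype.card (Finset (Finset (Fin m))) := ⟨_, rfl⟩
  have hc0 : 0 < c := by
    rw [hc]
    exact Fintype.card_pos
  obtain ⟨τ, hτ⟩ : ∃ τ : ℝ, τ = 1 / (2 * (c : ℝ)) := ⟨_, rfl⟩
  have hcr : (0 : ℝ) < c := by exact_mod_cast hc0
  have hτ0 : 0 < τ := by
    rw [hτ]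
    positivity
  have hmr : (0 : ℝ) < m := by exact_mod_cast hm
  refine ⟨4 * m * c, by nlinarith, fun r' hr' => ?_⟩
  have hτ'0 : 0 < (τ / 2) ^ r' ^ m := by positivity
  obtain ⟨q, hq⟩ := exists_nat_ge (2 * ((m : ℝ) * r') ^ 2 / (τ / 2) ^ r' ^ m)
  refine ⟨q + 1, Nat.succ_pos q, ?_⟩
  intro W _ _ H
  obtain ⟨r, hr⟩ : ∃ r, r = r' * (4 * m * c * (q + 1)) := ⟨_, rfl⟩
  rw [← hr]
  intro cl u hcl hcnt
  have hr0 : 0 < r := by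
    rw [hr]
    positivity
  obtain ⟨P, hPu, hP⟩ := exists_pattern cl hcnt hr0
  rw [← hc, ← hτ] at hP
  refine exists_block_of_pattern hr0 hr' hτ0 ?_ ?_ hcl hPu hP
  · rw [hτ, hr]
    push_cast
    field_simp
    ring_nf
    linarith
  · rw [div_le_iff₀ hτ'0] at hq
    refine hq.trans ?_
    have : q ≤ r := by
      have h1 : 0 < r' * (4 * m * c) := by positivity
      have h2 : r = r' * (4 * m * c) * (q + 1) := by rw [hr]; ring
      rw [h2]
      nlinarith
    gcongr

end Block

section Bite

variable {W : Type} [Fintype W] [DecidableEq W]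

/-- If few tuples are bad, some permutation makes few of the given blocks bad. -/
lemma exists_perm_few_bad {N m M : ℕ} (b : Fin M → Fin m → Fin N)
    (hb : ∀ c, Function.Injective (b c)) (Bad : (Fin m → Fin N) → Prop) {ρ : ℝ}
    (hpos : 0 < cnt (fun j : Fin m → Fin N => Function.Injective j))
    (h : cnt (fun j : Fin m → Fin N => Function.Injective j ∧ Bad j) ≤
      ρ * cnt (fun j : Fin m → Fin N => Function.Injective j)) :
    ∃ π : Equiv.Perm (Fin N), cnt (fun c : Fin M => Bad fun i => π (b c i)) ≤ ρ * M := by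
  classical
  by_contra hcon
  push Not at hcon
  have h1 : ∀ c, cnt (fun π : Equiv.Perm (Fin N) => Bad fun i => π (b c i)) ≤
      ρ * Fintype.card (Equiv.Perm (Fin N)) := by
    intro c
    have h2 := cnt_perm_mul (hb c) Bad
    refine le_of_mul_le_mul_right ?_ hpos
    rw [h2]
    calc _ ≤ (Fintype.card (Equiv.Perm (Fin N)) : ℝ) *
          (ρ * cnt (fun j : Fin m → Fin N => Function.Injective j)) :=
          mul_le_mul_of_nonneg_left h (Nat.cast_nonneg _)
      _ = _ := by ring
  have h3 := cnt_prod (fun (π : Equiv.Perm (Fin N)) (c : Fin M) => Bad fun i => π (b c i))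
  have h4 := cnt_prod' (fun (π : Equiv.Perm (Fin N)) (c : Fin M) => Bad fun i => π (b c i))
  have h5 : ∑ c : Fin M, cnt (fun π : Equiv.Perm (Fin N) => Bad fun i => π (b c i)) ≤
      M * (ρ * Fintype.card (Equiv.Perm (Fin N))) := by
    refine (Finset.sum_le_sum fun c _ => h1 c).trans ?_
    rw [Finset.sum_const, Finset.card_univ, Fintype.card_fin, nsmul_eq_mul]
  have h6 : ∑ _π : Equiv.Perm (Fin N), ρ * (M : ℝ) <
      ∑ π : Equiv.Perm (Fin N), cnt (fun c : Fin M => Bad fun i => π (b c i)) :=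
    Finset.sum_lt_sum_of_nonempty Finset.univ_nonempty fun π _ => hcon π
  rw [Finset.sum_const, Finset.card_univ, nsmul_eq_mul] at h6
  rw [← h3, h4] at h6
  linarith

lemma combine_blocks {k l s m M N r : ℕ} {H : Set (Finset W)} (J : Fin M × Fin m → Fin N)
    (hJ : Function.Injective J) (cl : Fin N → Fin r → W)
    (hcl : ∀ i j a b, cl i a = cl j b → i = j ∧ a = b) (G : Finset (Fin M)) {t : ℕ}
    (Kc : Fin M → Finset (Fin m)) (Tc : Fin M → Fin m → Finset (Fin r))
    (hTc : ∀ c ∈ G, ∀ i, (Tc c i).card = t)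
    (h : ∀ c ∈ G, Tileable k l s H ((Kc c).biUnion fun i => (Tc c i).image (cl (J (c, i))))) :
    ∃ (K : Finset (Fin N)) (T : Fin N → Finset (Fin r)), K.card = ∑ c ∈ G, (Kc c).card ∧
      (∀ i ∈ K, (T i).card = t) ∧
      Tileable k l s H (K.biUnion fun i => (T i).image (cl i)) := by
  classical
  have hT : ∀ c i, Function.extend J (fun z => Tc z.1 z.2) (fun _ => ∅) (J (c, i)) = Tc c i :=
    fun c i => hJ.extend_apply _ _ _
  refine ⟨G.biUnion fun c => (Kc c).image fun i => J (c, i),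
    Function.extend J (fun z => Tc z.1 z.2) (fun _ => ∅), ?_, ?_, ?_⟩
  · rw [Finset.card_biUnion]
    · refine Finset.sum_congr rfl fun c _ => Finset.card_image_of_injective _ fun i j hij => ?_
      have := hJ hij
      simpa using this
    · intro c _ c' _ hcc
      rw [Function.onFun, Finset.disjoint_left]
      intro x hx hx'
      obtain ⟨i, -, rfl⟩ := Finset.mem_image.1 hx
      obtain ⟨j, -, hj⟩ := Finset.mem_image.1 hx'
      have := hJ hj
      simp only [Prod.mk.injEq] at this
      exact hcc this.1.symm
  · intro x hx
    obtain ⟨c, hc, hx⟩ := Finset.mem_biUnion.1 hx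
    obtain ⟨i, -, rfl⟩ := Finset.mem_image.1 hx
    rw [hT]
    exact hTc c hc i
  · rw [Finset.biUnion_biUnion]
    refine Tileable.biUnion G _ (fun c hc => ?_) fun c hc c' hc' hcc => ?_
    · rw [Finset.image_biUnion]
      simp only [hT]
      exact h c hc
    · rw [Finset.image_biUnion, Finset.image_biUnion, Finset.disjoint_biUnion_left]
      intro i _
      rw [Finset.disjoint_biUnion_right]
      intro j _
      rw [Finset.disjoint_left]
      intro x hx hx'
      obtain ⟨a, -, rfl⟩ := Finset.mem_image.1 hx
      obtain ⟨b, -, hb⟩ := Finset.mem_image.1 hx'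
      have := hJ (hcl _ _ _ _ hb).1
      simp only [Prod.mk.injEq] at this
      exact hcc this.1.symm

/-- Almost all `m`-tuples of clusters have many good transversals. -/
lemma cnt_bad_block {m N r : ℕ} (cl : Fin N → Fin r → W)
    (hcl : ∀ i j a b, cl i a = cl j b → i = j ∧ a = b) (hr : 0 < r) (hmN : m ≤ N) (hN : 0 < N)
    (hcard : Fintype.card W ≤ (N + 1) * r) (Good : (Fin m → W) → Prop) {ε2 : ℝ} (hε2 : 0 ≤ ε2)
    (h : cnt (fun x : Fin m → W => ¬ (Function.Injective x ∧ Good x)) ≤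
      ε2 * (Fintype.card W : ℝ) ^ m) :
    cnt (fun b : Fin m → Fin N => Function.Injective b ∧
      ¬ 1 / 2 * (r : ℝ) ^ m ≤ cnt (fun t : Fin m → Fin r => Good fun i => cl (b i) (t i))) ≤
    6 * ε2 * (N : ℝ) ^ m := by
  classical
  have hrr : (0 : ℝ) < r := by exact_mod_cast hr
  have hNr : (0 : ℝ) < N := by exact_mod_cast hN
  have hW : (Fintype.card W : ℝ) ^ m ≤ 3 * ((N : ℝ) ^ m * (r : ℝ) ^ m) := by
    have h1 : (Fintype.card W : ℝ) ≤ (1 / N + 1) * (N * r) := by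
      have : (Fintype.card W : ℝ) ≤ (N + 1) * r := by exact_mod_cast hcard
      refine this.trans (le_of_eq ?_)
      field_simp
      ring
    have h2 : ((1 : ℝ) / N + 1) ^ m ≤ 3 := by
      calc ((1 : ℝ) / N + 1) ^ m ≤ (Real.exp (1 / N)) ^ m := by
            gcongr
            exact Real.add_one_le_exp _
        _ = Real.exp (m * (1 / N)) := by rw [← Real.exp_nat_mul]
        _ ≤ Real.exp 1 := by
            apply Real.exp_le_exp.2
            rw [mul_one_div, div_le_one hNr]
            exact_mod_cast hmN
        _ ≤ 3 := (Real.exp_one_lt_d9.le.trans (by norm_num))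
    calc (Fintype.card W : ℝ) ^ m ≤ ((1 / N + 1) * (N * r)) ^ m := by gcongr
      _ = ((1 : ℝ) / N + 1) ^ m * ((N : ℝ) ^ m * (r : ℝ) ^ m) := by rw [mul_pow, mul_pow]
      _ ≤ _ := by gcongr
  have h1 := cnt_and_prod_ge (X := Fin m → Fin N) (Y := Fin m → Fin r)
    (P := fun b : Fin m → Fin N => Function.Injective b ∧
      ¬ 1 / 2 * (r : ℝ) ^ m ≤ cnt (fun t : Fin m → Fin r => Good fun i => cl (b i) (t i)))
    (Q := fun b t => ¬ Good fun i => cl (b i) (t i)) (b := 1 / 2 * (r : ℝ) ^ m)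
    (by positivity) le_rfl (by
      rintro b ⟨-, hb⟩
      have h2 := cnt_and_ge (fun _ : Fin m → Fin r => True)
        (fun t : Fin m → Fin r => Good fun i => cl (b i) (t i))
      rw [cnt_true] at h2
      simp only [Fintype.card_pi, Fintype.card_fin, Finset.prod_const, Finset.card_univ,
        true_and] at h2
      push_cast at h2
      linarith)
  have h2 := cnt_le_of_injective
    (P := fun z : (Fin m → Fin N) × (Fin m → Fin r) => (Function.Injective z.1 ∧
      ¬ 1 / 2 * (r : ℝ) ^ m ≤ cnt (fun t : Fin m → Fin r => Good fun i => cl (z.1 i) (t i))) ∧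
      ¬ Good fun i => cl (z.1 i) (z.2 i))
    (Q := fun x : Fin m → W => ¬ (Function.Injective x ∧ Good x))
    (fun z i => cl (z.1 i) (z.2 i)) (by
      rintro ⟨b, t⟩ ⟨b', t'⟩ h
      have := fun i => hcl _ _ _ _ (congrFun h i)
      exact Prod.ext (funext fun i => (this i).1) (funext fun i => (this i).2))
    (fun z hz hz' => hz.2 hz'.2)
  have h3 := (h1.trans h2).trans h
  have h4 : ε2 * (Fintype.card W : ℝ) ^ m ≤ ε2 * (3 * ((N : ℝ) ^ m * (r : ℝ) ^ m)) := by gcongr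
  have hrm : (0 : ℝ) < (r : ℝ) ^ m := by positivity
  refine le_of_mul_le_mul_right ?_ (show (0 : ℝ) < 1 / 2 * (r : ℝ) ^ m by positivity)
  refine (h3.trans h4).trans (le_of_eq ?_)
  ring

lemma half_le_cnt_injective {m N : ℕ} (hN : 0 < N) (h : 2 * m ^ 2 ≤ N) :
    1 / 2 * (N : ℝ) ^ m ≤ cnt (fun j : Fin m → Fin N => Function.Injective j) := by
  have hNr : (0 : ℝ) < N := by exact_mod_cast hN
  have h1 := cnt_not_injective_mul (W := Fin N) m
  rw [Fintype.card_fin] at h1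
  have h2 := cnt_and_ge (fun _ : Fin m → Fin N => True) (fun j => Function.Injective j)
  rw [cnt_true] at h2
  simp only [Fintype.card_pi, Fintype.card_fin, Finset.prod_const, Finset.card_univ,
    true_and] at h2
  push_cast at h2
  have h3 : cnt (fun x : Fin m → Fin N => ¬ Function.Injective x) ≤ 1 / 2 * (N : ℝ) ^ m := by
    refine le_of_mul_le_mul_right (h1.trans ?_) hNr
    have h4 : 2 * (m : ℝ) ^ 2 ≤ N := by exact_mod_cast h
    have h5 : (0 : ℝ) < (N : ℝ) ^ m := by positivity
    nlinarith
  linarith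

end Bite

lemma cnt_eq_card_filter {X : Type} [Fintype X] (P : X → Prop) [DecidablePred P] :
    cnt P = ((Finset.univ.filter P).card : ℝ) := by
  rw [cnt, Nat.card_eq_fintype_card, Fintype.card_subtype]

lemma le_card_filter_not {M : ℕ} (P : Fin M → Prop) [DecidablePred P] {x : ℝ}
    (h : cnt (fun c => ¬ P c) ≤ x) : (M : ℝ) - x ≤ ((Finset.univ.filter P).card : ℝ) := by
  have h2 := cnt_and_ge (fun _ : Fin M => True) P
  rw [cnt_true, Fintype.card_fin] at h2
  simp only [true_and] at h2
  rw [cnt_eq_card_filter P] at h2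
  linarith

/-- Given a partition of the vertices into clusters, a fixed proportion of almost every cluster
can be covered by tiles with smaller parts. -/
lemma exists_bite {k l d : ℕ} (hdk : d < k) {μ ε1 : ℝ} (hμ : tVal k d l < μ) (hμ0 : 0 ≤ μ)
    (hε1 : 0 < ε1) (hε1' : ε1 ≤ 1) : ∃ S : ℕ, 1 < S ∧ ∀ r' : ℕ, 0 < r' → ∃ q : ℕ, 0 < q ∧
      ∃ n0 : ℕ, ∀ (W : Type) [Fintype W] [DecidableEq W] (H : Set (Finset W)),
        DegCond d k H μ → ∀ (N : ℕ) (cl : Fin N → Fin (r' * (S * q)) → W),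
        (∀ i j a b, cl i a = cl j b → i = j ∧ a = b) → n0 ≤ N →
        Fintype.card W ≤ (N + 1) * (r' * (S * q)) →
        ∃ (K : Finset (Fin N)) (T : Fin N → Finset (Fin (r' * (S * q)))),
          (N : ℝ) - K.card ≤ ε1 * N ∧ (∀ i ∈ K, (T i).card = q * r') ∧
          Tileable k l r' H (K.biUnion fun i => (T i).image (cl i)) := by
  classical
  obtain ⟨m, hm, n1, hsamp⟩ := exists_sampling (l := l) hdk hμ hμ0
    (show 0 < ε1 / 4 by positivity) (show 0 < ε1 / 48 by positivity)
  obtain ⟨S, hS, hblock⟩ := exists_block (k := k) (l := l) hm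
  refine ⟨S, hS, fun r' hr' => ?_⟩
  obtain ⟨q, hq, hblock⟩ := hblock r' hr'
  refine ⟨q, hq, ?_⟩
  obtain ⟨n2, hn2⟩ := exists_nat_ge (2 * (m : ℝ) / ε1)
  refine ⟨n1 + n2 + 2 * m ^ 2 + m + 1, ?_⟩
  intro W _ _ H hH N
  have hr0 : 0 < r' * (S * q) := by positivity
  generalize r' * (S * q) = r at *
  intro cl hcl hN hW
  have hN0 : 0 < N := by omega
  have hNr : (0 : ℝ) < N := by exact_mod_cast hN0
  have hWN : n1 ≤ Fintype.card W := by
    have : Fintype.card (Fin N) ≤ Fintype.card W :=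
      Fintype.card_le_of_injective (fun i => cl i ⟨0, hr0⟩) fun i j h => (hcl _ _ _ _ h).1
    rw [Fintype.card_fin] at this
    omega
  have hbad := cnt_bad_block cl hcl hr0 (m := m) (by omega) hN0 hW
    (fun x => HasYTilingCover m l (pat k H x) (ε1 / 4 * m)) (by positivity) (hsamp W H hH hWN)
  have hinj := half_le_cnt_injective (m := m) hN0 (by omega)
  have hNm : N / m * m ≤ N := Nat.div_mul_le_self N m
  obtain ⟨π, hπ⟩ := exists_perm_few_bad (M := N / m) (ρ := ε1 / 4)
    (fun c i => Fin.castLE hNm (finProdFinEquiv (c, i)))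
    (fun c i j hij => by
      have := finProdFinEquiv.injective (Fin.castLE_injective hNm hij)
      simpa using this) _ (lt_of_lt_of_le (by positivity) hinj) (hbad.trans (by nlinarith))
  set J : Fin (N / m) × Fin m → Fin N := fun z => π (Fin.castLE hNm (finProdFinEquiv z)) with hJ
  have hJi : Function.Injective J :=
    π.injective.comp ((Fin.castLE_injective hNm).comp finProdFinEquiv.injective)
  have hG := le_card_filter_not (fun c : Fin (N / m) => 1 / 2 * (r : ℝ) ^ m ≤
    cnt (fun t : Fin m → Fin r => HasYTilingCover m l
      (pat k H fun i => cl (J (c, i)) (t i)) (ε1 / 4 * m))) hπ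
  set G := Finset.univ.filter (fun c : Fin (N / m) => 1 / 2 * (r : ℝ) ^ m ≤
    cnt (fun t : Fin m → Fin r => HasYTilingCover m l
      (pat k H fun i => cl (J (c, i)) (t i)) (ε1 / 4 * m))) with hGdef
  have hex : ∀ c, ∃ (K : Finset (Fin m)) (T : Fin m → Finset (Fin r)), c ∈ G →
      (m : ℝ) - K.card ≤ ε1 / 4 * m ∧ (∀ i, (T i).card = q * r') ∧
      Tileable k l r' H (K.biUnion fun i => (T i).image (cl (J (c, i)))) := by
    intro c
    by_cases hc : c ∈ G
    · obtain ⟨K, T, h⟩ := hblock W H (fun i => cl (J (c, i))) (ε1 / 4 * m) (fun i j a b h => by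
        have h1 := hcl _ _ _ _ h
        have h2 := hJi h1.1
        simp only [Prod.mk.injEq] at h2
        exact ⟨h2.2, h1.2⟩) (Finset.mem_filter.1 hc).2
      exact ⟨K, T, fun _ => h⟩
    · exact ⟨∅, fun _ => ∅, fun h => absurd h hc⟩
  choose Kc Tc hKT using hex
  obtain ⟨K, T, hK, hT, htile⟩ := combine_blocks J hJi cl hcl G Kc Tc
    (fun c hc => (hKT c hc).2.1) (fun c hc => (hKT c hc).2.2)
  refine ⟨K, T, ?_, hT, htile⟩
  have h1 : (G.card : ℝ) * ((1 - ε1 / 4) * m) ≤ K.card := by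
    rw [hK]
    push_cast
    rw [← nsmul_eq_mul]
    refine Finset.card_nsmul_le_sum _ _ _ fun c hc => ?_
    have := (hKT c hc).1
    linarith
  have h2 : (N : ℝ) - m ≤ (N / m : ℕ) * m := by
    have : N < N / m * m + m := by
      have := Nat.div_add_mod N m
      have h := Nat.mod_lt N hm
      nlinarith
    have : (N : ℝ) < (N / m : ℕ) * m + m := by exact_mod_cast this
    linarith
  have h3 : 2 * (m : ℝ) ≤ ε1 * N := by
    rw [div_le_iff₀ hε1] at hn2
    have : (n2 : ℝ) ≤ N := by
      exact_mod_cast (by omega : n2 ≤ N)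
    nlinarith
  have hm0 : (0 : ℝ) < m := by exact_mod_cast hm
  have h4 : (1 - ε1 / 4) * ((1 - ε1 / 4) * ((N : ℝ) - m)) ≤ G.card * ((1 - ε1 / 4) * m) := by
    calc (1 - ε1 / 4) * ((1 - ε1 / 4) * ((N : ℝ) - m)) ≤
        (1 - ε1 / 4) * ((1 - ε1 / 4) * ((N / m : ℕ) * m)) := by
          gcongr <;> linarith
      _ = (((N / m : ℕ) : ℝ) - ε1 / 4 * (N / m : ℕ)) * ((1 - ε1 / 4) * m) := by ring
      _ ≤ _ := by
          gcongr
          nlinarith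
  have h5 : (m : ℝ) ≤ N := by exact_mod_cast (by omega : m ≤ N)
  nlinarith [mul_nonneg hε1.le (sub_nonneg.2 h5), mul_nonneg (mul_nonneg hε1.le hε1.le) (sub_nonneg.2 h5)]

section Step

variable {W : Type} [Fintype W] [DecidableEq W]

lemma exists_chunks {r : ℕ} (L : Finset W) : ∀ t : ℕ, t * r ≤ L.card →
    ∃ c : Fin t → Finset W, (∀ i, (c i).card = r ∧ c i ⊆ L) ∧
      ∀ i j, i ≠ j → Disjoint (c i) (c j) := by
  intro t ht
  have h := L.equivFin.symm
  have hlt : ∀ z : Fin t × Fin r, (finProdFinEquiv z : ℕ) < L.card := fun z =>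
    lt_of_lt_of_le (finProdFinEquiv z).2 ht
  have hinj : Function.Injective fun z : Fin t × Fin r => (h ⟨finProdFinEquiv z, hlt z⟩ : W) := by
    intro z z' hz
    have := h.injective (Subtype.ext hz)
    exact finProdFinEquiv.injective (Fin.ext (Fin.mk.inj_iff.1 this))
  refine ⟨fun i => Finset.univ.image fun a : Fin r => (h ⟨finProdFinEquiv (i, a), hlt _⟩ : W),
    fun i => ⟨?_, fun x hx => ?_⟩, fun i j hij => ?_⟩
  · rw [Finset.card_image_of_injective, Finset.card_univ, Fintype.card_fin]
    intro a b hab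
    simpa using hinj hab
  · obtain ⟨a, -, rfl⟩ := Finset.mem_image.1 hx
    exact (h _).2
  · rw [Finset.disjoint_left]
    intro x hx hx'
    obtain ⟨a, -, rfl⟩ := Finset.mem_image.1 hx
    obtain ⟨b, -, hb⟩ := Finset.mem_image.1 hx'
    have := hinj hb
    simp only [Prod.mk.injEq] at this
    exact hij this.1.symm

/-- A family of disjoint `r`-sets extends to an enumerated almost partition into `r`-sets. -/
lemma exists_enumeration {r : ℕ} (hr : 0 < r) (C : Finset (Finset W)) (hC : ∀ c ∈ C, c.card = r)
    (hdisj : ∀ c ∈ C, ∀ c' ∈ C, c ≠ c' → Disjoint c c') :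
    ∃ (N : ℕ) (cl : Fin N → Fin r → W), (∀ i j a b, cl i a = cl j b → i = j ∧ a = b) ∧
      Fintype.card W < (N + 1) * r ∧ ∀ c ∈ C, ∃ i, Finset.univ.image (cl i) = c := by
  classical
  set L : Finset W := Finset.univ \ C.biUnion id with hL
  obtain ⟨c, hc, hcd⟩ := exists_chunks (r := r) L (L.card / r) (Nat.div_mul_le_self _ _)
  let cs : Fin C.card ⊕ Fin (L.card / r) → Finset W :=
    Sum.elim (fun i => (C.equivFin.symm i : Finset W)) c
  have hcs : ∀ i, (cs i).card = r := by
    rintro (i | i)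
    · exact hC _ (C.equivFin.symm i).2
    · exact (hc i).1
  have hCL : ∀ c' ∈ C, ∀ i, Disjoint c' (c i) := by
    intro c' hc' i
    refine Finset.disjoint_of_subset_right (hc i).2 ?_
    rw [hL]
    refine Finset.disjoint_of_subset_left ?_ Finset.disjoint_sdiff
    exact Finset.subset_biUnion_of_mem id hc'
  have hcsd : ∀ i j, i ≠ j → Disjoint (cs i) (cs j) := by
    rintro (i | i) (j | j) hij
    · refine hdisj _ (C.equivFin.symm i).2 _ (C.equivFin.symm j).2 fun h => hij ?_
      rw [C.equivFin.symm.injective (Subtype.ext h)]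
    · exact hCL _ (C.equivFin.symm i).2 j
    · exact (hCL _ (C.equivFin.symm j).2 i).symm
    · exact hcd i j fun h => hij (by rw [h])
  have hcard : Fintype.card W = C.card * r + L.card := by
    rw [hL, Finset.card_sdiff, Finset.inter_univ, Finset.card_univ]
    have h1 : (C.biUnion id).card = C.card * r := by
      rw [Finset.card_biUnion (t := id) hdisj]
      exact Finset.sum_const_nat hC
    have h2 := Finset.card_le_univ (C.biUnion id)
    omega
  let e : Fin (C.card + L.card / r) ≃ Fin C.card ⊕ Fin (L.card / r) := finSumFinEquiv.symm
  let f : ∀ i, Fin r ≃ cs i := fun i => ((cs i).equivFinOfCardEq (hcs i)).symm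
  have himg : ∀ i, Finset.univ.image (fun a => (f i a : W)) = cs i := by
    intro i
    ext x
    simp only [Finset.mem_image, Finset.mem_univ, true_and]
    constructor
    · rintro ⟨a, rfl⟩
      exact (f i a).2
    · intro hx
      exact ⟨(f i).symm ⟨x, hx⟩, by simp⟩
  refine ⟨C.card + L.card / r, fun i a => (f (e i) a : W), ?_, ?_, ?_⟩
  · intro i j a b hab
    by_cases hij : i = j
    · subst hij
      exact ⟨rfl, (f (e i)).injective (Subtype.ext hab)⟩
    · have := Finset.disjoint_left.1 (hcsd (e i) (e j) fun h => hij (e.injective h)) (f (e i) a).2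
      exact absurd (by
        rw [show (f (e i) a : W) = f (e j) b from hab]
        exact (f (e j) b).2) this
  · rw [hcard]
    have := Nat.lt_div_mul_add (a := L.card) hr
    nlinarith
  · intro c' hc'
    refine ⟨e.symm (Sum.inl (C.equivFin ⟨c', hc'⟩)), ?_⟩
    rw [himg]
    simp [cs]

/-- Large hypergraphs with the given degree condition can be tiled up to a proportion `u`. -/
def Coverable (k l d : ℕ) (μ u : ℝ) : Prop :=
  ∀ r : ℕ, 0 < r → ∃ n0 : ℕ, ∀ (W : Type) [Fintype W] [DecidableEq W] (H : Set (Finset W)),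
    DegCond d k H μ → n0 ≤ Fintype.card W →
    ∃ Z, Tileable k l r H Z ∧ u * Fintype.card W ≤ Z.card

/-- Replace parts of the clusters of a tiling by a bite. -/
lemma Tileable.exchange {k l r' S q N : ℕ} (hS : 1 < S)
    {H : Set (Finset W)} {C : Finset (Finset W)} (hC : ∀ c ∈ C, c.card = r' * (S * q))
    (hdisj : ∀ c ∈ C, ∀ c' ∈ C, c ≠ c' → Disjoint c c')
    (hCt : ∀ (ρ : ℕ) (S : Finset W → Finset W), (∀ c ∈ C, S c ⊆ c ∧ (S c).card = ρ) →
      Tileable k l ρ H (C.biUnion S))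
    (cl : Fin N → Fin (r' * (S * q)) → W)
    (hcl : ∀ i j a b, cl i a = cl j b → i = j ∧ a = b)
    (hCcl : ∀ c ∈ C, ∃ i, Finset.univ.image (cl i) = c)
    {K : Finset (Fin N)} {T : Fin N → Finset (Fin (r' * (S * q)))}
    (hT : ∀ i ∈ K, (T i).card = q * r')
    (ht : Tileable k l r' H (K.biUnion fun i => (T i).image (cl i))) :
    ∃ Z, Tileable k l r' H Z ∧ Z.card = C.card * ((S - 1) * q * r') + K.card * (q * r') := by
  classical
  obtain ⟨S, rfl⟩ : ∃ S', S = S' + 1 := ⟨S - 1, by omega⟩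
  rw [Nat.add_sub_cancel]
  set B := K.biUnion fun i => (T i).image (cl i) with hB
  have hinj : ∀ i, Function.Injective (cl i) := fun i a b hab => (hcl _ _ _ _ hab).2
  have hrr : r' * ((S + 1) * q) = S * q * r' + q * r' := by ring
  have hex : ∀ c, ∃ s : Finset W, c ∈ C → (s ⊆ c ∧ s.card = S * q * r') ∧ Disjoint s B := by
    intro c
    by_cases hc : c ∈ C
    · obtain ⟨i, rfl⟩ := hCcl c hc
      by_cases hi : i ∈ K
      · refine ⟨Finset.univ.image (cl i) \ (T i).image (cl i), fun _ =>
          ⟨⟨Finset.sdiff_subset, ?_⟩, ?_⟩⟩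
        · rw [Finset.card_sdiff_of_subset (Finset.image_subset_image (Finset.subset_univ _)), hC _ hc,
            Finset.card_image_of_injective _ (hinj i), hT i hi]
          omega
        · rw [Finset.disjoint_left]
          intro x hx hxB
          obtain ⟨hx1, hx2⟩ := Finset.mem_sdiff.1 hx
          obtain ⟨j, hj, hxj⟩ := Finset.mem_biUnion.1 hxB
          obtain ⟨a, -, rfl⟩ := Finset.mem_image.1 hx1
          obtain ⟨b, hb, hab⟩ := Finset.mem_image.1 hxj
          obtain ⟨h1, h2⟩ := hcl _ _ _ _ hab
          subst h1
          subst h2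
          exact hx2 hxj
      · obtain ⟨s, hs, hs'⟩ := Finset.exists_subset_card_eq
          (show S * q * r' ≤ (Finset.univ.image (cl i)).card by rw [hC _ hc]; omega)
        refine ⟨s, fun _ => ⟨⟨hs, hs'⟩, ?_⟩⟩
        rw [Finset.disjoint_left]
        intro x hx hxB
        obtain ⟨j, hj, hxj⟩ := Finset.mem_biUnion.1 hxB
        obtain ⟨a, -, rfl⟩ := Finset.mem_image.1 (hs hx)
        obtain ⟨b, hb, hab⟩ := Finset.mem_image.1 hxj
        obtain ⟨h1, -⟩ := hcl _ _ _ _ hab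
        subst h1
        exact hi hj
    · exact ⟨∅, fun h => absurd h hc⟩
  choose s hs using hex
  have h1 := (hCt (S * q * r') s fun c hc => (hs c hc).1).split
  have h2 : Disjoint (C.biUnion s) B := (Finset.disjoint_biUnion_left _ _ _).2 fun c hc =>
    (hs c hc).2
  refine ⟨C.biUnion s ∪ B, h1.union ht h2, ?_⟩
  rw [Finset.card_union_of_disjoint h2, Finset.card_biUnion, Finset.card_biUnion]
  · rw [Finset.sum_const_nat fun c hc => (hs c hc).1.2, Finset.sum_const_nat fun i hi => by
      rw [Finset.card_image_of_injective _ (hinj i), hT i hi]]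
  · intro i _ j _ hij
    rw [Function.onFun, Finset.disjoint_left]
    intro x hx hx'
    obtain ⟨a, -, rfl⟩ := Finset.mem_image.1 hx
    obtain ⟨b, -, hab⟩ := Finset.mem_image.1 hx'
    exact hij (hcl _ _ _ _ hab).1.symm
  · intro c hc c' hc' hcc
    exact Finset.disjoint_of_subset_left (hs c hc).1.1
      (Finset.disjoint_of_subset_right (hs c' hc').1.1 (hdisj c hc c' hc' hcc))

lemma coverable_zero (k l d : ℕ) (μ : ℝ) : Coverable k l d μ 0 := fun r _ =>
  ⟨0, fun W _ _ H _ _ => ⟨∅, Tileable.empty, by simp⟩⟩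

lemma exists_coverable_step {k l d : ℕ} (hdk : d < k) {μ ε1 : ℝ} (hμ : tVal k d l < μ)
    (hμ0 : 0 ≤ μ) (hε1 : 0 < ε1) (hε1' : ε1 ≤ 1) : ∃ S : ℕ, 1 < S ∧ ∀ u : ℝ,
      Coverable k l d μ u → Coverable k l d μ (u + (1 - 2 * ε1 - u) / S) := by
  obtain ⟨S, hS, hbite⟩ := exists_bite hdk hμ hμ0 hε1 hε1'
  refine ⟨S, hS, fun u hu r' hr' => ?_⟩
  obtain ⟨q, hq, n1, hbite⟩ := hbite r' hr'
  have hr0 : 0 < r' * (S * q) := by positivity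
  obtain ⟨n2, hcov⟩ := hu _ hr0
  obtain ⟨n3, hn3⟩ := exists_nat_ge (((r' * (S * q) : ℕ) : ℝ) / ε1)
  refine ⟨n2 + n3 + (n1 + 1) * (r' * (S * q)), ?_⟩
  intro W _ _ H hH hW
  obtain ⟨Z, hZ, hZc⟩ := hcov W H hH (by omega)
  obtain ⟨C, hC1, hC2, hC3, hC4⟩ := hZ.exists_clusters hr0
  obtain ⟨N, cl, hcl, hN, hCcl⟩ := exists_enumeration hr0 C hC1 hC2
  have hN1 : n1 ≤ N := by
    have h1 : (n1 + 1) * (r' * (S * q)) < (N + 1) * (r' * (S * q)) := by omega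
    have := lt_of_mul_lt_mul_right h1 (Nat.zero_le _)
    omega
  obtain ⟨K, T, hK, hT, ht⟩ := hbite W H hH N cl hcl hN1 hN.le
  obtain ⟨Z', hZ', hZc'⟩ := Tileable.exchange hS hC1 hC2 hC4 cl hcl hCcl hT ht
  refine ⟨Z', hZ', ?_⟩
  have hZcard : (Z.card : ℝ) = C.card * ((r' * (S * q) : ℕ) : ℝ) := by
    rw [← hC3, Finset.card_biUnion (t := id) hC2]
    exact_mod_cast Finset.sum_const_nat hC1
  have hSr : (1 : ℝ) < S := by exact_mod_cast hS
  have h1 : (Z'.card : ℝ) * S = C.card * (r' * (S * q) : ℕ) * (S - 1) + K.card * (r' * (S * q) : ℕ) := by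
    rw [hZc']
    push_cast [Nat.cast_sub hS.le]
    ring
  set n : ℝ := (Fintype.card W : ℝ) with hn
  have hN' : n < (N + 1) * ((r' * (S * q) : ℕ) : ℝ) := by
    rw [hn]
    exact_mod_cast hN
  have hrn : ((r' * (S * q) : ℕ) : ℝ) ≤ ε1 * n := by
    rw [div_le_iff₀ hε1] at hn3
    have : (n3 : ℝ) ≤ n := by
      rw [hn]
      exact_mod_cast (by omega : n3 ≤ Fintype.card W)
    nlinarith
  have hrr : (0 : ℝ) < ((r' * (S * q) : ℕ) : ℝ) := by exact_mod_cast hr0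
  generalize ((r' * (S * q) : ℕ) : ℝ) = r at *
  have h2 : (1 - 2 * ε1) * n ≤ K.card * r := by
    have h3 : (1 - ε1) * (N * r) ≤ K.card * r := by nlinarith
    have h4 : (1 - ε1) * ((1 - ε1) * n) ≤ (1 - ε1) * (N * r) :=
      mul_le_mul_of_nonneg_left (by linarith) (by linarith)
    have h5 : 0 ≤ n := by rw [hn]; positivity
    nlinarith [mul_nonneg (mul_nonneg hε1.le hε1.le) h5]
  refine le_of_mul_le_mul_right ?_ (show (0 : ℝ) < S by linarith)
  rw [h1]
  have h3 : (u + (1 - 2 * ε1 - u) / S) * n * S = u * n * (S - 1) + (1 - 2 * ε1) * n := by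
    field_simp
    ring
  rw [h3]
  rw [hZcard] at hZc
  have := mul_le_mul_of_nonneg_right hZc (show (0 : ℝ) ≤ S - 1 by linarith)
  linarith

/-- Almost perfect tilings with blown-up tiles. -/
lemma exists_almost_tiling {k l d : ℕ} (hdk : d < k) {μ ε : ℝ} (hμ : tVal k d l < μ)
    (hμ0 : 0 ≤ μ) (hε : 0 < ε) : Coverable k l d μ (1 - ε) := by
  obtain ⟨ε1, h0, h1, h2⟩ : ∃ ε1 : ℝ, 0 < ε1 ∧ ε1 ≤ 1 ∧ 3 * ε1 ≤ ε :=
    ⟨min 1 (ε / 3), by positivity, min_le_left _ _, by linarith [min_le_right 1 (ε / 3)]⟩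
  obtain ⟨S, hS, hstep⟩ := exists_coverable_step (l := l) hdk hμ hμ0 h0 h1
  have hSr : (1 : ℝ) < S := by exact_mod_cast hS
  have hiter : ∀ j : ℕ, Coverable k l d μ ((1 - 2 * ε1) * (1 - (1 - 1 / (S : ℝ)) ^ j)) := by
    intro j
    induction j with
    | zero => simpa using coverable_zero k l d μ
    | succ j ih =>
      convert hstep _ ih using 1
      rw [pow_succ]
      ring
  have hS1 : 1 / (S : ℝ) < 1 := by
    rw [div_lt_one (by linarith)]
    exact hSr
  have hS0 : 0 < 1 / (S : ℝ) := by positivity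
  obtain ⟨j, hj⟩ := exists_pow_lt_of_lt_one h0 (show 1 - 1 / (S : ℝ) < 1 by linarith)
  intro r hr
  obtain ⟨n0, h⟩ := hiter j r hr
  refine ⟨n0, fun W _ _ H hH hW => ?_⟩
  obtain ⟨Z, hZ, hZc⟩ := h W H hH hW
  refine ⟨Z, hZ, le_trans (mul_le_mul_of_nonneg_right ?_ (Nat.cast_nonneg _)) hZc⟩
  have h3 : 0 ≤ (1 - 1 / (S : ℝ)) ^ j := pow_nonneg (by linarith) _
  nlinarith

end Step

section TilePath

variable {V : Type} [Fintype V] [DecidableEq V]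

/-- Going around a copy of `Y_{k,2l}` repeatedly visits all of its vertices equally often. -/
lemma walk_around {W : Type} [DecidableEq W] {l : ℕ} {e₁ e₂ C₁ C₂ : Finset W}
    (h1 : C₁.card = l) (h2 : C₂.card = l) (hd : Disjoint C₁ C₂) (hC : C₁ ∪ C₂ = e₁ ∩ e₂) (p : ℕ) :
    LWalk l {e₁, e₂} C₁ C₁ (p • (e₁ ∪ e₂).val) := by
  have hsub : ∀ {x}, x ∈ C₁ ∪ C₂ → x ∈ e₁ ∧ x ∈ e₂ := fun hx => by
    rw [hC] at hx
    exact Finset.mem_inter.1 hx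
  have hs1 : C₁ ⊆ e₁ := fun x hx => (hsub (Finset.mem_union_left _ hx)).1
  have hs2 : C₂ ⊆ e₂ := fun x hx => (hsub (Finset.mem_union_right _ hx)).2
  have w1 : LWalk l {e₁, e₂} C₁ C₂ (e₁ \ C₁).val := LWalk.single (by simp) hs1 (fun x hx =>
    Finset.mem_sdiff.2 ⟨(hsub (Finset.mem_union_right _ hx)).1,
      fun h => Finset.disjoint_left.1 hd h hx⟩) h2
  have w2 : LWalk l {e₁, e₂} C₂ C₁ (e₂ \ C₂).val := LWalk.single (by simp) hs2 (fun x hx =>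
    Finset.mem_sdiff.2 ⟨(hsub (Finset.mem_union_left _ hx)).2,
      fun h => Finset.disjoint_left.1 hd hx h⟩) h1
  have h12 : (e₁ \ C₁).val + (e₂ \ C₂).val = (e₁ ∪ e₂).val := by
    have hdd : Disjoint (e₁ \ C₁) (e₂ \ C₂) := by
      rw [Finset.disjoint_left]
      intro x hx hx'
      simp only [Finset.mem_sdiff] at hx hx'
      have : x ∈ C₁ ∪ C₂ := by
        rw [hC]
        exact Finset.mem_inter.2 ⟨hx.1, hx'.1⟩
      rcases Finset.mem_union.1 this with h | h
      · exact hx.2 h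
      · exact hx'.2 h
    rw [← union_val hdd]
    congr 1
    ext x
    simp only [Finset.mem_union, Finset.mem_sdiff]
    constructor
    · rintro (h | h)
      · exact Or.inl h.1
      · exact Or.inr h.1
    · intro h
      by_cases hx1 : x ∈ C₁
      · exact Or.inr ⟨(hsub (Finset.mem_union_left _ hx1)).2,
          fun h => Finset.disjoint_left.1 hd hx1 h⟩
      · by_cases hx2 : x ∈ C₂
        · exact Or.inl ⟨(hsub (Finset.mem_union_right _ hx2)).1, hx1⟩
        · rcases h with h | h
          · exact Or.inl ⟨h, hx1⟩
          · exact Or.inr ⟨h, hx2⟩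
  induction p with
  | zero => simpa using LWalk.nil
  | succ p ih =>
    rw [succ_nsmul, ← h12, ← add_assoc]
    rw [← h12] at ih
    exact (ih.trans w1).trans w2

lemma map_fst_filter {m r p : ℕ} (E : Finset (Fin m)) (D : Fin m → Finset (Fin r))
    (hD : ∀ i ∈ E, (D i).card = p) :
    (Finset.univ.filter fun z : Fin m × Fin r => z.1 ∈ E ∧ z.2 ∈ D z.1).val.map Prod.fst =
      p • E.val := by
  ext i
  rw [Multiset.count_map, Multiset.count_nsmul, ← Finset.filter_val, Finset.card_val,
    Finset.filter_filter]
  by_cases hi : i ∈ E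
  · rw [Multiset.count_eq_one_of_mem E.nodup hi, mul_one, ← hD i hi]
    have : (Finset.univ.filter fun z : Fin m × Fin r => (z.1 ∈ E ∧ z.2 ∈ D z.1) ∧ i = z.1) =
        (D i).image fun a => (i, a) := by
      ext ⟨j, a⟩
      simp only [Finset.mem_filter, Finset.mem_univ, true_and, Finset.mem_image, Prod.mk.injEq]
      constructor
      · rintro ⟨⟨-, h⟩, rfl⟩
        exact ⟨a, h, rfl, rfl⟩
      · rintro ⟨b, hb, rfl, rfl⟩
        exact ⟨⟨hi, hb⟩, rfl⟩
    rw [this, Finset.card_image_of_injective]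
    intro a b hab
    simpa using hab
  · rw [Multiset.count_eq_zero_of_notMem hi, mul_zero, Finset.card_eq_zero,
      Finset.filter_eq_empty_iff]
    rintro ⟨j, a⟩ - ⟨⟨h, -⟩, rfl⟩
    exact hi h

/-- Whatever is removed from a tile outside a small core, most of the rest is spanned by a
path whose ends are fixed in advance. -/
lemma IsTile.exists_path {k l r : ℕ} (hl : 1 ≤ l) (hlk : 2 * l < k) (hr : 2 ≤ r)
    {H : Set (Finset V)} {T : Finset V} (h : IsTile k l r H T) :
    ∃ A B core : Finset V, A.card = l ∧ B.card = l ∧ Disjoint A B ∧ A ∪ B ⊆ core ∧ core ⊆ T ∧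
      core.card ≤ 4 * k ∧ T.card = (2 * k - 2 * l) * r ∧
      ∀ R : Finset V, Disjoint R core → ∃ K : Finset V, K ⊆ T ∧ Disjoint K R ∧
        PathOn l H A B K ∧ (T \ K).card ≤ 2 * k * (1 + (R ∩ T).card) := by
  classical
  obtain ⟨m, e₁, e₂, g, he1, he2, he12, hg, hgH, rfl⟩ := h
  set E := e₁ ∪ e₂ with hE
  have hEc : E.card = 2 * k - 2 * l := by
    have := Finset.card_union_add_card_inter e₁ e₂
    rw [← hE, he1, he2, he12] at this
    omega
  obtain ⟨C₁, hC₁, hC₁l⟩ := Finset.exists_subset_card_eq (show l ≤ (e₁ ∩ e₂).card by omega)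
  have hC₁E : C₁ ⊆ E := fun x hx => Finset.mem_union_left _ (Finset.mem_inter.1 (hC₁ hx)).1
  have hwalk := walk_around (e₁ := e₁) (e₂ := e₂) hC₁l (C₂ := (e₁ ∩ e₂) \ C₁)
    (by rw [Finset.card_sdiff_of_subset hC₁]; omega) Finset.disjoint_sdiff
    (Finset.union_sdiff_of_subset hC₁)
  let f : Fin m × Fin r → V := fun z => g z.1 z.2
  let a0 : Fin r := ⟨0, by omega⟩
  let a1 : Fin r := ⟨1, by omega⟩
  have ha01 : a0 ≠ a1 := by simp [a0, a1]
  have hf : Set.InjOn f {z | z.1 ∈ E} := by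
    rintro ⟨i, a⟩ hi ⟨j, b⟩ hj hab
    obtain ⟨h1, h2⟩ := hg i hi j hj a b hab
    rw [h1, h2]
  have hinj : ∀ s : Finset (Fin m × Fin r), (∀ z ∈ s, z.1 ∈ E) → Set.InjOn f s :=
    fun s hs => hf.mono fun z hz => hs z hz
  set T := E.biUnion fun i => Finset.univ.image (g i) with hT
  have hmemT : ∀ i ∈ E, ∀ a, f (i, a) ∈ T := fun i hi a =>
    Finset.mem_biUnion.2 ⟨i, hi, Finset.mem_image_of_mem _ (Finset.mem_univ a)⟩
  have hTcard : T.card = (2 * k - 2 * l) * r := by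
    rw [hT, Finset.card_biUnion, Finset.sum_const_nat (m := r), hEc]
    · intro i hi
      rw [Finset.card_image_of_injective _ fun a b hab => (hg i hi i hi a b hab).2]
      simp
    · intro i hi j hj hij
      rw [Function.onFun, Finset.disjoint_left]
      intro x hx hx'
      obtain ⟨a, -, rfl⟩ := Finset.mem_image.1 hx
      obtain ⟨b, -, hab⟩ := Finset.mem_image.1 hx'
      exact hij (hg j hj i hi b a hab).1.symm
  let At : Finset (Fin m × Fin r) := C₁.image fun i => (i, a0)
  let Bt : Finset (Fin m × Fin r) := C₁.image fun i => (i, a1)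
  have hAtE : ∀ z ∈ At, z.1 ∈ E := by
    intro z hz
    obtain ⟨i, hi, rfl⟩ := Finset.mem_image.1 hz
    exact hC₁E hi
  have hBtE : ∀ z ∈ Bt, z.1 ∈ E := by
    intro z hz
    obtain ⟨i, hi, rfl⟩ := Finset.mem_image.1 hz
    exact hC₁E hi
  have hpair : ∀ a : Fin r, Function.Injective fun i : Fin m => (i, a) := fun a i j hij => by
    simpa using hij
  have hAB : Disjoint At Bt := by
    rw [Finset.disjoint_left]
    intro z hz hz'
    obtain ⟨i, hi, rfl⟩ := Finset.mem_image.1 hz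
    obtain ⟨j, hj, hij⟩ := Finset.mem_image.1 hz'
    simp only [Prod.mk.injEq] at hij
    exact ha01 hij.2.symm
  have hmapfst : ∀ a : Fin r, (C₁.image fun i => (i, a)).val.map Prod.fst = C₁.val := by
    intro a
    rw [Finset.image_val_of_injOn (hpair a).injOn, Multiset.map_map]
    simp
  have hdisjf : ∀ s t : Finset (Fin m × Fin r), (∀ z ∈ s, z.1 ∈ E) → (∀ z ∈ t, z.1 ∈ E) →
      Disjoint s t → Disjoint (s.image f) (t.image f) := by
    intro s t hs ht hst
    rw [Finset.disjoint_left]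
    intro x hx hx'
    obtain ⟨z, hz, rfl⟩ := Finset.mem_image.1 hx
    obtain ⟨z', hz', hzz⟩ := Finset.mem_image.1 hx'
    rw [hf (ht z' hz') (hs z hz) hzz] at hz'
    exact Finset.disjoint_left.1 hst hz hz'
  let ct : Finset (Fin m × Fin r) := E ×ˢ {a0, a1}
  refine ⟨At.image f, Bt.image f, ct.image f, ?_, ?_, hdisjf _ _ hAtE hBtE hAB, ?_, ?_, ?_,
    hTcard, ?_⟩
  · rw [Finset.card_image_of_injOn (hinj _ hAtE), Finset.card_image_of_injective _ (hpair a0), hC₁l]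
  · rw [Finset.card_image_of_injOn (hinj _ hBtE), Finset.card_image_of_injective _ (hpair a1), hC₁l]
  · rw [← Finset.image_union]
    refine Finset.image_subset_image fun z hz => ?_
    rcases Finset.mem_union.1 hz with hz | hz
    · obtain ⟨i, hi, rfl⟩ := Finset.mem_image.1 hz
      simp [ct, hC₁E hi]
    · obtain ⟨i, hi, rfl⟩ := Finset.mem_image.1 hz
      simp [ct, hC₁E hi]
  · intro x hx
    obtain ⟨⟨i, a⟩, hz, rfl⟩ := Finset.mem_image.1 hx
    exact hmemT i (Finset.mem_product.1 hz).1 a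
  · refine Finset.card_image_le.trans ?_
    rw [Finset.card_product, hEc]
    have := Finset.card_le_two (a := a0) (b := a1)
    calc (2 * k - 2 * l) * ({a0, a1} : Finset (Fin r)).card ≤ (2 * k) * 2 := by gcongr; omega
      _ = 4 * k := by ring
  intro R hR
  set s := (R ∩ T).card with hs
  have hfree : ∀ i, ∃ D : Finset (Fin r), i ∈ E → a1 ∈ D ∧ a0 ∉ D ∧ (∀ a ∈ D, f (i, a) ∉ R) ∧
      D.card = max 1 (r - 1 - s) := by
    intro i
    by_cases hi : i ∈ E
    · set Fr : Finset (Fin r) := (Finset.univ.filter fun a => f (i, a) ∉ R).erase a0 with hFr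
      have ha1 : a1 ∈ Fr := by
        rw [hFr, Finset.mem_erase, Finset.mem_filter]
        refine ⟨ha01.symm, Finset.mem_univ _, fun h => Finset.disjoint_left.1 hR h ?_⟩
        exact Finset.mem_image_of_mem f (by simp [ct, hi])
      have hcard : r - 1 - s ≤ Fr.card := by
        have h1 : (Finset.univ.filter fun a => f (i, a) ∈ R).card ≤ s := by
          rw [hs]
          refine Finset.card_le_card_of_injOn (fun a => f (i, a)) (fun a ha => ?_) ?_
          · have := (Finset.mem_filter.1 ha).2
            exact Finset.mem_inter.2 ⟨this, hmemT i hi a⟩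
          · intro a _ b _ hab
            exact (hg i hi i hi a b hab).2
        have h2 := Finset.card_filter_add_card_filter_not (s := (Finset.univ : Finset (Fin r)))
          (fun a => f (i, a) ∈ R)
        rw [Finset.card_univ, Fintype.card_fin] at h2
        have h3 := Finset.pred_card_le_card_erase
          (s := Finset.univ.filter fun a => f (i, a) ∉ R) (a := a0)
        rw [← hFr] at h3
        omega
      have hpos : 1 ≤ Fr.card := Finset.card_pos.2 ⟨a1, ha1⟩
      obtain ⟨D, hD1, hD2, hD3⟩ := Finset.exists_subsuperset_card_eq (s := {a1}) (t := Fr)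
        (n := max 1 (r - 1 - s)) (by simpa using ha1) (by simp) (by omega)
      refine ⟨D, fun _ => ⟨hD1 (by simp), fun h => ?_, fun a ha => ?_, hD3⟩⟩
      · exact Finset.notMem_erase _ _ (hD2 h)
      · exact (Finset.mem_filter.1 (Finset.mem_of_mem_erase (hD2 ha))).2
    · exact ⟨∅, fun h => absurd h hi⟩
  choose D hD using hfree
  set p := max 1 (r - 1 - s) with hp
  have hp1 : 1 ≤ p := le_max_left _ _
  let X : Finset (Fin m × Fin r) := Finset.univ.filter fun z => z.1 ∈ E ∧ z.2 ∈ D z.1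
  have hXE : ∀ z ∈ X, z.1 ∈ E := fun z hz => (Finset.mem_filter.1 hz).2.1
  have hX : X.val.map Prod.fst = p • E.val := map_fst_filter E D fun i hi => (hD i hi).2.2.2
  have hAX : Disjoint At X := by
    rw [Finset.disjoint_left]
    intro z hz hz'
    obtain ⟨i, hi, rfl⟩ := Finset.mem_image.1 hz
    exact (hD i (hC₁E hi)).2.1 (Finset.mem_filter.1 hz').2.2
  have hBX : Bt ⊆ X := by
    intro z hz
    obtain ⟨i, hi, rfl⟩ := Finset.mem_image.1 hz
    exact Finset.mem_filter.2 ⟨Finset.mem_univ _, hC₁E hi, (hD i (hC₁E hi)).1⟩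
  have hEne : p • E.val ≠ 0 := by
    intro h0
    have := congrArg Multiset.card h0
    rw [Multiset.card_nsmul, Finset.card_val, hEc, Multiset.card_zero] at this
    have h2 : 0 < p * (2 * k - 2 * l) := Nat.mul_pos hp1 (by omega)
    omega
  have hlift := (hwalk p).lift (p := (Prod.fst : Fin m × Fin r → Fin m)) (by omega) hEne
    (hmapfst a0) hX hAX hBX (hmapfst a1)
  have hmap := hlift.map (g := f) (H := H) (by
    rintro e ⟨he1, he2⟩
    have hsub : ∀ z ∈ e, z.1 ∈ E := by
      intro z hz
      have : z.1 ∈ e.image Prod.fst := Finset.mem_image_of_mem _ hz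
      rcases he2 with h | h
      · rw [h] at this
        exact Finset.mem_union_left _ this
      · rw [h] at this
        exact Finset.mem_union_right _ this
    refine ⟨hinj e hsub, ?_⟩
    let σ : Fin m → Fin r := fun i => if h : ∃ a, (i, a) ∈ e then h.choose else a0
    have hσ : e.image f = (e.image Prod.fst).image fun i => g i (σ i) := by
      rw [Finset.image_image]
      refine Finset.image_congr fun z hz => ?_
      have h : ∃ a, (z.1, a) ∈ e := ⟨z.2, hz⟩
      have h1 : σ z.1 = h.choose := dif_pos h
      have h2 : (z.1, σ z.1) = z := he1 (by rw [h1]; exact h.choose_spec) hz rfl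
      change g z.1 z.2 = g z.1 (σ z.1)
      rw [← congrArg Prod.snd h2]
    rw [hσ]
    rcases he2 with h | h
    · rw [h]
      exact (hgH σ).1
    · rw [h]
      exact (hgH σ).2)
  refine ⟨At.image f ∪ X.image f, ?_, ?_, ⟨Finset.subset_union_left, ?_, ?_⟩, ?_⟩
  · rw [← Finset.image_union]
    intro x hx
    obtain ⟨⟨i, a⟩, hz, rfl⟩ := Finset.mem_image.1 hx
    exact hmemT i ((Finset.mem_union.1 hz).elim (hAtE _) (hXE _)) a
  · rw [Finset.disjoint_union_left]
    constructor
    · refine Finset.disjoint_of_subset_left ?_ hR.symm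
      refine Finset.image_subset_image fun z hz => ?_
      obtain ⟨i, hi, rfl⟩ := Finset.mem_image.1 hz
      simp [ct, hC₁E hi]
    · rw [Finset.disjoint_left]
      intro x hx
      obtain ⟨⟨i, a⟩, hz, rfl⟩ := Finset.mem_image.1 hx
      have := (Finset.mem_filter.1 hz).2
      exact (hD i this.1).2.2.1 a this.2
  · rw [Finset.card_image_of_injOn (hinj _ hAtE), Finset.card_image_of_injective _ (hpair a0), hC₁l]
  · rw [Finset.union_sdiff_cancel_left (hdisjf _ _ hAtE hXE hAX),
      Finset.image_val_of_injOn (hinj X hXE)]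
    exact hmap
  · have hXc : X.card = p * (2 * k - 2 * l) := by
      have := congrArg Multiset.card hX
      rw [Multiset.card_map, Multiset.card_nsmul, Finset.card_val, Finset.card_val, hEc] at this
      exact this
    have hXT : X.image f ⊆ T := by
      intro x hx
      obtain ⟨⟨i, a⟩, hz, rfl⟩ := Finset.mem_image.1 hx
      exact hmemT i (hXE _ hz) a
    calc (T \ (At.image f ∪ X.image f)).card ≤ (T \ X.image f).card :=
          Finset.card_le_card (Finset.sdiff_subset_sdiff le_rfl Finset.subset_union_right)
      _ = (2 * k - 2 * l) * r - p * (2 * k - 2 * l) := by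
          rw [Finset.card_sdiff_of_subset hXT, hTcard,
            Finset.card_image_of_injOn (hinj X hXE), hXc]
      _ = (2 * k - 2 * l) * (r - p) := by
          rw [mul_comm p, ← Nat.mul_sub]
      _ ≤ 2 * k * (1 + s) := by
          gcongr
          · omega
          · omega

end TilePath

section Assembly

variable {V : Type} [Fintype V] [DecidableEq V]

lemma IsTile.image {W : Type} [Fintype W] [DecidableEq W] {k l r : ℕ} {H' : Set (Finset W)}
    {H : Set (Finset V)} {T : Finset W} (h : IsTile k l r H' T) {j : W → V}
    (hj : Function.Injective j) (hH : ∀ e ∈ H', e.image j ∈ H) : IsTile k l r H (T.image j) := by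
  obtain ⟨m, e₁, e₂, g, h1, h2, h3, hg, hgH, rfl⟩ := h
  refine ⟨m, e₁, e₂, fun i a => j (g i a), h1, h2, h3,
    fun i hi i' hi' a b hab => hg i hi i' hi' a b (hj hab), fun σ => ?_, ?_⟩
  · have h4 := hH _ (hgH σ).1
    have h5 := hH _ (hgH σ).2
    rw [Finset.image_image] at h4 h5
    exact ⟨h4, h5⟩
  · rw [Finset.biUnion_image]
    refine Finset.biUnion_congr rfl fun i _ => ?_
    rw [Finset.image_image]
    rfl

lemma Tileable.image {W : Type} [Fintype W] [DecidableEq W] {k l r : ℕ} {H' : Set (Finset W)}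
    {H : Set (Finset V)} {Z : Finset W} (h : Tileable k l r H' Z) {j : W → V}
    (hj : Function.Injective j) (hH : ∀ e ∈ H', e.image j ∈ H) :
    Tileable k l r H (Z.image j) := by
  induction h with
  | empty => simpa using Tileable.empty
  | add hZ hT hTZ ih =>
    rw [Finset.image_union]
    exact ih.add (hT.image hj hH) ((Finset.disjoint_image hj).2 hTZ)

lemma Tileable.exists_family {k l r : ℕ} {H : Set (Finset V)} {Z : Finset V}
    (h : Tileable k l r H Z) : ∃ F : Finset (Finset V), (∀ T ∈ F, IsTile k l r H T) ∧
      (∀ T ∈ F, ∀ T' ∈ F, T ≠ T' → Disjoint T T') ∧ F.biUnion id = Z := by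
  induction h with
  | empty => exact ⟨∅, by simp, by simp, by simp⟩
  | @add Z T hZ hT hTZ ih =>
    obtain ⟨F, h1, h2, rfl⟩ := ih
    rw [Finset.disjoint_biUnion_right] at hTZ
    refine ⟨insert T F, ?_, ?_, by rw [Finset.biUnion_insert, id]⟩
    · intro T' hT'
      rcases Finset.mem_insert.1 hT' with rfl | hT'
      · exact hT
      · exact h1 T' hT'
    · intro T₁ hT₁ T₂ hT₂ hne
      rcases Finset.mem_insert.1 hT₁ with h | hT₁ <;> rcases Finset.mem_insert.1 hT₂ with h' | hT₂
      · exact absurd (h.trans h'.symm) hne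
      · rw [h]
        exact hTZ T₂ hT₂
      · rw [h']
        exact (hTZ T₁ hT₁).symm
      · exact h2 T₁ hT₁ T₂ hT₂ hne

lemma DegCond.mono {d k : ℕ} {H : Set (Finset V)} {δ δ' : ℝ} (h : DegCond d k H δ)
    (hδ : δ' ≤ δ) : DegCond d k H δ' :=
  ⟨h.1, fun S hS => (mul_le_mul_of_nonneg_right hδ (by positivity)).trans (h.2 S hS)⟩

/-- Deleting a small set of vertices costs little degree. -/
lemma DegCond.restrict {d k : ℕ} (hdk : d < k) {H : Set (Finset V)} {μ μ' κ : ℝ}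
    (h : DegCond d k H μ') (hμ0 : 0 ≤ μ) {X : Finset V} (hX : (X.card : ℝ) ≤ κ * Fintype.card V)
    (hμ : μ + (k - d : ℕ) * κ ≤ μ') :
    DegCond d k {S : Finset {x // x ∉ X} | S.image Subtype.val ∈ H} μ := by
  classical
  constructor
  · intro e he
    rw [← h.1 _ he, Finset.card_image_of_injective _ Subtype.val_injective]
  intro S hS
  set n : ℝ := (Fintype.card V : ℝ) with hn
  have hn0 : 0 ≤ n := Nat.cast_nonneg _
  have hW : (Fintype.card {x // x ∉ X} : ℝ) ≤ n := by
    rw [hn, Nat.cast_le]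
    exact Fintype.card_subtype_le _
  have hSc : (S.image Subtype.val).card = d := by
    rw [Finset.card_image_of_injective _ Subtype.val_injective, hS]
  have hbad : cnt (fun t : Fin (k - d) → V => ¬ ∀ i, t i ∉ X) ≤ (k - d : ℕ) * κ * n ^ (k - d) := by
    have h1 : cnt (fun t : Fin (k - d) → V => ¬ ∀ i, t i ∉ X) ≤
        ∑ i, cnt fun t : Fin (k - d) → V => t i ∈ X := by
      rw [cnt_congr (Q := fun t : Fin (k - d) → V => ∃ i, t i ∈ X) fun t => by simp]
      exact cnt_exists_le _
    refine h1.trans ?_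
    have h2 : ∀ i ∈ Finset.univ, cnt (fun t : Fin (k - d) → V => t i ∈ X) ≤ κ * n ^ (k - d) := by
      intro i _
      have h3 := cnt_mem_coord_mul_le (V := V) i X
      rw [Fintype.card_fin, ← hn] at h3
      rcases hn0.eq_or_lt with h0 | h0
      · have : IsEmpty V := by
          rw [← Fintype.card_eq_zero_iff]
          rw [hn] at h0
          exact_mod_cast h0.symm
        rw [← h0, zero_pow (by omega), mul_zero, cnt]
        have : IsEmpty {t : Fin (k - d) → V // t i ∈ X} := ⟨fun t => isEmptyElim (t.1 i)⟩
        simp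
      · refine le_of_mul_le_mul_right (h3.trans ?_) h0
        calc (X.card : ℝ) * n ^ (k - d) ≤ κ * n * n ^ (k - d) := by gcongr
          _ = κ * n ^ (k - d) * n := by ring
    refine (Finset.sum_le_card_nsmul _ _ _ h2).trans (le_of_eq ?_)
    rw [Finset.card_univ, Fintype.card_fin, nsmul_eq_mul]
    ring
  have hgood := cnt_and_ge (fun t : Fin (k - d) → V =>
    S.image Subtype.val ∪ Finset.univ.image t ∈ H) fun t => ∀ i, t i ∉ X
  have hmain := h.2 _ hSc
  rw [← hn] at hmain
  have htrans : cnt (fun t : Fin (k - d) → V =>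
      S.image Subtype.val ∪ Finset.univ.image t ∈ H ∧ ∀ i, t i ∉ X) ≤
      cnt (fun t : Fin (k - d) → {x // x ∉ X} => S ∪ Finset.univ.image t ∈
        {S : Finset {x // x ∉ X} | S.image Subtype.val ∈ H}) := by
    rw [cnt, cnt, Nat.cast_le]
    refine Nat.card_le_card_of_injective
      (fun t => ⟨fun i => ⟨t.1 i, t.2.2 i⟩, ?_⟩) ?_
    · change (S ∪ _).image _ ∈ H
      rw [Finset.image_union, Finset.image_image]
      exact t.2.1
    · intro t t' htt
      ext i
      have h5 := congrFun (congrArg Subtype.val htt) i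
      exact congrArg Subtype.val h5
  have hpow : μ * (Fintype.card {x // x ∉ X} : ℝ) ^ (k - d) ≤ μ * n ^ (k - d) := by gcongr
  have hfin : μ * n ^ (k - d) + (k - d : ℕ) * κ * n ^ (k - d) ≤ μ' * n ^ (k - d) := by
    rw [← add_mul]
    exact mul_le_mul_of_nonneg_right hμ (by positivity)
  linarith

end Assembly

section Closing

variable {V : Type} [Fintype V] [DecidableEq V]

/-- Connect the absorbing path and the paths of a family of tiles into a closed walk, and absorb
what is left over. -/
lemma exists_closed_walk_of_tiles {k l r c0 : ℕ} (hl : 1 ≤ l) (hlk : 2 * l < k) (hr : 2 ≤ r)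
    {L M : ℝ} {H : Set (Finset V)} (hHk : ∀ e ∈ H, e.card = k)
    (hconn : ∀ A B F : Finset V, A.card = l → B.card = l → Disjoint A B → (F.card : ℝ) ≤ L →
      ∃ R : Finset V, Disjoint R F ∧ Disjoint R A ∧ Disjoint R B ∧ R.card ≤ c0 ∧
        LWalk l H A B (R ∪ B).val)
    {A₀ B₀ X : Finset V} (hA₀ : A₀.card = l) (hB₀ : B₀.card = l) (hAB₀ : Disjoint A₀ B₀)
    (habs : ∀ U : Finset V, Disjoint U X → (k - l) ∣ U.card → (U.card : ℝ) ≤ M →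
      PathOn l H A₀ B₀ (X ∪ U))
    {F : Finset (Finset V)} (hF : ∀ T ∈ F, IsTile k l r H T)
    (hFd : ∀ T ∈ F, ∀ T' ∈ F, T ≠ T' → Disjoint T T') (hFX : ∀ T ∈ F, Disjoint T X)
    (hdvd : (k - l) ∣ Fintype.card V)
    (hL : (X.card : ℝ) + 4 * k * F.card + c0 * (F.card + 1) ≤ L)
    (hM : ((Finset.univ \ (X ∪ F.biUnion id)).card : ℝ) +
      2 * k * (F.card + c0 * (F.card + 2)) ≤ M) :
    ∃ A : Finset V, A.card = l ∧ LWalk l H A A Finset.univ.val := by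
  classical
  have hM0 : 0 ≤ M := le_trans (by positivity) hM
  have hX₀ : PathOn l H A₀ B₀ X := by
    have := habs ∅ (Finset.disjoint_empty_left X) (by simp) (by simpa using hM0)
    rwa [Finset.union_empty] at this
  have htile : ∀ T : Finset V, ∃ A B core : Finset V, T ∈ F → A.card = l ∧ B.card = l ∧
      Disjoint A B ∧ A ∪ B ⊆ core ∧ core ⊆ T ∧ core.card ≤ 4 * k ∧
      ∀ R : Finset V, Disjoint R core → ∃ K : Finset V, K ⊆ T ∧ Disjoint K R ∧
        PathOn l H A B K ∧ (T \ K).card ≤ 2 * k * (1 + (R ∩ T).card) := by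
    intro T
    by_cases hT : T ∈ F
    · obtain ⟨A, B, core, h1, h2, h3, h4, h5, h6, -, h7⟩ := (hF T hT).exists_path hl hlk hr
      exact ⟨A, B, core, fun _ => ⟨h1, h2, h3, h4, h5, h6, h7⟩⟩
    · exact ⟨∅, ∅, ∅, fun h => absurd h hT⟩
  choose At Bt ct ht using htile
  have hAtT : ∀ T ∈ F, At T ⊆ T := fun T hT =>
    (Finset.subset_union_left.trans (ht T hT).2.2.2.1).trans (ht T hT).2.2.2.2.1
  have hBtT : ∀ T ∈ F, Bt T ⊆ T := fun T hT =>
    (Finset.subset_union_right.trans (ht T hT).2.2.2.1).trans (ht T hT).2.2.2.2.1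
  let A : Option (Finset V) → Finset V := fun o => o.elim A₀ At
  let B : Option (Finset V) → Finset V := fun o => o.elim B₀ Bt
  let I : Finset (Option (Finset V)) := Finset.insertNone F
  have hIc : I.card = F.card + 1 := Finset.card_insertNone F
  set G : Finset V := X ∪ F.biUnion ct with hG
  have hGc : (G.card : ℝ) ≤ X.card + 4 * k * F.card := by
    have h1 : (F.biUnion ct).card ≤ F.card * (4 * k) :=
      Finset.card_biUnion_le_card_mul _ _ _ fun T hT => (ht T hT).2.2.2.2.2.1
    have h2 : G.card ≤ X.card + 4 * k * F.card :=
      (Finset.card_union_le _ _).trans (by rw [mul_comm (4 * k)]; omega)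
    exact_mod_cast h2
  have hAc : ∀ i ∈ I, (A i).card = l := by
    rintro (_ | T) hi
    · exact hA₀
    · exact (ht T (Finset.some_mem_insertNone.1 hi)).1
  have hBc : ∀ i ∈ I, (B i).card = l := by
    rintro (_ | T) hi
    · exact hB₀
    · exact (ht T (Finset.some_mem_insertNone.1 hi)).2.1
  have hAB : ∀ i ∈ I, ∀ j ∈ I, Disjoint (A i) (B j) := by
    rintro (_ | T) hi (_ | T') hj
    · exact hAB₀
    · have hT' := Finset.some_mem_insertNone.1 hj
      exact Finset.disjoint_of_subset_left hX₀.1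
        (Finset.disjoint_of_subset_right (hBtT T' hT') (hFX T' hT').symm)
    · have hT := Finset.some_mem_insertNone.1 hi
      exact Finset.disjoint_of_subset_left (hAtT T hT)
        (Finset.disjoint_of_subset_right hX₀.end_subset (hFX T hT))
    · have hT := Finset.some_mem_insertNone.1 hi
      have hT' := Finset.some_mem_insertNone.1 hj
      by_cases h : T = T'
      · subst h
        exact (ht T hT).2.2.1
      · exact Finset.disjoint_of_subset_left (hAtT T hT)
          (Finset.disjoint_of_subset_right (hBtT T' hT') (hFd T hT T' hT' h))
  obtain ⟨i0, hi0, i1, hi1, R, hRG, hRc, hchain⟩ := exists_chain hconn (A := A) (B := B) (F := G)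
    (I := I) ⟨none, Finset.none_mem_insertNone⟩ hAc hBc hAB (by
      rw [hIc]
      push_cast
      linarith)
  obtain ⟨R2, hR2, hR2B, hR2A, hR2c, hR2w⟩ := hconn (B i1) (A i0) (G ∪ R) (hBc i1 hi1)
    (hAc i0 hi0) (hAB i0 hi0 i1 hi1).symm (by
      have h1 : ((G ∪ R).card : ℝ) ≤ G.card + R.card := by
        exact_mod_cast Finset.card_union_le G R
      have h2 : (R.card : ℝ) ≤ c0 * (F.card + 1) := by
        rw [hIc] at hRc
        exact_mod_cast hRc
      linarith)
  rw [Finset.disjoint_union_right] at hR2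
  have hRX : Disjoint R X := Finset.disjoint_of_subset_right Finset.subset_union_left hRG
  have hR2X : Disjoint R2 X := Finset.disjoint_of_subset_right Finset.subset_union_left hR2.1
  have hcore : ∀ T ∈ F, Disjoint (R ∪ R2) (ct T) := by
    intro T hT
    have h1 : ct T ⊆ G :=
      (Finset.subset_biUnion_of_mem ct hT).trans Finset.subset_union_right
    exact Finset.disjoint_union_left.2 ⟨Finset.disjoint_of_subset_right h1 hRG,
      Finset.disjoint_of_subset_right h1 hR2.1⟩
  have hK : ∀ T : Finset V, ∃ K : Finset V, T ∈ F → K ⊆ T ∧ Disjoint K (R ∪ R2) ∧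
      PathOn l H (At T) (Bt T) K ∧ (T \ K).card ≤ 2 * k * (1 + ((R ∪ R2) ∩ T).card) := by
    intro T
    by_cases hT : T ∈ F
    · obtain ⟨K, hK⟩ := (ht T hT).2.2.2.2.2.2 _ (hcore T hT)
      exact ⟨K, fun _ => hK⟩
    · exact ⟨∅, fun h => absurd h hT⟩
  choose KT hKT using hK
  set Y : Finset V := X ∪ F.biUnion KT ∪ R ∪ R2 with hY
  have hwalk : ∀ U : Finset V, Disjoint U Y → (k - l) ∣ U.card → (U.card : ℝ) ≤ M →
      LWalk l H (A i0) (A i0) (U ∪ Y).val := by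
    intro U hUY hUd hUM
    rw [hY, Finset.disjoint_union_right, Finset.disjoint_union_right,
      Finset.disjoint_union_right, Finset.disjoint_biUnion_right] at hUY
    obtain ⟨⟨⟨hUX, hUK⟩, hUR⟩, hUR2⟩ := hUY
    let K : Option (Finset V) → Finset V := fun o => o.elim (X ∪ U) KT
    have hKp : ∀ i ∈ I, PathOn l H (A i) (B i) (K i) := by
      rintro (_ | T) hi
      · exact habs U hUX hUd hUM
      · exact (hKT T (Finset.some_mem_insertNone.1 hi)).2.2.1
    have hXT : ∀ T ∈ F, Disjoint (X ∪ U) (KT T) := fun T hT =>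
      Finset.disjoint_union_left.2
        ⟨Finset.disjoint_of_subset_right (hKT T hT).1 (hFX T hT).symm, hUK T hT⟩
    have hKd : ∀ i ∈ I, ∀ j ∈ I, i ≠ j → Disjoint (K i) (K j) := by
      rintro (_ | T) hi (_ | T') hj hij
      · exact absurd rfl hij
      · exact hXT T' (Finset.some_mem_insertNone.1 hj)
      · exact (hXT T (Finset.some_mem_insertNone.1 hi)).symm
      · have hT := Finset.some_mem_insertNone.1 hi
        have hT' := Finset.some_mem_insertNone.1 hj
        exact Finset.disjoint_of_subset_left (hKT T hT).1
          (Finset.disjoint_of_subset_right (hKT T' hT').1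
            (hFd T hT T' hT' fun h => hij (by rw [h])))
    have hKR : ∀ i ∈ I, Disjoint (K i) (R ∪ R2) := by
      rintro (_ | T) hi
      · exact Finset.disjoint_union_left.2 ⟨Finset.disjoint_union_right.2 ⟨hRX.symm, hR2X.symm⟩,
          Finset.disjoint_union_right.2 ⟨hUR, hUR2⟩⟩
      · exact (hKT T (Finset.some_mem_insertNone.1 hi)).2.1
    have hpath := hchain K hKp hKd fun i hi => (Finset.disjoint_union_right.1 (hKR i hi)).1
    have hclosed := hpath.close hR2w (by
      rw [Finset.disjoint_union_left, Finset.disjoint_biUnion_left]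
      exact ⟨fun i hi => (Finset.disjoint_union_right.1 (hKR i hi)).2, hR2.2.symm⟩)
    convert hclosed using 2
    ext x
    simp only [hY, I, K, Finset.mem_union, Finset.mem_biUnion, Finset.mem_insertNone,
      Option.exists, Option.elim, Option.mem_def]
    constructor
    · rintro (h | (((h | ⟨T, hT, h⟩) | h) | h))
      · exact Or.inl (Or.inl (Or.inl ⟨by simp, Or.inr h⟩))
      · exact Or.inl (Or.inl (Or.inl ⟨by simp, Or.inl h⟩))
      · exact Or.inl (Or.inl (Or.inr ⟨T, by simpa using hT, h⟩))
      · exact Or.inl (Or.inr h)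
      · exact Or.inr h
    · rintro (((⟨-, h | h⟩ | ⟨T, hT, h⟩) | h) | h)
      · exact Or.inr (Or.inl (Or.inl (Or.inl h)))
      · exact Or.inl h
      · exact Or.inr (Or.inl (Or.inl (Or.inr ⟨T, by simpa using hT, h⟩)))
      · exact Or.inr (Or.inl (Or.inr h))
      · exact Or.inr (Or.inr h)
  have hYd : (k - l) ∣ Y.card := by
    have h1 := hwalk ∅ (Finset.disjoint_empty_left _) (by simp) (by simpa using hM0)
    rw [Finset.empty_union] at h1
    exact h1.dvd_card hHk (hAc i0 hi0)
  refine ⟨A i0, hAc i0 hi0, ?_⟩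
  have hfin := hwalk (Finset.univ \ Y) Finset.sdiff_disjoint (by
    rw [Finset.card_sdiff_of_subset (Finset.subset_univ _), Finset.card_univ]
    exact Nat.dvd_sub hdvd hYd) ?_
  · rwa [Finset.sdiff_union_of_subset (Finset.subset_univ _)] at hfin
  have hsub : Finset.univ \ Y ⊆
      (Finset.univ \ (X ∪ F.biUnion id)) ∪ F.biUnion fun T => T \ KT T := by
    intro x hx
    have hx := (Finset.mem_sdiff.1 hx).2
    by_cases hxF : x ∈ F.biUnion id
    · obtain ⟨T, hT, hxT⟩ := Finset.mem_biUnion.1 hxF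
      refine Finset.mem_union_right _ (Finset.mem_biUnion.2 ⟨T, hT, Finset.mem_sdiff.2 ⟨hxT, ?_⟩⟩)
      intro hxK
      exact hx (Finset.mem_union_left _ (Finset.mem_union_left _
        (Finset.mem_union_right _ (Finset.mem_biUnion.2 ⟨T, hT, hxK⟩))))
    · refine Finset.mem_union_left _ (Finset.mem_sdiff.2 ⟨Finset.mem_univ _, ?_⟩)
      intro hxX
      rcases Finset.mem_union.1 hxX with h | h
      · exact hx (Finset.mem_union_left _ (Finset.mem_union_left _ (Finset.mem_union_left _ h)))
      · exact hxF h
  have hloss : (F.biUnion fun T => T \ KT T).card ≤ 2 * k * (F.card + c0 * (F.card + 2)) := by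
    have h1 : (F.biUnion fun T => T \ KT T).card ≤
        ∑ T ∈ F, 2 * k * (1 + ((R ∪ R2) ∩ T).card) :=
      Finset.card_biUnion_le.trans (Finset.sum_le_sum fun T hT => (hKT T hT).2.2.2)
    have h2 : ∑ T ∈ F, ((R ∪ R2) ∩ T).card ≤ (R ∪ R2).card := by
      rw [← Finset.card_biUnion]
      · refine Finset.card_le_card (Finset.biUnion_subset.2 fun T _ => Finset.inter_subset_left)
      · intro T hT T' hT' hne
        exact Finset.disjoint_of_subset_left Finset.inter_subset_right
          (Finset.disjoint_of_subset_right Finset.inter_subset_right (hFd T hT T' hT' hne))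
    have h3 : (R ∪ R2).card ≤ c0 * (F.card + 2) := by
      refine (Finset.card_union_le _ _).trans ?_
      rw [hIc] at hRc
      calc R.card + R2.card ≤ c0 * (F.card + 1) + c0 := add_le_add hRc hR2c
        _ = c0 * (F.card + 2) := by ring
    refine h1.trans ?_
    rw [← Finset.mul_sum, Finset.sum_add_distrib, Finset.sum_const, smul_eq_mul, mul_one]
    exact Nat.mul_le_mul_left _ (add_le_add le_rfl (h2.trans h3))
  refine le_trans ?_ hM
  have h4 := (Finset.card_le_card hsub).trans (Finset.card_union_le _ _)
  have h5 : (Finset.univ \ Y).card ≤ (Finset.univ \ (X ∪ F.biUnion id)).card +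
      2 * k * (F.card + c0 * (F.card + 2)) := h4.trans (add_le_add le_rfl hloss)
  exact_mod_cast h5

end Closing

lemma exists_closed_walk {k l d : ℕ} (hl : 1 ≤ l) (hlk : 2 * l < k) (hld : l < d)
    (hdk : d ≤ k - 1) {μ μ' : ℝ} (hμ : tVal k d l < μ) (hμ0 : 0 < μ) (hμμ : μ < μ') :
    ∃ n0 : ℕ, ∀ (V : Type) [Fintype V] [DecidableEq V] (H : Set (Finset V)),
      DegCond d k H μ' → n0 ≤ Fintype.card V → (k - l) ∣ Fintype.card V →
      ∃ A : Finset V, A.card = l ∧ LWalk l H A A Finset.univ.val := by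
  classical
  have hdk' : d < k := by omega
  have hδ0 : 0 < min μ 1 := lt_min hμ0 one_pos
  obtain ⟨γ, c0, n1, hγ, hconn⟩ := exists_connector hl hlk hld hdk hδ0 (min_le_right _ _)
  obtain ⟨κ, hκ0, hκγ, hκμ, hκ2⟩ : ∃ κ : ℝ, 0 < κ ∧ κ ≤ γ / 4 ∧ k * κ ≤ μ' - μ ∧ κ ≤ 1 / 2 := by
    have hk0 : (0 : ℝ) < k := by
      exact_mod_cast (by omega : 0 < k)
    refine ⟨min (γ / 4) (min ((μ' - μ) / k) (1 / 2)), lt_min (by positivity)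
      (lt_min (div_pos (by linarith) hk0) (by norm_num)), min_le_left _ _, ?_,
      (min_le_right _ _).trans (min_le_right _ _)⟩
    calc k * min (γ / 4) (min ((μ' - μ) / k) (1 / 2)) ≤ k * ((μ' - μ) / k) := by
          gcongr
          exact (min_le_right _ _).trans (min_le_left _ _)
      _ = μ' - μ := by field_simp
  obtain ⟨ξ, hξ, n2, habs⟩ := exists_absorbing_path hl hlk hld hdk hδ0 (min_le_right _ _) hκ0
  set D : ℝ := 4 * k + c0 + 2 * k * (1 + c0) with hD
  have hD0 : 0 ≤ D := by positivity
  set σ : ℝ := min γ ξ / 2 with hσ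
  have hσ0 : 0 < σ := by positivity
  have hσγ : σ ≤ γ / 2 := by
    have := min_le_left γ ξ
    linarith
  have hσξ : σ ≤ ξ / 2 := by
    have := min_le_right γ ξ
    linarith
  obtain ⟨r, hr⟩ := exists_nat_ge (max 2 (2 * D / σ))
  have hr2 : 2 ≤ r := by exact_mod_cast (le_max_left _ _).trans hr
  have hrD : 2 * D ≤ σ * r := by
    have := (le_max_right _ _).trans hr
    rw [div_le_iff₀ hσ0] at this
    linarith
  obtain ⟨n3, hcov⟩ := exists_almost_tiling hdk' hμ hμ0.le (half_pos hξ) r (by omega)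
  obtain ⟨n4, hn4⟩ := exists_nat_ge (4 * D / σ)
  refine ⟨max (max n1 n2) (max (2 * n3) n4), fun V _ _ H hH hV hdvd => ?_⟩
  have hV1 : n1 ≤ Fintype.card V := by omega
  have hV2 : n2 ≤ Fintype.card V := by omega
  have hV3 : 2 * n3 ≤ Fintype.card V := by omega
  have hV4 : n4 ≤ Fintype.card V := by omega
  set n : ℝ := (Fintype.card V : ℝ) with hn
  have hn0 : 0 ≤ n := Nat.cast_nonneg _
  have hHδ : DegCond d k H (min μ 1) := hH.mono ((min_le_left _ _).trans hμμ.le)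
  obtain ⟨A₀, B₀, X, hA₀, hB₀, hAB₀, hXc, hX⟩ := habs V H hHδ hV2
  have hHW := hH.restrict hdk' hμ0.le hXc (by
    have : ((k - d : ℕ) : ℝ) * κ ≤ k * κ := by
      gcongr
      omega
    linarith)
  have hWc : (Fintype.card {x // x ∉ X} : ℝ) = n - X.card := by
    have h1 : Fintype.card {x // x ∉ X} = Fintype.card V - X.card := by
      rw [Fintype.card_subtype_compl, Fintype.card_coe]
    rw [h1, Nat.cast_sub (Finset.card_le_univ X)]
  have hW3 : n3 ≤ Fintype.card {x // x ∉ X} := by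
    have h1 : (2 : ℝ) * n3 ≤ n := by
      rw [hn]
      exact_mod_cast hV3
    have h2 : (n3 : ℝ) ≤ Fintype.card {x // x ∉ X} := by
      rw [hWc]
      have : κ * n ≤ 1 / 2 * n := mul_le_mul_of_nonneg_right hκ2 hn0
      linarith
    exact_mod_cast h2
  obtain ⟨Z, hZ, hZc⟩ := hcov _ _ hHW hW3
  have hval : Function.Injective (Subtype.val : {x // x ∉ X} → V) := Subtype.val_injective
  obtain ⟨F, hF, hFd, hFZ⟩ := (hZ.image (H := H) hval fun e he => he).exists_family
  have hFX : ∀ T ∈ F, Disjoint T X := by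
    intro T hT
    have h1 : T ⊆ Z.image Subtype.val := by
      rw [← hFZ]
      exact Finset.subset_biUnion_of_mem id hT
    refine Finset.disjoint_of_subset_left h1 (Finset.disjoint_left.2 fun x hx => ?_)
    obtain ⟨y, -, rfl⟩ := Finset.mem_image.1 hx
    exact y.2
  have hqr : (F.card : ℝ) * r ≤ n := by
    have h1 : F.card * r ≤ (F.biUnion id).card := by
      rw [Finset.card_biUnion (t := id) hFd]
      refine (Finset.card_nsmul_le_sum F _ r fun T hT => ?_)
      obtain ⟨-, -, -, -, -, -, -, -, -, h, -⟩ := (hF T hT).exists_path hl hlk hr2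
      rw [id, h]
      exact Nat.le_mul_of_pos_left r (by omega)
    rw [hn]
    exact_mod_cast h1.trans (Finset.card_le_univ _)
  have hDq : D * (F.card + 2) ≤ σ * n := by
    have h1 : 2 * D * F.card ≤ σ * n := by
      calc 2 * D * F.card ≤ σ * r * F.card :=
            mul_le_mul_of_nonneg_right hrD (Nat.cast_nonneg _)
        _ = σ * (F.card * r) := by ring
        _ ≤ σ * n := mul_le_mul_of_nonneg_left hqr hσ0.le
    have h2 : 4 * D ≤ σ * n := by
      rw [div_le_iff₀ hσ0] at hn4
      have h3 : (n4 : ℝ) ≤ n := by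
        rw [hn]
        exact_mod_cast hV4
      have h4 := mul_le_mul_of_nonneg_right h3 hσ0.le
      linarith
    linarith
  have hq0 : (0 : ℝ) ≤ F.card := Nat.cast_nonneg _
  have hk0 : (0 : ℝ) ≤ k := Nat.cast_nonneg _
  have hc0 : (0 : ℝ) ≤ c0 := Nat.cast_nonneg _
  refine exists_closed_walk_of_tiles hl hlk hr2 (L := γ * n) (M := ξ * n) hH.1
    (fun A B F => hconn V H hHδ hV1 A B F) hA₀ hB₀ hAB₀ hX hF hFd hFX hdvd ?_ ?_
  · have h1 : 4 * k * F.card + c0 * (F.card + 1) ≤ D * ((F.card : ℝ) + 2) := by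
      rw [hD, ← sub_nonneg]
      ring_nf
      positivity
    have h2 : κ * n ≤ γ / 4 * n := mul_le_mul_of_nonneg_right hκγ hn0
    have h3 : σ * n ≤ γ / 2 * n := mul_le_mul_of_nonneg_right hσγ hn0
    have h4 : 0 ≤ γ * n := mul_nonneg hγ.le hn0
    linarith
  · have h1 : 2 * k * (F.card + c0 * (F.card + 2)) ≤ D * ((F.card : ℝ) + 2) := by
      rw [hD, ← sub_nonneg]
      ring_nf
      positivity
    have h2 : σ * n ≤ ξ / 2 * n := mul_le_mul_of_nonneg_right hσξ hn0
    have h3 : (Finset.univ \ (X ∪ F.biUnion id)) ⊆ (Finset.univ \ Z).image Subtype.val := by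
      intro x hx
      rw [hFZ, Finset.mem_sdiff, Finset.mem_union, not_or] at hx
      exact Finset.mem_image.2 ⟨⟨x, hx.2.1⟩, Finset.mem_sdiff.2 ⟨Finset.mem_univ _, fun h =>
        hx.2.2 (Finset.mem_image_of_mem _ h)⟩, rfl⟩
    have h4 : ((Finset.univ \ (X ∪ F.biUnion id)).card : ℝ) ≤
        (Fintype.card {x // x ∉ X} : ℝ) - Z.card := by
      have h5 := (Finset.card_le_card h3).trans Finset.card_image_le
      rw [Finset.card_sdiff_of_subset (Finset.subset_univ Z), Finset.card_univ] at h5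
      rw [← Nat.cast_sub (Finset.card_le_univ Z)]
      exact_mod_cast h5
    have h6 : ξ / 2 * (Fintype.card {x // x ∉ X} : ℝ) ≤ ξ / 2 * n := by
      refine mul_le_mul_of_nonneg_left ?_ (half_pos hξ).le
      rw [hWc]
      linarith [(Nat.cast_nonneg X.card : (0 : ℝ) ≤ X.card)]
    linarith

/-- The minimum degree condition, for tuples in place of sets. -/
lemma exists_degCond (k d : ℕ) {μ μ' : ℝ} (hμ : μ < μ') :
    ∃ n0 : ℕ, ∀ n, n0 ≤ n → ∀ H : Finset (Finset (Fin n)), IsKGraph n k H →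
      μ' * (n.choose (k - d) : ℝ) ≤ minDeg n k d H → DegCond d k (↑H : Set (Finset (Fin n))) μ := by
  classical
  obtain ⟨n0, hn0⟩ : ∃ n0 : ℕ, ∀ n, n0 ≤ n →
      μ * (n : ℝ) ^ (k - d) ≤ μ' * ((k - d).factorial * (n.choose (k - d) : ℝ)) := by
    obtain ⟨φ, hφ, hEq⟩ := (isEquivalent_choose (k - d)).exists_eq_mul
    have h1 : ∀ᶠ n in Filter.atTop, μ < μ' * φ n :=
      (tendsto_const_nhds.mul hφ).eventually_const_lt (by rwa [mul_one])
    obtain ⟨n0, hn0⟩ := Filter.eventually_atTop.1 (h1.and hEq)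
    refine ⟨n0, fun n hn => ?_⟩
    obtain ⟨h2, h3⟩ := hn0 n hn
    have h3 : (n.choose (k - d) : ℝ) = φ n * ((n : ℝ) ^ (k - d) / (k - d).factorial) := h3
    rw [h3]
    have h4 : ((k - d).factorial : ℝ) ≠ 0 := by exact_mod_cast (k - d).factorial_ne_zero
    calc μ * (n : ℝ) ^ (k - d) ≤ μ' * φ n * (n : ℝ) ^ (k - d) := by gcongr
      _ = μ' * ((k - d).factorial * (φ n * ((n : ℝ) ^ (k - d) / (k - d).factorial))) := by
        field_simp
  refine ⟨n0, fun n hn H hH hdeg => ⟨fun e he => hH e he, fun S hS => ?_⟩⟩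
  rw [Fintype.card_fin]
  refine (hn0 n hn).trans ?_
  have h1 : (hDeg n k H S : ℝ) = cnt (fun T : Finset (Fin n) => T.card = k - d ∧
      (Disjoint S T ∧ S ∪ T ∈ H)) := by
    rw [hDeg, hS, cnt]
  have h2 : (minDeg n k d H : ℝ) ≤ hDeg n k H S := by exact_mod_cast minDeg_le H hS
  calc μ' * ((k - d).factorial * (n.choose (k - d) : ℝ))
      = (k - d).factorial * (μ' * (n.choose (k - d) : ℝ)) := by ring
    _ ≤ (k - d).factorial * (hDeg n k H S : ℝ) := by
        gcongr
        exact hdeg.trans h2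
    _ = cnt (fun t : Fin (k - d) → Fin n => Function.Injective t ∧
          (Disjoint S (Finset.univ.image t) ∧ S ∪ Finset.univ.image t ∈ H)) := by
        rw [h1]
        exact (cnt_tuple (k - d) fun T => Disjoint S T ∧ S ∪ T ∈ H).symm
    _ ≤ _ := cnt_mono fun t ht => ht.2.2

end LCycle

/-- For `η > 0`, `k ≥ 3`, `1 ≤ ℓ < k/2` and `ℓ < d ≤ k-1`, every
sufficiently large `k`-graph `H` with `(k-ℓ) ∣ n` and
`δ_d(H) ≥ (max{t(k,d,ℓ), 1/3} + η) C(n, k-d)` contains a Hamilton `ℓ`-cycle; consequently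
`h_d^ℓ(k) ≤ max{t(k,d,ℓ), 1/3}`. -/
theorem hamilton_from_tiling_threshold (η : ℝ) (hη : 0 < η) (k l d : ℕ)
    (hk : 3 ≤ k) (hl : 1 ≤ l) (hlk : 2 * l < k) (hld : l < d) (hdk : d ≤ k - 1) :
    (∃ n₀ : ℕ, ∀ n : ℕ, n₀ ≤ n → (k - l) ∣ n →
      ∀ H : Finset (Finset (Fin n)), IsKGraph n k H →
        (max (tVal k d l) (1 / 3) + η) * (n.choose (k - d) : ℝ) ≤ (minDeg n k d H : ℝ) →
        HasHamiltonCycle n k l H) ∧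
    hVal k d l ≤ max (tVal k d l) (1 / 3) := by
  set M : ℝ := max (tVal k d l) (1 / 3) with hM
  have hMt : tVal k d l ≤ M := le_max_left _ _
  have hM3 : 1 / 3 ≤ M := le_max_right _ _
  have main : ∀ η : ℝ, 0 < η → ∃ n₀ : ℕ, ∀ n : ℕ, n₀ ≤ n → (k - l) ∣ n →
      ∀ H : Finset (Finset (Fin n)), IsKGraph n k H →
        (M + η) * (n.choose (k - d) : ℝ) ≤ (minDeg n k d H : ℝ) → HasHamiltonCycle n k l H := by
    intro η hη
    obtain ⟨n1, hn1⟩ := LCycle.exists_closed_walk hl hlk hld hdk (μ := M + η / 4)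
      (μ' := M + η / 2) (by linarith) (by linarith) (by linarith)
    obtain ⟨n2, hn2⟩ := LCycle.exists_degCond k d (show M + η / 2 < M + η by linarith)
    refine ⟨max n1 n2, fun n hn hdvd H hH hdeg => ?_⟩
    obtain ⟨A, hA, hw⟩ := hn1 (Fin n) H (hn2 n ((le_max_right _ _).trans hn) H hH hdeg)
      (by rw [Fintype.card_fin]; exact (le_max_left _ _).trans hn) (by rwa [Fintype.card_fin])
    exact LCycle.hasHamiltonCycle_of_closed_walk hl hlk.le hH hA hw
  refine ⟨main η hη, le_of_forall_pos_le_add fun ε hε => ?_⟩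
  obtain ⟨n₀, hn₀⟩ := main (ε / 2) (half_pos hε)
  obtain ⟨n1, hn1⟩ := exists_nat_ge (2 / ε)
  have hfreq : (Filter.atTop ⊓ Filter.principal {m : ℕ | (k - l) ∣ m}).NeBot := by
    rw [← Filter.frequently_mem_iff_neBot, Filter.frequently_atTop]
    exact fun a => ⟨(k - l) * a, Nat.le_mul_of_pos_left a (by omega), dvd_mul_right _ _⟩
  refine Filter.limsup_le_of_le ?_ ?_
  · exact (Filter.isBoundedUnder_of ⟨0, fun n => by positivity⟩).isCoboundedUnder_le
  rw [Filter.eventually_inf_principal]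
  filter_upwards [Filter.eventually_ge_atTop (max (max n₀ k) (n1 + k))] with n hn hdvd
  have hn0 : n₀ ≤ n := by omega
  have hC : n - k + 1 ≤ n.choose (k - d) := by
    have h1 := Nat.choose_le_choose (n - (k - d)) (show n - (k - d) + 1 ≤ n by omega)
    rw [Nat.choose_succ_self_right, Nat.choose_symm (by omega)] at h1
    omega
  have hCr : 2 / ε ≤ (n.choose (k - d) : ℝ) := by
    refine hn1.trans ?_
    exact_mod_cast (by omega : n1 ≤ n.choose (k - d))
  have hC0 : (0 : ℝ) < n.choose (k - d) := lt_of_lt_of_le (by positivity) hCr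
  rw [div_le_iff₀ hC0]
  have hle : hThreshold k d l n ≤ ⌈(M + ε / 2) * (n.choose (k - d) : ℝ)⌉₊ :=
    Nat.sInf_le fun H hH hdeg => hn₀ n hn0 hdvd H hH ((Nat.le_ceil _).trans (by exact_mod_cast hdeg))
  have h1 : (hThreshold k d l n : ℝ) ≤ (M + ε / 2) * (n.choose (k - d) : ℝ) + 1 := by
    refine (Nat.cast_le.2 hle).trans (Nat.ceil_lt_add_one ?_).le
    have : 0 ≤ M + ε / 2 := by linarith
    positivity
  rw [div_le_iff₀ hε] at hCr
  linarith
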